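/- The cd-index of a Gorenstein* poset has non-negative integer coefficients: if Π is a Gorenstein* poset of rank n, then every coefficient of the cd-monomials in Ψ_Π(c,d) is a non-negative integer. -/

import Mathlib

open scoped Classical

noncomputable section

/-- The ring of polynomials in two non-commuting variables `a`, `b` (with rational
coefficients), in which `ab`-indices and `cd`-indices live. -/
abbrev NC := FreeAlgebra ℚ (Fin 2)

/-- The variable `a`. -/
def va : NC := FreeAlgebra.ι ℚ 0
/-- The variable `b`. -/
def vb : NC := FreeAlgebra.ι ℚ 1
/-- `c = a + b`. -/
def vc : NC := va + vb
/-- `d = ab + ba`. -/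
def vd : NC := va * vb + vb * va

/-- A `cd`-monomial, encoded as a list of booleans (`false` = `c`, `true` = `d`),
viewed inside `NC` via `c = a+b`, `d = ab+ba`. -/
def cdMonomial : List Bool → NC
  | [] => 1
  | s :: w => (if s then vd else vc) * cdMonomial w

/-- Degree of a `cd`-monomial (`c` has degree 1, `d` has degree 2). -/
def cdDeg (w : List Bool) : ℕ := (w.map fun s => if s then 2 else 1).sum

/-- Evaluation of an integer combination of `cd`-monomials in `NC`. -/
def cdEval (f : List Bool →₀ ℤ) : NC := f.sum fun w z => (z : ℚ) • cdMonomial w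

/-- The weight of a chain, computed from the (strictly increasing) list of absolute ranks
of its elements; `N` is the absolute rank of the (possibly formal) maximal element `1̂`.
For a list `[r₀, r₁, …, r_k]` this is
`(a-b)^(r₁-r₀-1) · b · (a-b)^(r₂-r₁-1) · b ⋯ b · (a-b)^(N-1-r_k)`. -/
def wtRanks (N : ℕ) : List ℕ → NC
  | [] => 1
  | [r] => (va - vb) ^ (N - 1 - r)
  | r :: s :: l => (va - vb) ^ (s - r - 1) * vb * wtRanks N (s :: l)


/-- A finite type has a finite `WithTop`. -/
instance {α : Type*} [Fintype α] : Fintype (WithTop α) := inferInstanceAs (Fintype (Option α))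

/-- A lexicographic sum of finite types is finite. -/
instance {α β : Type*} [Fintype α] [Fintype β] : Fintype (α ⊕ₗ β) :=
  inferInstanceAs (Fintype (α ⊕ β))

section Posets

variable {P : Type*} [Fintype P] [PartialOrder P]

/-- `y` is a chain of the subposet `S ⊆ P` whose minimal element is `m`, containing `m`
(chains of a poset always contain the minimal element `0̂ = m`). -/
def chainIn (S : Set P) (m : P) (y : Finset P) : Prop :=
  m ∈ y ∧ ↑y ⊆ S ∧ IsChain (· < ·) (↑y : Set P)

/-- The `ab`-index `Ψ` of the subposet `S ⊆ P` with minimal element `m`, of rank `n`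
(so the adjoined maximal element `1̂` has absolute rank `rk m + n + 1`); ranks of
elements are computed by the ambient rank function `rk`. -/
def absIndexOn (S : Set P) (m : P) (rk : P → ℕ) (n : ℕ) : NC :=
  ∑ y : Finset P,
    if chainIn S m y then wtRanks (rk m + n + 1) ((y.image rk).sort (· ≤ ·)) else 0

/-- The simplicial boundary operator relative to a chain `x`: a chain `y ⊇ x` is sent to
the signed sum of the chains `y ∖ {σ}` for `σ ∈ y ∖ x`, the sign of `σ` being determined
by its position in `y`.  Together with the grading by cardinality, this is the cellular
(chain) complex of the order complex computing (relative) simplicial homology. -/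
def bnd (x : Finset P) : (Finset P →₀ ℝ) →ₗ[ℝ] (Finset P →₀ ℝ) :=
  Finsupp.lsum ℝ fun y => LinearMap.id.smulRight
    (∑ σ ∈ y \ x, ((-1 : ℝ) ^ (y.filter fun τ => τ < σ).card) • Finsupp.single (y.erase σ) (1 : ℝ))

/-- The degree-`k` term of the cellular complex of (the order complex of) the subposet
`S` with minimal element `m`, relative to the chain `x`: the span of all chains `y ⊇ x`
in `S` with `k` elements. -/
def cellSpace (S : Set P) (m : P) (x : Finset P) (k : ℕ) : Submodule ℝ (Finset P →₀ ℝ) :=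
  Submodule.span ℝ
    {f | ∃ y : Finset P, chainIn S m y ∧ x ⊆ y ∧ y.card = k ∧ f = Finsupp.single y 1}

/-- The homological Gorenstein condition for the subposet `S ⊆ P` with minimal element
`m`, of rank `n`: the order complex is a real homology sphere, i.e. for every chain `x`
the cellular complex of the interval `[x, 1̂)` of the order complex is exact except at the
top (chains of `n+1` elements), where the homology is 1-dimensional. -/
def GorensteinOn (S : Set P) (m : P) (n : ℕ) : Prop :=
  ∀ x : Finset P, chainIn S m x → ∀ k : ℕ,
    Module.finrank ℝ ↥(LinearMap.ker (bnd x) ⊓ cellSpace S m x k) =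
      Module.finrank ℝ ↥(Submodule.map (bnd x) (cellSpace S m x (k + 1))) +
        (if k = n + 1 then 1 else 0)

/-- `S ⊆ P` is a graded (sub)poset of rank `n` with minimal element `m`: covers in `S`
increase the ambient rank `rk` by one, and all maximal elements of `S` have rank
`rk m + n`. -/
def IsGradedOn (S : Set P) (m : P) (rk : P → ℕ) (n : ℕ) : Prop :=
  m ∈ S ∧ (∀ x ∈ S, m ≤ x) ∧
    (∀ a ∈ S, ∀ b ∈ S, a < b → (¬ ∃ c ∈ S, a < c ∧ c < b) → rk b = rk a + 1) ∧
    (∀ a ∈ S, (∀ b ∈ S, ¬ a < b) → rk a = rk m + n)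

/-- `S ⊆ P` (with minimal element `m` and ambient rank function `rk`) is a Gorenstein*
poset of rank `n`. -/
def IsGorensteinStarOn (S : Set P) (m : P) (rk : P → ℕ) (n : ℕ) : Prop :=
  IsGradedOn S m rk n ∧ GorensteinOn S m n

/-- The pair `(S, B)` (with minimal element `m` and ambient rank function `rk`) is a
near-Gorenstein* poset of rank `n` with boundary `B`: `B` is an order ideal of `S` of
rank `n-1` which is Gorenstein* of rank `n-1`, and the order complex of `S` is a real
homology ball with boundary the order complex of `B`: for every chain `x` of `S`, the
cellular complex of `[x, 1̂)` is exact, except that when `x` is not a chain of `B` the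
homology at the top is 1-dimensional. -/
def IsNearGorensteinStarOn (S B : Set P) (m : P) (rk : P → ℕ) (n : ℕ) : Prop :=
  IsGradedOn S m rk n ∧ B ⊆ S ∧ (∀ σ ∈ B, ∀ τ ∈ S, τ ≤ σ → τ ∈ B) ∧
    IsGradedOn B m rk (n - 1) ∧ GorensteinOn B m (n - 1) ∧
    ∀ x : Finset P, chainIn S m x → ∀ k : ℕ,
      Module.finrank ℝ ↥(LinearMap.ker (bnd x) ⊓ cellSpace S m x k) =
        Module.finrank ℝ ↥(Submodule.map (bnd x) (cellSpace S m x (k + 1))) +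
          (if k = n + 1 ∧ ¬(↑x ⊆ B) then 1 else 0)

end Posets

end

section Rank

open Module

set_option linter.unusedSectionVars false

lemma finrank_map_add_finrank_inf_ker {M N : Type*} [AddCommGroup M] [Module ℝ M]
    [FiniteDimensional ℝ M] [AddCommGroup N] [Module ℝ N] (f : M →ₗ[ℝ] N)
    (W : Submodule ℝ M) :
    finrank ℝ (W.map f) + finrank ℝ ↥(W ⊓ LinearMap.ker f) = finrank ℝ W := by
  have h := LinearMap.finrank_range_add_finrank_ker (f ∘ₗ W.subtype)
  rwa [LinearMap.range_comp, Submodule.range_subtype, LinearMap.ker_comp,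
    ← Submodule.finrank_map_subtype_eq, Submodule.map_comap_subtype] at h

variable {X Y X' Y' : Type*} [AddCommGroup X] [Module ℝ X] [FiniteDimensional ℝ X]
  [AddCommGroup Y] [Module ℝ Y] [FiniteDimensional ℝ Y]
  [AddCommGroup X'] [Module ℝ X'] [FiniteDimensional ℝ X']
  [AddCommGroup Y'] [Module ℝ Y'] [FiniteDimensional ℝ Y']

/-- The rank of a bilinear form. -/
noncomputable def bilinRank (B : X →ₗ[ℝ] Y →ₗ[ℝ] ℝ) : ℕ := finrank ℝ (LinearMap.range B)


lemma flip_eq_dualMap_comp (B : X →ₗ[ℝ] Y →ₗ[ℝ] ℝ) :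
    B.flip = B.dualMap ∘ₗ (Dual.eval ℝ Y) := by
  ext y x; rfl

lemma range_flip_eq (B : X →ₗ[ℝ] Y →ₗ[ℝ] ℝ) :
    LinearMap.range B.flip = LinearMap.range B.dualMap := by
  rw [flip_eq_dualMap_comp, LinearMap.range_comp_of_range_eq_top]
  exact LinearMap.range_eq_top.2 (evalEquiv ℝ Y).surjective

lemma bilinRank_flip (B : X →ₗ[ℝ] Y →ₗ[ℝ] ℝ) : bilinRank B.flip = bilinRank B := by
  unfold bilinRank
  rw [range_flip_eq, LinearMap.finrank_range_dualMap_eq_finrank_range]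

lemma bilinRank_eq_of_ker (B : X →ₗ[ℝ] Y →ₗ[ℝ] ℝ) (B' : X →ₗ[ℝ] Y' →ₗ[ℝ] ℝ)
    (h : ∀ x, B x = 0 ↔ B' x = 0) : bilinRank B = bilinRank B' := by
  have hk : LinearMap.ker B = LinearMap.ker B' := by ext x; simp [h]
  have h1 := LinearMap.finrank_range_add_finrank_ker B
  have h2 := LinearMap.finrank_range_add_finrank_ker B'
  unfold bilinRank
  rw [hk] at h1
  omega

/-- A functional vanishing on the radical of a symmetric form is represented by the form. -/
lemma exists_eq_of_ker_le (B : X →ₗ[ℝ] X →ₗ[ℝ] ℝ) (hB : B.flip = B) (φ : X →ₗ[ℝ] ℝ)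
    (h : ∀ u, B u = 0 → φ u = 0) : ∃ v, B v = φ := by
  have h1 : φ ∈ LinearMap.range B.dualMap := by
    rw [LinearMap.range_dualMap_eq_dualAnnihilator_ker, Submodule.mem_dualAnnihilator]
    intro w hw
    exact h w hw
  rw [← range_flip_eq, hB] at h1
  exact h1

/-- The rank of an orthogonal sum of bilinear forms is the sum of the ranks. -/
lemma bilinRank_pi {ι : Type*} [Fintype ι] (B : ι → X →ₗ[ℝ] Y →ₗ[ℝ] ℝ) :
    bilinRank (∑ i, (B i).compl₁₂ (LinearMap.proj i : (ι → X) →ₗ[ℝ] X)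
      (LinearMap.proj i : (ι → Y) →ₗ[ℝ] Y)) = ∑ i, bilinRank (B i) := by
  set T := ∑ i, (B i).compl₁₂ (LinearMap.proj i : (ι → X) →ₗ[ℝ] X)
      (LinearMap.proj i : (ι → Y) →ₗ[ℝ] Y) with hT
  have hTa : ∀ α γ, T α γ = ∑ i, B i (α i) (γ i) := by
    intro α γ; simp [hT, LinearMap.sum_apply]
  have hker : ∀ α, T α = 0 ↔ ∀ i, B i (α i) = 0 := by
    intro α
    constructor
    · intro h i
      ext y
      have := hTa α (Pi.single i y)
      rw [h, Finset.sum_eq_single i] at this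
      · simpa using this.symm
      · intro j _ hj; simp [Pi.single_eq_of_ne hj]
      · simp
    · intro h
      refine LinearMap.ext fun γ => ?_
      rw [hTa]; simp [h]
  let e : LinearMap.ker T ≃ₗ[ℝ] (∀ i, LinearMap.ker (B i)) :=
    { toFun := fun α i => ⟨α.1 i, (hker α.1).1 α.2 i⟩
      map_add' := fun _ _ => rfl
      map_smul' := fun _ _ => rfl
      invFun := fun α => ⟨fun i => (α i).1, (hker _).2 fun i => (α i).2⟩
      left_inv := fun _ => rfl
      right_inv := fun _ => rfl }
  have h1 := LinearMap.finrank_range_add_finrank_ker T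
  rw [e.finrank_eq, finrank_pi_fintype, finrank_pi_fintype] at h1
  have h2 : ∑ i, (finrank ℝ (LinearMap.range (B i)) + finrank ℝ (LinearMap.ker (B i)))
      = ∑ _i : ι, finrank ℝ X :=
    Finset.sum_congr rfl fun i _ => LinearMap.finrank_range_add_finrank_ker (B i)
  rw [Finset.sum_add_distrib] at h2
  unfold bilinRank
  omega

/-- Rank defect of restricting the functionals in the range of a form to a subspace. -/
lemma bilinRank_compl₁₂_add {E F : Type*} [AddCommGroup E] [Module ℝ E]
    [FiniteDimensional ℝ E] [AddCommGroup F] [Module ℝ F] [FiniteDimensional ℝ F]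
    (B : X →ₗ[ℝ] Y →ₗ[ℝ] ℝ) (k : E →ₗ[ℝ] X) (k' : F →ₗ[ℝ] Y) :
    bilinRank (B.compl₁₂ k k') +
      finrank ℝ ↥(LinearMap.range (B ∘ₗ k) ⊓ LinearMap.ker k'.dualMap)
      = bilinRank (B ∘ₗ k) := by
  have h := finrank_map_add_finrank_inf_ker k'.dualMap (LinearMap.range (B ∘ₗ k))
  rw [← LinearMap.range_comp] at h
  exact h

lemma bilinRank_compl₁₂_id {F : Type*} [AddCommGroup F] [Module ℝ F]
    [FiniteDimensional ℝ F] (B : X →ₗ[ℝ] Y →ₗ[ℝ] ℝ) (k' : F →ₗ[ℝ] Y) :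
    bilinRank (B.compl₁₂ LinearMap.id k') = bilinRank (B.flip ∘ₗ k') := by
  rw [← bilinRank_flip]
  rfl

/-- The rank of the form induced on `J × J'` when `I ⊆ J`, `I' ⊆ J'` are orthogonal to
`J'`, `J` and these orthogonal complements are as small as possible. -/
lemma bilinRank_restrict {J J' : Type*} [AddCommGroup J] [Module ℝ J] [FiniteDimensional ℝ J]
    [AddCommGroup J'] [Module ℝ J'] [FiniteDimensional ℝ J']
    (B : X →ₗ[ℝ] Y →ₗ[ℝ] ℝ) (i : X' →ₗ[ℝ] X) (i' : Y' →ₗ[ℝ] Y) (j : J →ₗ[ℝ] X)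
    (j' : J' →ₗ[ℝ] Y) (hi : LinearMap.range i ≤ LinearMap.range j)
    (hij : ∀ a b, B (i a) (j' b) = 0) (hji : ∀ a b, B (j a) (i' b) = 0)
    (h1 : bilinRank B ≤ bilinRank (B ∘ₗ j) + bilinRank (B.flip ∘ₗ i'))
    (h2 : bilinRank B ≤ bilinRank (B.flip ∘ₗ j') + bilinRank (B ∘ₗ i)) :
    bilinRank (B.compl₁₂ j j') + bilinRank (B ∘ₗ i) + bilinRank (B.flip ∘ₗ i')
      = bilinRank B := by
  have k1 := bilinRank_compl₁₂_add B j j'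
  have k2 := bilinRank_compl₁₂_add B (LinearMap.id : X →ₗ[ℝ] X) j'
  have k3 := bilinRank_compl₁₂_add B (LinearMap.id : X →ₗ[ℝ] X) i'
  rw [bilinRank_compl₁₂_id, LinearMap.comp_id] at k2 k3
  have m1 : finrank ℝ ↥(LinearMap.range (B ∘ₗ j) ⊓ LinearMap.ker j'.dualMap)
      ≤ finrank ℝ ↥(LinearMap.range B ⊓ LinearMap.ker j'.dualMap) :=
    Submodule.finrank_mono (inf_le_inf_right _ (LinearMap.range_comp_le_range _ _))
  have m2 : bilinRank (B ∘ₗ i)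
      ≤ finrank ℝ ↥(LinearMap.range (B ∘ₗ j) ⊓ LinearMap.ker j'.dualMap) := by
    apply Submodule.finrank_mono
    rintro _ ⟨a, rfl⟩
    refine ⟨?_, ?_⟩
    · obtain ⟨b, hb⟩ := hi ⟨a, rfl⟩
      exact ⟨b, by simp [hb]⟩
    · change j'.dualMap _ = 0
      ext b
      exact hij a b
  have m3 : bilinRank (B ∘ₗ j)
      ≤ finrank ℝ ↥(LinearMap.range B ⊓ LinearMap.ker i'.dualMap) := by
    apply Submodule.finrank_mono
    rintro _ ⟨a, rfl⟩
    refine ⟨⟨j a, rfl⟩, ?_⟩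
    change i'.dualMap _ = 0
    ext b
    exact hji a b
  omega

end Rank

section Form

variable {I J V : Type*} [Fintype I] [Fintype J] [AddCommGroup V] [Module ℝ V]

/-- The bilinear form on `V`-valued vectors with the given matrix of bilinear forms. -/
noncomputable def matForm (K : I → J → V →ₗ[ℝ] V →ₗ[ℝ] ℝ) : (I → V) →ₗ[ℝ] (J → V) →ₗ[ℝ] ℝ :=
  ∑ i, ∑ j, (K i j).compl₁₂ (LinearMap.proj i) (LinearMap.proj j)

lemma matForm_apply (K : I → J → V →ₗ[ℝ] V →ₗ[ℝ] ℝ) (α : I → V) (γ : J → V) :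
    matForm K α γ = ∑ i, ∑ j, K i j (α i) (γ j) := by
  simp [matForm, LinearMap.sum_apply]

lemma matForm_eq_zero_iff (K : I → J → V →ₗ[ℝ] V →ₗ[ℝ] ℝ) (α : I → V) :
    matForm K α = 0 ↔ ∀ j, ∑ i, K i j (α i) = 0 := by
  constructor
  · intro h j
    ext w
    have h1 := matForm_apply K α (Pi.single j w)
    rw [h, Finset.sum_comm, Finset.sum_eq_single j] at h1
    · simpa [LinearMap.sum_apply] using h1.symm
    · intro b _ hb; simp [Pi.single_eq_of_ne hb]
    · simp
  · intro h
    refine LinearMap.ext fun γ => ?_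
    rw [matForm_apply, Finset.sum_comm]
    simp only [← LinearMap.sum_apply, h]
    simp

lemma matForm_flip (K : I → J → V →ₗ[ℝ] V →ₗ[ℝ] ℝ) :
    (matForm K).flip = matForm fun j i => (K i j).flip := by
  refine LinearMap.ext fun γ => LinearMap.ext fun α => ?_
  rw [LinearMap.flip_apply, matForm_apply, matForm_apply, Finset.sum_comm]
  rfl

end Form

section Generic

open Module

variable {P V : Type*} [Fintype P] [AddCommGroup V] [Module ℝ V] [FiniteDimensional ℝ V]

/-- For all but finitely many `s`, the radical of `A + s B` lies in that of `B`. -/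
lemma finite_setOf_radical (A B : V →ₗ[ℝ] V →ₗ[ℝ] ℝ) (hA : A.flip = A) (hB : B.flip = B)
    (hd : ∀ v, B v v = 0 → B v = 0) :
    {s : ℝ | ∃ v, (A + s • B) v = 0 ∧ B v ≠ 0}.Finite := by
  set T := {s : ℝ | ∃ v, (A + s • B) v = 0 ∧ B v ≠ 0}
  choose v hv using fun s : T => s.2
  have hA' : ∀ x y, A x y = A y x := fun x y => by
    conv_lhs => rw [← hA]
    rfl
  have hB' : ∀ x y, B x y = B y x := fun x y => by
    conv_lhs => rw [← hB]
    rfl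
  have horth : ∀ s t : T, s ≠ t → B (v s) (v t) = 0 := by
    intro s t hst
    have h1 : A (v s) (v t) + s.1 * B (v s) (v t) = 0 := by
      simpa using LinearMap.congr_fun (hv s).1 (v t)
    have h2 : A (v t) (v s) + t.1 * B (v t) (v s) = 0 := by
      simpa using LinearMap.congr_fun (hv t).1 (v s)
    rw [hA' (v t), hB' (v t)] at h2
    have h3 : (s.1 - t.1) * B (v s) (v t) = 0 := by linarith
    rcases mul_eq_zero.1 h3 with h | h
    · exact absurd (Subtype.ext (sub_eq_zero.1 h)) hst
    · exact h
  have hli : LinearIndependent ℝ v := by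
    rw [linearIndependent_iff']
    intro S c hc s hs
    have h1 : ∑ t ∈ S, c t * B (v s) (v t) = 0 := by
      simpa using congrArg (B (v s)) hc
    rw [Finset.sum_eq_single s] at h1
    · rcases mul_eq_zero.1 h1 with h | h
      · exact h
      · exact absurd (hd _ h) (hv s).2
    · intro t _ hts
      rw [horth s t hts.symm, mul_zero]
    · exact fun h => absurd hs h
  have : Finite T := hli.finite
  exact T.toFinite

/-- A symmetric form has the same radical as some form which is definite on the quotient. -/
lemma exists_definite_form (q : V →ₗ[ℝ] V →ₗ[ℝ] ℝ) (hq : q.flip = q) :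
    ∃ B : V →ₗ[ℝ] V →ₗ[ℝ] ℝ, B.flip = B ∧ (∀ v, B v v = 0 → B v = 0) ∧
      ∀ v, B v = 0 ↔ q v = 0 := by
  let e := Module.finBasis ℝ V
  let B : V →ₗ[ℝ] V →ₗ[ℝ] ℝ := ∑ k, (q (e k)).smulRight (q (e k))
  have hBa : ∀ v w, B v w = ∑ k, q (e k) v * q (e k) w := by
    intro v w; simp [B, LinearMap.sum_apply]
  have hq' : ∀ x y, q x y = q y x := fun x y => by
    conv_lhs => rw [← hq]
    rfl
  have h1 : ∀ v, B v v = 0 → q v = 0 := by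
    intro v hv
    rw [hBa, Finset.sum_eq_zero_iff_of_nonneg fun k _ => mul_self_nonneg _] at hv
    refine e.ext fun k => ?_
    rw [hq']
    simpa using hv k (Finset.mem_univ k)
  have h2 : ∀ v, q v = 0 → B v = 0 := by
    intro v hv
    refine LinearMap.ext fun w => ?_
    rw [hBa]
    refine Finset.sum_eq_zero fun k _ => ?_
    rw [hq', hv]; simp
  refine ⟨B, ?_, fun v hv => h2 v (h1 v hv), fun v => ⟨fun h => h1 v (by rw [h]; rfl), h2 v⟩⟩
  refine LinearMap.ext fun v => LinearMap.ext fun w => ?_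
  rw [LinearMap.flip_apply, hBa, hBa]
  exact Finset.sum_congr rfl fun k _ => mul_comm _ _

/-- Simultaneous generic combinations of symmetric forms: the radical is the common radical
of the forms with nonzero coefficient. -/
lemma exists_generic_forms (ε : P → P → ℝ) (q : P → V →ₗ[ℝ] V →ₗ[ℝ] ℝ)
    (hq : ∀ z, (q z).flip = q z) :
    ∃ b : P → V →ₗ[ℝ] V →ₗ[ℝ] ℝ, (∀ z, (b z).flip = b z) ∧
      ∀ y u, (∑ z, ε y z • b z) u = 0 ↔ ∀ z, ε y z ≠ 0 → q z u = 0 := by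
  choose B hBs hBd hBq using fun z => exists_definite_form (q z) (hq z)
  have hflip : ∀ (F : Finset P) (c : P → ℝ),
      (∑ z ∈ F, c z • B z).flip = ∑ z ∈ F, c z • B z := by
    intro F c
    refine LinearMap.ext fun v => LinearMap.ext fun w => ?_
    simp only [LinearMap.flip_apply, LinearMap.sum_apply, LinearMap.smul_apply]
    refine Finset.sum_congr rfl fun z _ => ?_
    conv_lhs => rw [← hBs]
    rfl
  have key : ∀ F : Finset P, ∃ s : P → ℝ, ∀ y u, (∑ z ∈ F, (ε y z * s z) • B z) u = 0 ↔
      ∀ z ∈ F, ε y z ≠ 0 → q z u = 0 := by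
    intro F
    induction F using Finset.induction_on with
    | empty => exact ⟨0, by simp⟩
    | insert z₀ F hz ih =>
      obtain ⟨s, hs⟩ := ih
      have hfin : (⋃ y : P, {t : ℝ | ∃ v, ((∑ z ∈ F, (ε y z * s z) • B z) +
          t • (ε y z₀ • B z₀)) v = 0 ∧ (ε y z₀ • B z₀) v ≠ 0}).Finite := by
        refine Set.finite_iUnion fun y => ?_
        refine finite_setOf_radical _ _ (hflip _ _) ?_ ?_
        · have := hflip {z₀} fun z => ε y z
          simpa using this
        · intro v hv
          rw [LinearMap.smul_apply, LinearMap.smul_apply, smul_eq_mul, mul_eq_zero] at hv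
          rcases hv with hv | hv
          · simp [hv]
          · simp [hBd _ _ hv]
      obtain ⟨t, ht⟩ := hfin.exists_notMem
      refine ⟨Function.update s z₀ t, fun y u => ?_⟩
      have e1 : (∑ z ∈ insert z₀ F, (ε y z * Function.update s z₀ t z) • B z)
          = (∑ z ∈ F, (ε y z * s z) • B z) + t • (ε y z₀ • B z₀) := by
        rw [Finset.sum_insert hz, add_comm, Function.update_self, smul_smul, mul_comm t]
        congr 1
        refine Finset.sum_congr rfl fun z hzF => ?_
        rw [Function.update_of_ne (by rintro rfl; exact hz hzF)]
      have e2 : (ε y z₀ • B z₀) u = 0 ↔ (ε y z₀ ≠ 0 → q z₀ u = 0) := by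
        rw [LinearMap.smul_apply, smul_eq_zero, hBq]
        tauto
      rw [e1, Finset.forall_mem_insert, ← e2, ← hs]
      constructor
      · intro h
        have h0 : (ε y z₀ • B z₀) u = 0 := by
          by_contra hne
          exact ht (Set.mem_iUnion.2 ⟨y, u, h, hne⟩)
        refine ⟨h0, ?_⟩
        rw [LinearMap.add_apply, LinearMap.smul_apply t, h0, smul_zero, add_zero] at h
        exact h
      · rintro ⟨h0, h1⟩
        rw [LinearMap.add_apply, LinearMap.smul_apply t, h0, smul_zero, add_zero, h1]
  obtain ⟨s, hs⟩ := key Finset.univ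
  refine ⟨fun z => s z • B z, fun z => ?_, fun y u => ?_⟩
  · simpa using hflip {z} s
  · have := hs y u
    simp only [smul_smul]
    simpa using this

end Generic

section Data

set_option linter.unusedSectionVars false

universe u

variable {P : Type u} {n : ℕ}

/-- Extend a tuple of elements to all natural numbers. -/
def ext0 (bot : P) (g : Fin (n + 1) → P) : ℕ → P :=
  fun i => if h : i < n + 1 then g ⟨i, h⟩ else bot

/-- Truncate a sequence. -/
def trunc (n : ℕ) (w : ℕ → P) : Fin (n + 1) → P := fun i => w i

lemma ext0_trunc (bot : P) (w : ℕ → P) {i : ℕ} (hi : i ≤ n) :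
    ext0 bot (trunc n w) i = w i := by
  simp [ext0, trunc, Nat.lt_succ_of_le hi]

/-- Merge three sequences along index sets `A`, `S`, starting at `bot`. -/
def mg (bot : P) (A S : Finset ℕ) (f g h : ℕ → P) : ℕ → P :=
  fun i => if i = 0 then bot else if i ∈ A then f i else if i ∈ S then g i else h i

lemma mg_insert (bot : P) (A S : Finset ℕ) (f g h : ℕ → P) {i : ℕ} (hi : i ≠ 0) (x : P) :
    mg bot (insert i A) S (Function.update f i x) g h
      = Function.update (mg bot A S f g h) i x := by
  funext k
  by_cases hk : k = i
  · subst hk; simp [mg, hi]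
  · simp [mg, hk]

variable [Fintype P]

/-- The product of the values of `ε` along the first `m` steps of a sequence. -/
noncomputable def oo (ε : P → P → ℝ) (m : ℕ) (w : ℕ → P) : ℝ :=
  ∏ k ∈ Finset.range m, ε (w k) (w (k + 1))

lemma oo_congr (ε : P → P → ℝ) {m : ℕ} {w w' : ℕ → P} (h : ∀ k ≤ m, w k = w' k) :
    oo ε m w = oo ε m w' := by
  refine Finset.prod_congr rfl fun k hk => ?_
  have := Finset.mem_range.1 hk
  rw [h k (by omega), h (k + 1) (by omega)]

lemma oo_succ (ε : P → P → ℝ) (m : ℕ) (w : ℕ → P) :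
    oo ε (m + 1) w = oo ε m w * ε (w m) (w (m + 1)) := Finset.prod_range_succ _ _

variable {V : Type u} [AddCommGroup V] [Module ℝ V]

/-- The form attached to a full sequence of length `m`. -/
noncomputable def wform (ε : P → P → ℝ) (m : ℕ) (q : P → V →ₗ[ℝ] V →ₗ[ℝ] ℝ) (w : ℕ → P) :
    V →ₗ[ℝ] V →ₗ[ℝ] ℝ := oo ε m w • q (w m)

lemma wform_congr (ε : P → P → ℝ) {m : ℕ} (q : P → V →ₗ[ℝ] V →ₗ[ℝ] ℝ) {w w' : ℕ → P}
    (h : ∀ k ≤ m, w k = w' k) : wform ε m q w = wform ε m q w' := by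
  rw [wform, wform, oo_congr ε h, h m le_rfl]

/-- The matrix form of the sequences, with rows indexed by the choices on `S` and columns by
the choices outside `A ∪ S`, the choices on `A` being fixed. -/
noncomputable def seqForm (n : ℕ) (ε : P → P → ℝ) (bot : P) (m : ℕ)
    (q : P → V →ₗ[ℝ] V →ₗ[ℝ] ℝ) (A S : Finset ℕ) (f : ℕ → P) :
    ((Fin (n + 1) → P) → V) →ₗ[ℝ] ((Fin (n + 1) → P) → V) →ₗ[ℝ] ℝ :=
  matForm fun g h => wform ε m q (mg bot A S f (ext0 bot g) (ext0 bot h))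

/-- The rank of `seqForm`. -/
noncomputable def seqRank (n : ℕ) (ε : P → P → ℝ) (bot : P) (m : ℕ)
    (q : P → V →ₗ[ℝ] V →ₗ[ℝ] ℝ) (A S : Finset ℕ) (f : ℕ → P) : ℕ :=
  bilinRank (seqForm n ε bot m q A S f)

variable (ε : P → P → ℝ) (bot : P) {m : ℕ} {q : P → V →ₗ[ℝ] V →ₗ[ℝ] ℝ}

lemma wform_flip (hq : ∀ z, (q z).flip = q z) (w : ℕ → P) :
    (wform ε m q w).flip = wform ε m q w := by
  conv_rhs => rw [wform, ← hq]
  rfl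

lemma seqForm_flip (hq : ∀ z, (q z).flip = q z) {A S T : Finset ℕ} (f : ℕ → P)
    (h : ∀ i, 1 ≤ i → i ≤ m → i ∉ A → (i ∈ T ↔ i ∉ S)) :
    (seqForm n ε bot m q A S f).flip = seqForm n ε bot m q A T f := by
  rw [seqForm, matForm_flip, seqForm]
  congr 1
  funext a b
  rw [wform_flip ε hq]
  refine wform_congr ε q fun k hk => ?_
  by_cases h0 : k = 0
  · simp [mg, h0]
  by_cases hA : k ∈ A
  · simp [mg, hA]
  have := h k (by omega) hk hA
  by_cases hS : k ∈ S <;> simp [mg, h0, hA, hS, this]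

lemma seqRank_flip [FiniteDimensional ℝ V] (hq : ∀ z, (q z).flip = q z) {A S T : Finset ℕ}
    (f : ℕ → P) (h : ∀ i, 1 ≤ i → i ≤ m → i ∉ A → (i ∈ T ↔ i ∉ S)) :
    seqRank n ε bot m q A S f = seqRank n ε bot m q A T f := by
  rw [seqRank, ← bilinRank_flip, seqForm_flip ε bot hq f h, seqRank]

lemma seqForm_eq_zero_iff (A S : Finset ℕ) (f : ℕ → P) (α : (Fin (n + 1) → P) → V) :
    seqForm n ε bot m q A S f α = 0 ↔
      ∀ h : Fin (n + 1) → P,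
        ∑ g, wform ε m q (mg bot A S f (ext0 bot g) (ext0 bot h)) (α g) = 0 :=
  matForm_eq_zero_iff _ _

lemma seqForm_apply (A S : Finset ℕ) (f : ℕ → P) (α γ : (Fin (n + 1) → P) → V) :
    seqForm n ε bot m q A S f α γ = ∑ g, ∑ h,
      wform ε m q (mg bot A S f (ext0 bot g) (ext0 bot h)) (α g) (γ h) :=
  matForm_apply _ _ _

/-- The hypothesis under which a family of forms is handled by induction: exactness of the
relations between ranks. -/
def RankExact (n : ℕ) (ε : P → P → ℝ) (bot : P) (m : ℕ)
    (q : P → V →ₗ[ℝ] V →ₗ[ℝ] ℝ) : Prop :=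
  ∀ i, 1 ≤ i → i + 1 ≤ m → ∀ A ⊆ Finset.Icc 1 m, ∀ S ⊆ Finset.Icc 1 m, ∀ f : ℕ → P,
    i ∉ A → i ∉ S →
    ∑ x, seqRank n ε bot m q (insert i A) S (Function.update f i x)
      = seqRank n ε bot m q A S f + seqRank n ε bot m q A (insert i S) f

/-- `Q` is obtained from `q` by contracting the last step generically. -/
def IsContraction (q Q : P → V →ₗ[ℝ] V →ₗ[ℝ] ℝ) : Prop :=
  ∀ y u, Q y u = 0 ↔ ∀ z, ε y z ≠ 0 → q z u = 0

/-- Two sequences which differ only at `m + 1` give the same weighted sums. -/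
lemma seqRank_contract [FiniteDimensional ℝ V] {Q : P → V →ₗ[ℝ] V →ₗ[ℝ] ℝ}
    (hQ : IsContraction ε q Q) {A S : Finset ℕ} (f : ℕ → P) (hm : m + 1 ≤ n)
    (hA : m + 1 ∉ A) (hS : m + 1 ∉ S) (h : m = 0 ∨ m ∈ A ∨ m ∉ S) :
    seqRank n ε bot (m + 1) q A S f = seqRank n ε bot m Q A S f := by
  refine bilinRank_eq_of_ker _ _ fun α => ?_
  rw [seqForm_eq_zero_iff, seqForm_eq_zero_iff]
  -- the value at `m` does not depend on the row
  have hy : ∀ g h' : ℕ → P, mg bot A S f g h' m = mg bot A ∅ f h' h' m := by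
    intro g h'
    rcases h with h | h | h <;> simp [mg, h]
  have e1 : ∀ h' : Fin (n + 1) → P,
      ∑ g, wform ε m Q (mg bot A S f (ext0 bot g) (ext0 bot h')) (α g)
        = Q (mg bot A ∅ f (ext0 bot h') (ext0 bot h') m)
          (∑ g, oo ε m (mg bot A S f (ext0 bot g) (ext0 bot h')) • α g) := by
    intro h'
    rw [map_sum]
    refine Finset.sum_congr rfl fun g _ => ?_
    rw [wform, hy, LinearMap.smul_apply, map_smul]
  have e2 : ∀ h' : Fin (n + 1) → P,
      ∑ g, wform ε (m + 1) q (mg bot A S f (ext0 bot g) (ext0 bot h')) (α g)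
        = ε (mg bot A ∅ f (ext0 bot h') (ext0 bot h') m) (ext0 bot h' (m + 1)) •
          q (ext0 bot h' (m + 1))
          (∑ g, oo ε m (mg bot A S f (ext0 bot g) (ext0 bot h')) • α g) := by
    intro h'
    rw [map_sum, Finset.smul_sum]
    refine Finset.sum_congr rfl fun g _ => ?_
    have : mg bot A S f (ext0 bot g) (ext0 bot h') (m + 1) = ext0 bot h' (m + 1) := by
      simp [mg, hA, hS]
    rw [wform, oo_succ, hy, this, LinearMap.smul_apply, map_smul, smul_smul, mul_comm]
  simp only [e1, e2]
  constructor
  · intro H h'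
    rw [hQ]
    intro z hz
    have := H (trunc n (Function.update (ext0 bot h') (m + 1) z))
    have hlow : ∀ k ≤ m, ext0 bot (trunc n (Function.update (ext0 bot h') (m + 1) z)) k
        = ext0 bot h' k := by
      intro k hk
      rw [ext0_trunc bot _ (by omega), Function.update_of_ne (by omega)]
    have hmg : ∀ (S : Finset ℕ) (g g' : ℕ → P), (∀ k ≤ m, g k = g' k) → ∀ k ≤ m,
        mg bot A S f g (ext0 bot (trunc n (Function.update (ext0 bot h') (m + 1) z))) k
        = mg bot A S f g' (ext0 bot h') k := by
      intro S g g' hg k hk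
      simp only [mg, hlow k hk, hg k hk]
    rw [hmg ∅ _ _ hlow m le_rfl, ext0_trunc bot _ hm, Function.update_self] at this
    simp only [fun g => oo_congr ε (hmg S (ext0 bot g) _ fun _ _ => rfl)] at this
    rcases smul_eq_zero.1 this with h0 | h0
    · exact absurd h0 hz
    · exact h0
  · intro H h'
    by_cases h0 : ε (mg bot A ∅ f (ext0 bot h') (ext0 bot h') m) (ext0 bot h' (m + 1)) = 0
    · rw [h0, zero_smul]
    · rw [(hQ _ _).1 (H h') _ h0, smul_zero]

end Data

section Derived

set_option linter.unusedSectionVars false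

universe u

variable {P : Type u} [Fintype P] {n : ℕ} {V : Type u} [AddCommGroup V] [Module ℝ V]
  [FiniteDimensional ℝ V] (ε : P → P → ℝ) (bot : P) {m : ℕ}
  (Q : P → V →ₗ[ℝ] V →ₗ[ℝ] ℝ)

/-- Families of vectors that are `ε`-closed with respect to `Q`. -/
noncomputable def derivedSpace : Submodule ℝ (P → V) :=
  LinearMap.ker (LinearMap.pi fun y => ∑ x, ε y x • (Q x ∘ₗ LinearMap.proj x) :
    (P → V) →ₗ[ℝ] (P → V →ₗ[ℝ] ℝ))

lemma mem_derivedSpace {u : P → V} :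
    u ∈ derivedSpace ε Q ↔ ∀ y, ∑ x, ε y x • Q x (u x) = 0 := by
  simp [derivedSpace, funext_iff, LinearMap.sum_apply]

/-- The derived family of forms. -/
noncomputable def derivedForm (y : P) :
    derivedSpace ε Q →ₗ[ℝ] derivedSpace ε Q →ₗ[ℝ] ℝ :=
  (∑ x, ε y x • (Q x).compl₁₂ (LinearMap.proj x : (P → V) →ₗ[ℝ] V)
    (LinearMap.proj x : (P → V) →ₗ[ℝ] V)).compl₁₂
    (derivedSpace ε Q).subtype (derivedSpace ε Q).subtype

lemma derivedForm_apply (y : P) (u v : derivedSpace ε Q) :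
    derivedForm ε Q y u v = ∑ x, ε y x * Q x (u.1 x) (v.1 x) := by
  simp [derivedForm, LinearMap.sum_apply]

lemma symm_apply {q : V →ₗ[ℝ] V →ₗ[ℝ] ℝ} (hq : q.flip = q) (v w : V) : q v w = q w v := by
  conv_lhs => rw [← hq]
  rfl

lemma derivedForm_flip (hQ : ∀ x, (Q x).flip = Q x) (y : P) :
    (derivedForm ε Q y).flip = derivedForm ε Q y := by
  refine LinearMap.ext fun u => LinearMap.ext fun v => ?_
  rw [LinearMap.flip_apply, derivedForm_apply, derivedForm_apply]
  exact Finset.sum_congr rfl fun x _ => by rw [symm_apply (hQ x)]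

/-- The orthogonal sum of the forms with the value at `m + 1` fixed. -/
noncomputable def sumForm (n : ℕ) (m : ℕ) (A S : Finset ℕ) (f : ℕ → P) :
    (P → (Fin (n + 1) → P) → V) →ₗ[ℝ] (P → (Fin (n + 1) → P) → V) →ₗ[ℝ] ℝ :=
  ∑ x, (seqForm n ε bot (m + 1) Q (insert (m + 1) A) S (Function.update f (m + 1) x)).compl₁₂
    (LinearMap.proj x : (P → (Fin (n + 1) → P) → V) →ₗ[ℝ] ((Fin (n + 1) → P) → V))
    (LinearMap.proj x : (P → (Fin (n + 1) → P) → V) →ₗ[ℝ] ((Fin (n + 1) → P) → V))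

lemma wform_update (m : ℕ) (w : ℕ → P) (x : P) :
    wform ε (m + 1) Q (Function.update w (m + 1) x) = (oo ε m w * ε (w m) x) • Q x := by
  rw [wform, oo_succ, Function.update_self, Function.update_of_ne (by omega)]
  congr 2
  exact oo_congr ε fun k hk => by rw [Function.update_of_ne (by omega)]

lemma sumForm_apply (A S : Finset ℕ) (f : ℕ → P) (α γ : P → (Fin (n + 1) → P) → V) :
    sumForm ε bot Q n m A S f α γ = ∑ x, ∑ g, ∑ h,
      (oo ε m (mg bot A S f (ext0 bot g) (ext0 bot h)) *
        ε (mg bot A S f (ext0 bot g) (ext0 bot h) m) x) * Q x (α x g) (γ x h) := by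
  simp only [sumForm, LinearMap.sum_apply, LinearMap.compl₁₂_apply, LinearMap.proj_apply,
    seqForm_apply, mg_insert bot A S f _ _ (Nat.succ_ne_zero m), wform_update,
    LinearMap.smul_apply, smul_eq_mul]

lemma sumForm_flip (hQ : ∀ x, (Q x).flip = Q x) {A S T : Finset ℕ} (f : ℕ → P)
    (h : ∀ i, 1 ≤ i → i ≤ m → i ∉ A → (i ∈ T ↔ i ∉ S)) :
    (sumForm ε bot Q n m A S f).flip = sumForm ε bot Q n m A T f := by
  refine LinearMap.ext fun α => LinearMap.ext fun γ => ?_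
  simp only [sumForm, LinearMap.flip_apply, LinearMap.sum_apply, LinearMap.compl₁₂_apply,
    LinearMap.proj_apply]
  refine Finset.sum_congr rfl fun x _ => ?_
  rw [← seqForm_flip ε bot hQ (Function.update f (m + 1) x) (A := insert (m + 1) A) (S := S)
    (T := T), LinearMap.flip_apply]
  intro i h1 h2 h3
  rw [Finset.mem_insert, not_or] at h3
  exact h i h1 (by omega) h3.2

/-- Constant families. -/
noncomputable def constMap (P V : Type u) (n : ℕ) [AddCommGroup V] [Module ℝ V] :
    ((Fin (n + 1) → P) → V) →ₗ[ℝ] (P → (Fin (n + 1) → P) → V) :=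
  LinearMap.pi fun _ => LinearMap.id

/-- Families in the derived space. -/
noncomputable def derivedMap (n : ℕ) :
    ((Fin (n + 1) → P) → derivedSpace ε Q) →ₗ[ℝ] (P → (Fin (n + 1) → P) → V) :=
  LinearMap.pi fun x => LinearMap.pi fun g =>
    LinearMap.proj x ∘ₗ (derivedSpace ε Q).subtype ∘ₗ LinearMap.proj g

lemma derivedMap_apply (u : (Fin (n + 1) → P) → derivedSpace ε Q) (x : P)
    (g : Fin (n + 1) → P) : derivedMap ε Q n u x g = (u g).1 x := rfl

lemma range_constMap_le (hc : ∀ y, ∑ x, ε y x • Q x = 0) :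
    LinearMap.range (constMap P V n) ≤ LinearMap.range (derivedMap ε Q n) := by
  rintro _ ⟨α, rfl⟩
  refine ⟨fun g => ⟨fun _ => α g, (mem_derivedSpace ε Q).2 fun y => ?_⟩, rfl⟩
  have := congrArg (fun F : V →ₗ[ℝ] V →ₗ[ℝ] ℝ => F (α g)) (hc y)
  simpa [LinearMap.sum_apply] using this

lemma sumForm_const_derived (hQ : ∀ x, (Q x).flip = Q x) (A S : Finset ℕ) (f : ℕ → P)
    (a : (Fin (n + 1) → P) → V) (b : (Fin (n + 1) → P) → derivedSpace ε Q) :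
    sumForm ε bot Q n m A S f (constMap P V n a) (derivedMap ε Q n b) = 0 := by
  rw [sumForm_apply, Finset.sum_comm]
  refine Finset.sum_eq_zero fun g _ => ?_
  rw [Finset.sum_comm]
  refine Finset.sum_eq_zero fun h _ => ?_
  have h1 := LinearMap.congr_fun ((mem_derivedSpace ε Q).1 (b h).2
    (mg bot A S f (ext0 bot g) (ext0 bot h) m)) (a g)
  simp only [LinearMap.sum_apply, LinearMap.smul_apply, smul_eq_mul,
    LinearMap.zero_apply] at h1
  simp only [mul_assoc, ← Finset.mul_sum]
  rw [mul_eq_zero]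
  right
  rw [← h1]
  refine Finset.sum_congr rfl fun x _ => ?_
  rw [symm_apply (hQ x)]
  rfl

lemma sumForm_derived (A S : Finset ℕ) (f : ℕ → P) :
    (sumForm ε bot Q n m A S f).compl₁₂ (derivedMap ε Q n) (derivedMap ε Q n)
      = seqForm n ε bot m (derivedForm ε Q) A S f := by
  refine LinearMap.ext fun α => LinearMap.ext fun γ => ?_
  rw [LinearMap.compl₁₂_apply, sumForm_apply, seqForm_apply, Finset.sum_comm]
  refine Finset.sum_congr rfl fun g _ => ?_
  rw [Finset.sum_comm]
  refine Finset.sum_congr rfl fun h _ => ?_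
  rw [wform, LinearMap.smul_apply, LinearMap.smul_apply, derivedForm_apply, smul_eq_mul,
    Finset.mul_sum]
  exact Finset.sum_congr rfl fun x _ => mul_assoc _ _ _

lemma bilinRank_sumForm (A S : Finset ℕ) (f : ℕ → P) :
    bilinRank (sumForm ε bot Q n m A S f) = ∑ x, seqRank n ε bot (m + 1) Q
      (insert (m + 1) A) S (Function.update f (m + 1) x) :=
  bilinRank_pi _

lemma sumForm_const_apply (A S : Finset ℕ) (f : ℕ → P) (hm : m + 1 ≤ n)
    (hA : m + 1 ∉ A) (hS : m + 1 ∉ S) :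
    bilinRank (sumForm ε bot Q n m A S f ∘ₗ constMap P V n)
      = seqRank n ε bot (m + 1) Q A S f := by
  refine bilinRank_eq_of_ker _ _ fun α => ?_
  rw [seqForm_eq_zero_iff]
  have hl : (sumForm ε bot Q n m A S f ∘ₗ constMap P V n) α = 0 ↔
      ∀ x, seqForm n ε bot (m + 1) Q (insert (m + 1) A) S
        (Function.update f (m + 1) x) α = 0 := by
    constructor
    · intro h x
      refine LinearMap.ext fun γ => ?_
      have h1 := LinearMap.congr_fun h (Pi.single x γ)
      simp only [sumForm, LinearMap.comp_apply, LinearMap.sum_apply, LinearMap.compl₁₂_apply,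
        LinearMap.proj_apply] at h1
      rw [Finset.sum_eq_single x] at h1
      · simpa [constMap] using h1
      · intro y _ hy; simp [Pi.single_eq_of_ne hy]
      · simp
    · intro h
      refine LinearMap.ext fun γ => ?_
      simp only [sumForm, LinearMap.comp_apply, LinearMap.sum_apply, LinearMap.compl₁₂_apply,
        LinearMap.proj_apply]
      exact Finset.sum_eq_zero fun x _ => LinearMap.congr_fun (h x) (γ x)
  rw [hl]
  simp only [seqForm_eq_zero_iff, mg_insert bot A S f _ _ (Nat.succ_ne_zero m)]
  constructor
  · intro H h
    rw [← H (ext0 bot h (m + 1)) h]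
    refine Finset.sum_congr rfl fun g _ => ?_
    congr 2
    rw [eq_comm, Function.update_eq_self_iff]
    simp [mg, hA, hS]
  · intro H x h
    rw [← H (trunc n (Function.update (ext0 bot h) (m + 1) x))]
    refine Finset.sum_congr rfl fun g _ => ?_
    congr 1
    refine wform_congr ε Q fun k hk => ?_
    by_cases hkm : k = m + 1
    · subst hkm
      simp [mg, hA, hS, ext0_trunc bot _ hm]
    · simp [mg, ext0_trunc bot _ (hk.trans hm), hkm]

lemma bilinRank_le_of_factor {X X' Y Y' : Type*} [AddCommGroup X] [Module ℝ X]
    [FiniteDimensional ℝ X]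
    [AddCommGroup X'] [Module ℝ X'] [FiniteDimensional ℝ X'] [AddCommGroup Y] [Module ℝ Y]
    [AddCommGroup Y'] [Module ℝ Y'] (B : X →ₗ[ℝ] Y →ₗ[ℝ] ℝ) (B' : X' →ₗ[ℝ] Y' →ₗ[ℝ] ℝ)
    (e : Y' →ₗ[ℝ] Y) (he : Function.Surjective e)
    (h : ∀ a, ∃ u, ∀ c, B a (e c) = B' u c) : bilinRank B ≤ bilinRank B' := by
  have hinj : Function.Injective e.dualMap := LinearMap.dualMap_injective_of_surjective he
  have h1 : (LinearMap.range B).map e.dualMap ≤ LinearMap.range B' := by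
    rintro _ ⟨_, ⟨a, rfl⟩, rfl⟩
    obtain ⟨u, hu⟩ := h a
    exact ⟨u, LinearMap.ext fun c => (hu c).symm⟩
  have h2 := Submodule.finrank_mono h1
  have h3 := (Submodule.equivMapOfInjective e.dualMap hinj (LinearMap.range B)).finrank_eq
  exact h3.trans_le h2

lemma seqRank_insert_le {q : P → V →ₗ[ℝ] V →ₗ[ℝ] ℝ} (hε : ∀ y z, ∑ x, ε y x * ε x z = 0)
    (hq : ∀ x, (q x).flip = q x) (hQ : ∀ x, (Q x).flip = Q x)
    (hqQ : IsContraction ε q Q) {A S : Finset ℕ} (f : ℕ → P) (hm : m + 2 ≤ n)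
    (hA : A ⊆ Finset.Icc 1 m) (hS : S ⊆ Finset.Icc 1 m) :
    seqRank n ε bot (m + 2) q A (insert (m + 2) S) f
      ≤ bilinRank (sumForm ε bot Q n m A S f ∘ₗ derivedMap ε Q n) := by
  have hA1 : m + 1 ∉ A := fun h => by have := Finset.mem_Icc.1 (hA h); omega
  have hA2 : m + 2 ∉ A := fun h => by have := Finset.mem_Icc.1 (hA h); omega
  have hS1 : m + 1 ∉ S := fun h => by have := Finset.mem_Icc.1 (hS h); omega
  let K : (Fin (n + 1) → P) → (P × (Fin (n + 1) → P)) → V →ₗ[ℝ] V →ₗ[ℝ] ℝ := fun g xh =>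
    (oo ε m (mg bot A S f (ext0 bot g) (ext0 bot xh.2)) *
      ε (mg bot A S f (ext0 bot g) (ext0 bot xh.2) m) xh.1 * ε xh.1 (ext0 bot g (m + 2))) •
        q (ext0 bot g (m + 2))
  have hrank : seqRank n ε bot (m + 2) q A (insert (m + 2) S) f = bilinRank (matForm K) := by
    refine bilinRank_eq_of_ker _ _ fun α => ?_
    rw [seqForm_eq_zero_iff, matForm_eq_zero_iff, Prod.forall]
    have key : ∀ (x : P) (g h h' : Fin (n + 1) → P), ext0 bot h' (m + 1) = x →
        (∀ k ≤ m, ext0 bot h' k = ext0 bot h k) →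
        wform ε (m + 2) q (mg bot A (insert (m + 2) S) f (ext0 bot g) (ext0 bot h'))
          = K g (x, h) := by
      intro x g h h' hx hh
      set w := mg bot A (insert (m + 2) S) f (ext0 bot g) (ext0 bot h') with hw
      have w2 : w (m + 2) = ext0 bot g (m + 2) := by simp [hw, mg, hA2]
      have w1 : w (m + 1) = x := by simp [hw, mg, hA1, hS1, hx]
      have w0 : ∀ k ≤ m, w k = mg bot A S f (ext0 bot g) (ext0 bot h) k := by
        intro k hk
        have : k ≠ m + 2 := by omega
        simp [hw, mg, hh k hk, this]
      rw [wform, oo_succ, oo_succ, oo_congr ε w0, w0 m le_rfl, w1, w2]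
    constructor
    · intro H x h
      rw [← H (trunc n (Function.update (ext0 bot h) (m + 1) x))]
      refine Finset.sum_congr rfl fun g _ => ?_
      rw [key x g h]
      · rw [ext0_trunc bot _ (by omega), Function.update_self]
      · intro k hk
        rw [ext0_trunc bot _ (by omega), Function.update_of_ne (by omega)]
    · intro H h
      rw [← H (ext0 bot h (m + 1)) h]
      refine Finset.sum_congr rfl fun g _ => ?_
      rw [key _ g h h rfl fun _ _ => rfl]
  rw [hrank]
  let e : (P → (Fin (n + 1) → P) → V) →ₗ[ℝ] (P × (Fin (n + 1) → P) → V) :=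
    { toFun := fun γ xh => γ xh.1 xh.2
      map_add' := fun _ _ => rfl
      map_smul' := fun _ _ => rfl }
  refine bilinRank_le_of_factor _ _ e (fun γ => ⟨fun x h => γ (x, h), rfl⟩) fun α => ?_
  -- representing the functionals by vectors of the derived space
  have hex : ∀ (g : Fin (n + 1) → P) (x : P), ∃ v,
      Q x v = ε x (ext0 bot g (m + 2)) • q (ext0 bot g (m + 2)) (α g) := by
    intro g x
    refine exists_eq_of_ker_le (Q x) (hQ x) _ fun u hu => ?_
    by_cases h0 : ε x (ext0 bot g (m + 2)) = 0
    · simp [h0]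
    · rw [LinearMap.smul_apply, symm_apply (hq _), (hqQ x u).1 hu _ h0]
      simp
  choose v hv using hex
  refine ⟨fun g => ⟨v g, (mem_derivedSpace ε Q).2 fun y => ?_⟩, fun γ => ?_⟩
  · simp only [hv, smul_smul, ← Finset.sum_smul, hε, zero_smul]
  · rw [LinearMap.comp_apply, sumForm_apply, matForm_apply]
    conv_rhs => rw [Finset.sum_comm]
    refine Finset.sum_congr rfl fun g _ => ?_
    rw [Fintype.sum_prod_type]
    refine Finset.sum_congr rfl fun x _ => Finset.sum_congr rfl fun h _ => ?_
    simp only [derivedMap_apply, hv, K, e, LinearMap.smul_apply, smul_eq_mul,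
      LinearMap.coe_mk, AddHom.coe_mk, mul_assoc]

end Derived

section Contract

set_option linter.unusedSectionVars false

universe u

variable {P : Type u} [Fintype P] {n : ℕ} {V : Type u} [AddCommGroup V] [Module ℝ V]
  [FiniteDimensional ℝ V] (ε : P → P → ℝ) (bot : P) {m : ℕ}
  (Q : P → V →ₗ[ℝ] V →ₗ[ℝ] ℝ) {q : P → V →ₗ[ℝ] V →ₗ[ℝ] ℝ}

lemma bilinRank_sumForm_eq (hqQ : IsContraction ε q Q) (hE : RankExact n ε bot (m + 2) q)
    {A S : Finset ℕ} (f : ℕ → P) (hm : m + 2 ≤ n)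
    (hA : A ⊆ Finset.Icc 1 m) (hS : S ⊆ Finset.Icc 1 m) :
    bilinRank (sumForm ε bot Q n m A S f)
      = seqRank n ε bot (m + 2) q A S f + seqRank n ε bot (m + 2) q A (insert (m + 1) S) f := by
  have hA1 : m + 1 ∉ A := fun h => by have := Finset.mem_Icc.1 (hA h); omega
  have hA2 : m + 2 ∉ A := fun h => by have := Finset.mem_Icc.1 (hA h); omega
  have hS1 : m + 1 ∉ S := fun h => by have := Finset.mem_Icc.1 (hS h); omega
  have hS2 : m + 2 ∉ S := fun h => by have := Finset.mem_Icc.1 (hS h); omega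
  have hI : Finset.Icc 1 m ⊆ Finset.Icc 1 (m + 2) := Finset.Icc_subset_Icc le_rfl (by omega)
  rw [← hE (m + 1) (by omega) (by omega) A (hA.trans hI) S (hS.trans hI) f hA1 hS1,
    bilinRank_sumForm]
  refine Finset.sum_congr rfl fun x _ => ?_
  rw [seqRank_contract ε bot hqQ _ hm (by simp [hA2]) hS2 (by simp)]

/-- The ranks of the derived family. -/
lemma seqRank_derived (hε : ∀ y z, ∑ x, ε y x * ε x z = 0)
    (hq : ∀ x, (q x).flip = q x) (hQ : ∀ x, (Q x).flip = Q x)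
    (hqQ : IsContraction ε q Q) (hc : ∀ y, ∑ x, ε y x • Q x = 0)
    (hE : RankExact n ε bot (m + 2) q) {A S : Finset ℕ} (f : ℕ → P) (hm : m + 2 ≤ n)
    (hA : A ⊆ Finset.Icc 1 m) (hS : S ⊆ Finset.Icc 1 m) :
    seqRank n ε bot m (derivedForm ε Q) A S f + seqRank n ε bot (m + 2) q A S f
      = seqRank n ε bot (m + 2) q A (insert (m + 2) S) f := by
  set T := Finset.Icc 1 m \ S with hT
  have hTm : T ⊆ Finset.Icc 1 m := Finset.sdiff_subset
  have hA1 : m + 1 ∉ A := fun h => by have := Finset.mem_Icc.1 (hA h); omega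
  have hA2 : m + 2 ∉ A := fun h => by have := Finset.mem_Icc.1 (hA h); omega
  have out1 : ∀ {S}, S ⊆ Finset.Icc 1 m → m + 1 ∉ S := fun hS h => by
    have := Finset.mem_Icc.1 (hS h); omega
  have out2 : ∀ {S}, S ⊆ Finset.Icc 1 m → m + 2 ∉ S := fun hS h => by
    have := Finset.mem_Icc.1 (hS h); omega
  have hST : ∀ i, 1 ≤ i → i ≤ m → i ∉ A → (i ∈ T ↔ i ∉ S) := by
    intro i h1 h2 _
    simp [hT, h1, h2]
  have hTS : ∀ i, 1 ≤ i → i ≤ m → i ∉ A → (i ∈ S ↔ i ∉ T) := by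
    intro i h1 h2 h3
    rw [hST i h1 h2 h3, not_not]
  have hcon : ∀ {S}, S ⊆ Finset.Icc 1 m →
      bilinRank (sumForm ε bot Q n m A S f ∘ₗ constMap P V n)
        = seqRank n ε bot (m + 2) q A S f := by
    intro S hS
    rw [sumForm_const_apply ε bot Q A S f (by omega) hA1 (out1 hS),
      seqRank_contract ε bot hqQ f hm hA2 (out2 hS) (Or.inr (Or.inr (out1 hS)))]
  have hfl := sumForm_flip ε bot Q (n := n) hQ f hST
  have r1 := bilinRank_sumForm_eq ε bot Q hqQ hE f hm hA hS
  have r2 := bilinRank_sumForm_eq ε bot Q hqQ hE f hm hA hTm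
  rw [← hfl, bilinRank_flip] at r2
  have f1 : seqRank n ε bot (m + 2) q A (insert (m + 2) T) f
      = seqRank n ε bot (m + 2) q A (insert (m + 1) S) f := by
    refine seqRank_flip ε bot hq f fun i h1 h2 h3 => ?_
    rcases (show i ≤ m ∨ i = m + 1 ∨ i = m + 2 by omega) with h | h | h
    · simp [hTS i h1 h h3, show i ≠ m + 1 by omega, show i ≠ m + 2 by omega]
    · simp [h, out1 hTm]
    · simp [h, out2 hS]
  have f2 : seqRank n ε bot (m + 2) q A (insert (m + 1) T) f
      = seqRank n ε bot (m + 2) q A (insert (m + 2) S) f := by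
    refine seqRank_flip ε bot hq f fun i h1 h2 h3 => ?_
    rcases (show i ≤ m ∨ i = m + 1 ∨ i = m + 2 by omega) with h | h | h
    · simp [hTS i h1 h h3, show i ≠ m + 1 by omega, show i ≠ m + 2 by omega]
    · simp [h, out1 hS]
    · simp [h, out2 hTm]
  have l1 := seqRank_insert_le ε bot Q hε hq hQ hqQ f hm hA hS
  have l2 := seqRank_insert_le ε bot Q hε hq hQ hqQ f hm hA hTm
  rw [← hfl] at l2
  have c1 := hcon hS
  have c2 := hcon hTm
  rw [← hfl] at c2
  have main := bilinRank_restrict (sumForm ε bot Q n m A S f) (constMap P V n)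
    (constMap P V n) (derivedMap ε Q n) (derivedMap ε Q n)
    (range_constMap_le ε Q hc) (sumForm_const_derived ε bot Q hQ A S f)
    (fun a b => by
      have := sumForm_const_derived ε bot Q (n := n) (m := m) hQ A T f b a
      rw [← hfl] at this
      exact this) (by omega) (by omega)
  rw [sumForm_derived] at main
  change seqRank n ε bot m (derivedForm ε Q) A S f + _ + _ = _ at main
  omega

lemma rankExact_derived (hε : ∀ y z, ∑ x, ε y x * ε x z = 0)
    (hq : ∀ x, (q x).flip = q x) (hQ : ∀ x, (Q x).flip = Q x)
    (hqQ : IsContraction ε q Q) (hc : ∀ y, ∑ x, ε y x • Q x = 0)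
    (hE : RankExact n ε bot (m + 2) q) (hm : m + 2 ≤ n) :
    RankExact n ε bot m (derivedForm ε Q) := by
  intro i h1 h2 A hA S hS f hiA hiS
  have hi : i ∈ Finset.Icc 1 m := Finset.mem_Icc.2 ⟨h1, by omega⟩
  have hI : Finset.Icc 1 m ⊆ Finset.Icc 1 (m + 2) := Finset.Icc_subset_Icc le_rfl (by omega)
  have hD := fun {A S : Finset ℕ} (f : ℕ → P) =>
    seqRank_derived ε bot Q (A := A) (S := S) hε hq hQ hqQ hc hE f hm
  have e1 := hE i h1 (by omega) A (hA.trans hI) S (hS.trans hI) f hiA hiS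
  have e2 := hE i h1 (by omega) A (hA.trans hI) (insert (m + 2) S)
    (Finset.insert_subset (Finset.mem_Icc.2 ⟨by omega, le_rfl⟩) (hS.trans hI)) f hiA
    (by simp only [Finset.mem_insert, not_or]; exact ⟨by omega, hiS⟩)
  have e3 := Finset.sum_congr (rfl : (Finset.univ : Finset P) = Finset.univ) fun x _ =>
    hD (Function.update f i x) (Finset.insert_subset hi hA) hS
  rw [Finset.sum_add_distrib] at e3
  have d1 := hD f hA hS
  have d2 := hD f hA (Finset.insert_subset hi hS)
  rw [Finset.insert_comm] at d2
  omega

lemma rankExact_contract (hQ : ∀ x, (Q x).flip = Q x)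
    (hqQ : IsContraction ε q Q)
    (hE : RankExact n ε bot (m + 1) q) (hm : m + 1 ≤ n) :
    RankExact n ε bot m Q := by
  intro i h1 h2 A hA S hS f hiA hiS
  have hi : i ∈ Finset.Icc 1 m := Finset.mem_Icc.2 ⟨h1, by omega⟩
  have hI : Finset.Icc 1 m ⊆ Finset.Icc 1 (m + 1) := Finset.Icc_subset_Icc le_rfl (by omega)
  have out : ∀ {S}, S ⊆ Finset.Icc 1 m → m + 1 ∉ S := fun hS h => by
    have := Finset.mem_Icc.1 (hS h); omega
  have key : ∀ S ⊆ Finset.Icc 1 m, i ∉ S → (m ∈ A ∨ m ∉ S) →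
      ∑ x, seqRank n ε bot m Q (insert i A) S (Function.update f i x)
      = seqRank n ε bot m Q A S f + seqRank n ε bot m Q A (insert i S) f := by
    intro S hS hiS h
    have e1 := hE i h1 (by omega) A (hA.trans hI) S (hS.trans hI) f hiA hiS
    rw [seqRank_contract ε bot hqQ f hm (out hA) (out hS) (Or.inr h),
      seqRank_contract ε bot hqQ f hm (out hA) (out (Finset.insert_subset hi hS))
        (Or.inr (h.imp_right fun h' => by
          simp only [Finset.mem_insert, not_or]; exact ⟨by omega, h'⟩))] at e1
    rw [← e1]
    refine Finset.sum_congr rfl fun x _ => ?_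
    rw [seqRank_contract ε bot hqQ _ hm (out (Finset.insert_subset hi hA)) (out hS)
      (Or.inr (h.imp_left fun h' => Finset.mem_insert_of_mem h'))]
  by_cases h : m ∈ A ∨ m ∉ S
  · exact key S hS hiS h
  push Not at h
  set T := Finset.Icc 1 m \ insert i S with hT
  have e := key T Finset.sdiff_subset (by simp [hT]) (Or.inr (by simp [hT, h.2]))
  have f1 : ∀ x, seqRank n ε bot m Q (insert i A) T (Function.update f i x)
      = seqRank n ε bot m Q (insert i A) S (Function.update f i x) := by
    intro x
    refine seqRank_flip ε bot hQ _ fun j h1 h2 h3 => ?_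
    rw [Finset.mem_insert, not_or] at h3
    simp [hT, h1, h2, h3.1]
  have f2 : seqRank n ε bot m Q A T f = seqRank n ε bot m Q A (insert i S) f := by
    refine seqRank_flip ε bot hQ _ fun j h1 h2 h3 => ?_
    simp [hT, h1, h2]
    tauto
  have f3 : seqRank n ε bot m Q A (insert i T) f = seqRank n ε bot m Q A S f := by
    refine seqRank_flip ε bot hQ _ fun j h1 h2 h3 => ?_
    by_cases hj : j = i
    · simp [hj, hiS]
    · simp [hT, h1, h2, hj]
  rw [f2, f3, add_comm] at e
  rw [← e]
  exact Finset.sum_congr rfl fun x _ => (f1 x).symm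

end Contract

section CdNonneg

/-- Nonnegative integer combinations of `cd`-monomials. -/
def cdCone : AddSubmonoid NC := AddSubmonoid.closure (Set.range cdMonomial)

lemma exists_cdEval_of_mem_cdCone {x : NC} (hx : x ∈ cdCone) :
    ∃ f : List Bool →₀ ℤ, x = cdEval f ∧ ∀ w, 0 ≤ f w := by
  induction hx using AddSubmonoid.closure_induction with
  | mem x hx =>
    obtain ⟨w, rfl⟩ := hx
    refine ⟨Finsupp.single w 1, by simp [cdEval], fun v => ?_⟩
    rw [Finsupp.single_apply]
    split_ifs <;> simp
  | zero => exact ⟨0, by simp [cdEval], fun _ => le_rfl⟩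
  | add x y _ _ hx hy =>
    obtain ⟨f, rfl, hf⟩ := hx
    obtain ⟨g, rfl, hg⟩ := hy
    refine ⟨f + g, ?_, fun w => add_nonneg (hf w) (hg w)⟩
    rw [cdEval, cdEval, cdEval, Finsupp.sum_add_index']
    · simp
    · intro a b c
      push_cast
      rw [add_smul]

lemma cdMonomial_append (w : List Bool) (s : Bool) :
    cdMonomial (w ++ [s]) = cdMonomial w * (if s then vd else vc) := by
  induction w with
  | nil => simp [cdMonomial]
  | cons t w ih => rw [List.cons_append, cdMonomial, ih, cdMonomial, mul_assoc]

lemma mul_mem_cdCone {x : NC} (hx : x ∈ cdCone) (s : Bool) :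
    x * (if s then vd else vc) ∈ cdCone := by
  induction hx using AddSubmonoid.closure_induction with
  | mem x hx =>
    obtain ⟨w, rfl⟩ := hx
    rw [← cdMonomial_append]
    exact AddSubmonoid.subset_closure ⟨_, rfl⟩
  | zero => rw [zero_mul]; exact zero_mem _
  | add x y _ _ hx hy => rw [add_mul]; exact add_mem hx hy

lemma natCast_mem_cdCone (k : ℕ) : (k : ℚ) • (1 : NC) ∈ cdCone := by
  rw [Nat.cast_smul_eq_nsmul]
  exact nsmul_mem (show cdMonomial [] ∈ cdCone from
    AddSubmonoid.subset_closure (Set.mem_range_self [])) k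

/-- The `ab`-word of length `m` with `b` exactly at the positions in `S`. -/
noncomputable def abWord : ℕ → Finset ℕ → NC
  | 0, _ => 1
  | m + 1, S => abWord m S * (if m + 1 ∈ S then vb else va)

lemma abWord_congr {m : ℕ} {S T : Finset ℕ} (h : ∀ i, 1 ≤ i → i ≤ m → (i ∈ S ↔ i ∈ T)) :
    abWord m S = abWord m T := by
  induction m with
  | zero => rfl
  | succ m ih =>
    rw [abWord, abWord, ih fun i h1 h2 => h i h1 (by omega)]
    simp only [h (m + 1) (by omega) le_rfl]

lemma Icc_one_succ (m : ℕ) : Finset.Icc 1 (m + 1) = insert (m + 1) (Finset.Icc 1 m) := by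
  ext i; simp only [Finset.mem_Icc, Finset.mem_insert]; omega

lemma sum_powerset_Icc_succ {M : Type*} [AddCommMonoid M] (m : ℕ) (F : Finset ℕ → M) :
    ∑ S ∈ (Finset.Icc 1 (m + 1)).powerset, F S
      = ∑ S ∈ (Finset.Icc 1 m).powerset, (F S + F (insert (m + 1) S)) := by
  rw [Icc_one_succ, Finset.sum_powerset_insert (by simp), Finset.sum_add_distrib]

universe u

variable {P : Type u} [Fintype P] {V : Type u} [AddCommGroup V] [Module ℝ V]

/-- The `ab`-polynomial of the ranks of a family of forms. -/
noncomputable def rankPoly (n : ℕ) (ε : P → P → ℝ) (bot : P) (m : ℕ)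
    (q : P → V →ₗ[ℝ] V →ₗ[ℝ] ℝ) (f : ℕ → P) : NC :=
  ∑ S ∈ (Finset.Icc 1 m).powerset, (seqRank n ε bot m q ∅ S f : ℚ) • abWord m S

variable {n : ℕ}

lemma rankPoly_add_two [FiniteDimensional ℝ V] (ε : P → P → ℝ) (bot : P) {m : ℕ}
    (q Q : P → V →ₗ[ℝ] V →ₗ[ℝ] ℝ)
    (hε : ∀ y z, ∑ x, ε y x * ε x z = 0)
    (hq : ∀ x, (q x).flip = q x) (hQ : ∀ x, (Q x).flip = Q x)
    (hqQ : IsContraction ε q Q) (hc : ∀ y, ∑ x, ε y x • Q x = 0)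
    (hE : RankExact n ε bot (m + 2) q) (hm : m + 2 ≤ n) (f : ℕ → P) :
    rankPoly n ε bot (m + 2) q f
      = rankPoly n ε bot (m + 1) Q f * vc + rankPoly n ε bot m (derivedForm ε Q) f * vd := by
  rw [rankPoly, sum_powerset_Icc_succ, sum_powerset_Icc_succ, rankPoly, sum_powerset_Icc_succ,
    rankPoly, Finset.sum_mul, Finset.sum_mul, ← Finset.sum_add_distrib]
  refine Finset.sum_congr rfl fun S hS => ?_
  rw [Finset.mem_powerset] at hS
  set T := Finset.Icc 1 m \ S with hT
  have hTm : T ⊆ Finset.Icc 1 m := Finset.sdiff_subset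
  have out1 : ∀ {S}, S ⊆ Finset.Icc 1 m → m + 1 ∉ S := fun hS h => by
    have := Finset.mem_Icc.1 (hS h); omega
  have out2 : ∀ {S}, S ⊆ Finset.Icc 1 m → m + 2 ∉ S := fun hS h => by
    have := Finset.mem_Icc.1 (hS h); omega
  have hTS : ∀ i, 1 ≤ i → i ≤ m → (i ∈ T ↔ i ∉ S) := by
    intro i h1 h2
    simp [hT, h1, h2]
  have con : ∀ {S}, S ⊆ Finset.Icc 1 m →
      seqRank n ε bot (m + 2) q ∅ S f = seqRank n ε bot (m + 1) Q ∅ S f := fun hS =>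
    seqRank_contract ε bot hqQ f hm (by simp) (out2 hS) (Or.inr (Or.inr (out1 hS)))
  have der : ∀ {S}, S ⊆ Finset.Icc 1 m →
      seqRank n ε bot m (derivedForm ε Q) ∅ S f + seqRank n ε bot (m + 2) q ∅ S f
      = seqRank n ε bot (m + 2) q ∅ (insert (m + 2) S) f := fun hS =>
    seqRank_derived ε bot Q hε hq hQ hqQ hc hE f hm (by simp) hS
  have c1 := con hS
  have c2 := con hTm
  have d1 := der hS
  have d2 := der hTm
  have f1 : seqRank n ε bot (m + 1) Q ∅ (insert (m + 1) S) f
      = seqRank n ε bot (m + 1) Q ∅ T f := by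
    refine seqRank_flip ε bot hQ f fun i h1 h2 _ => ?_
    rcases (show i ≤ m ∨ i = m + 1 by omega) with h | h
    · simp [hTS i h1 h, show i ≠ m + 1 by omega]
    · simp [h, out1 hTm]
  have f2 : seqRank n ε bot (m + 2) q ∅ (insert (m + 2) (insert (m + 1) S)) f
      = seqRank n ε bot (m + 2) q ∅ T f := by
    refine seqRank_flip ε bot hq f fun i h1 h2 _ => ?_
    rcases (show i ≤ m ∨ i = m + 1 ∨ i = m + 2 by omega) with h | h | h
    · simp [hTS i h1 h, show i ≠ m + 1 by omega, show i ≠ m + 2 by omega]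
    · simp [h, out1 hTm]
    · simp [h, out2 hTm]
  have f3 : seqRank n ε bot (m + 2) q ∅ (insert (m + 1) S) f
      = seqRank n ε bot (m + 2) q ∅ (insert (m + 2) T) f := by
    refine seqRank_flip ε bot hq f fun i h1 h2 _ => ?_
    rcases (show i ≤ m ∨ i = m + 1 ∨ i = m + 2 by omega) with h | h | h
    · simp [hTS i h1 h, show i ≠ m + 1 by omega, show i ≠ m + 2 by omega]
    · simp [h, out1 hTm]
    · simp [h, out2 hS]
  have f4 : seqRank n ε bot m (derivedForm ε Q) ∅ T f
      = seqRank n ε bot m (derivedForm ε Q) ∅ S f :=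
    seqRank_flip ε bot (derivedForm_flip ε Q hQ) f fun i h1 h2 _ => by
      simp [hTS i h1 h2]
  have w : ∀ {S'}, (∀ i, 1 ≤ i → i ≤ m → (i ∈ S' ↔ i ∈ S)) → abWord m S' = abWord m S :=
    fun h => abWord_congr h
  have hm1 : ∀ i, i ≤ m → i ≠ m + 1 := fun i h => by omega
  have hm2 : ∀ i, i ≤ m → i ≠ m + 2 := fun i h => by omega
  have w1 : abWord m (insert (m + 1) S) = abWord m S :=
    w fun i _ h => by simp [hm1 i h]
  have w2 : abWord m (insert (m + 2) S) = abWord m S :=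
    w fun i _ h => by simp [hm2 i h]
  have w3 : abWord m (insert (m + 2) (insert (m + 1) S)) = abWord m S :=
    w fun i _ h => by simp [hm1 i h, hm2 i h]
  have g1 : seqRank n ε bot (m + 2) q ∅ (insert (m + 1) S) f
    = seqRank n ε bot (m + 1) Q ∅ (insert (m + 1) S) f
      + seqRank n ε bot m (derivedForm ε Q) ∅ S f := by omega
  have g2 : seqRank n ε bot (m + 2) q ∅ (insert (m + 2) S) f
    = seqRank n ε bot (m + 1) Q ∅ S f + seqRank n ε bot m (derivedForm ε Q) ∅ S f := by omega
  have g3 : seqRank n ε bot (m + 2) q ∅ (insert (m + 2) (insert (m + 1) S)) f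
    = seqRank n ε bot (m + 1) Q ∅ (insert (m + 1) S) f := by omega
  have e : m + 1 + 1 = m + 2 := rfl
  simp only [abWord, e, w1, w2, w3, g1, g2, g3, c1, out1 hS, out2 hS, Finset.mem_insert,
    if_true, if_false, or_false, or_true,
    show m + 1 ≠ m + 2 by omega, show m + 2 ≠ m + 1 by omega, vc, vd]
  push_cast
  simp only [mul_add, add_mul, smul_mul_assoc, add_smul, mul_assoc]
  abel

lemma rankPoly_mem_cdCone (ε : P → P → ℝ) (bot : P) (f : ℕ → P)
    (hε : ∀ y z, ∑ x, ε y x * ε x z = 0) (m : ℕ) (hm : m ≤ n) :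
    ∀ (V : Type u) [AddCommGroup V] [Module ℝ V] [FiniteDimensional ℝ V]
      (q : P → V →ₗ[ℝ] V →ₗ[ℝ] ℝ), (∀ x, (q x).flip = q x) → RankExact n ε bot m q →
      rankPoly n ε bot m q f ∈ cdCone := by
  induction m using Nat.strong_induction_on with
  | _ m ih =>
    intro V _ _ _ q hq hE
    match m, hm, ih, hE with
    | 0, _, _, _ =>
      simp only [rankPoly, zero_lt_one, Finset.Icc_eq_empty_of_lt, Finset.powerset_empty,
        Finset.sum_singleton, abWord]
      exact natCast_mem_cdCone _
    | 1, hm, _, hE =>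
      obtain ⟨b, hb, hbq⟩ := exists_generic_forms ε q hq
      have h1 : seqRank n ε bot 1 q ∅ {1} f = seqRank n ε bot 1 q ∅ ∅ f :=
        seqRank_flip ε bot hq f fun i h1 h2 _ => by
          have : i = 1 := by omega
          simp [this]
      have h2 : rankPoly n ε bot 1 q f
          = ((seqRank n ε bot 1 q ∅ ∅ f : ℚ) • (1 : NC)) * vc := by
        rw [rankPoly, sum_powerset_Icc_succ]
        simp [abWord, h1, vc]
      rw [h2]
      exact mul_mem_cdCone (natCast_mem_cdCone _) false
    | m + 2, hm, ih, hE =>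
      obtain ⟨b, hb, hbq⟩ := exists_generic_forms ε q hq
      set Q := fun y => ∑ z, ε y z • b z with hQd
      have hQ : ∀ x, (Q x).flip = Q x := by
        intro x
        refine LinearMap.ext fun v => LinearMap.ext fun w => ?_
        simp only [hQd, LinearMap.flip_apply, LinearMap.sum_apply, LinearMap.smul_apply]
        exact Finset.sum_congr rfl fun z _ => by rw [symm_apply (hb z)]
      have hqQ : IsContraction ε q Q := hbq
      have hc : ∀ y, ∑ x, ε y x • Q x = 0 := by
        intro y
        simp only [hQd, Finset.smul_sum, smul_smul]
        rw [Finset.sum_comm]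
        simp only [← Finset.sum_smul, hε, zero_smul, Finset.sum_const_zero]
      rw [rankPoly_add_two ε bot q Q hε hq hQ hqQ hc hE hm f]
      refine add_mem (mul_mem_cdCone ?_ false) (mul_mem_cdCone ?_ true)
      · exact ih (m + 1) (by omega) (by omega) V Q hQ
          (rankExact_contract ε bot Q hQ hqQ hE hm)
      · exact ih m (by omega) (by omega) (derivedSpace ε Q) _ (derivedForm_flip ε Q hQ)
          (rankExact_derived ε bot Q hε hq hQ hqQ hc hE hm)

end CdNonneg

section ChainComplex

set_option linter.unusedSectionVars false

variable {P : Type*} [Fintype P] [PartialOrder P] [OrderBot P]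

/-- The sign of inserting `x` in `w`. -/
noncomputable def insSign (x : P) (w : Finset P) : ℝ := (-1) ^ (w.filter (· < x)).card

/-- The boundary operator relative to `F`, on functions. -/
noncomputable def dl (F : Finset P) : (Finset P → ℝ) →ₗ[ℝ] (Finset P → ℝ) where
  toFun c w := if F ⊆ w then ∑ x ∈ wᶜ, insSign x w * c (insert x w) else 0
  map_add' c e := by
    funext w
    by_cases h : F ⊆ w <;> simp [h, mul_add, Finset.sum_add_distrib]
  map_smul' t c := by
    funext w
    by_cases h : F ⊆ w
    · simp only [h, if_true, Pi.smul_apply, smul_eq_mul, RingHom.id_apply, Finset.mul_sum]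
      exact Finset.sum_congr rfl fun x _ => by ring
    · simp [h]

lemma dl_apply (F : Finset P) (c : Finset P → ℝ) {w : Finset P} (h : F ⊆ w) :
    dl F c w = ∑ x ∈ wᶜ, insSign x w * c (insert x w) := if_pos h

lemma dl_apply_of_not (F : Finset P) (c : Finset P → ℝ) {w : Finset P} (h : ¬ F ⊆ w) :
    dl F c w = 0 := if_neg h

/-- Chains containing the minimal element. -/
def BotChain (y : Finset P) : Prop := chainIn Set.univ ⊥ y

lemma BotChain.le_total {y : Finset P} (hy : BotChain y) {a b : P} (ha : a ∈ y) (hb : b ∈ y)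
    (hab : a ≠ b) : a < b ∨ b < a := hy.2.2 ha hb hab

lemma BotChain.subset {y w : Finset P} (hy : BotChain y) (h : w ⊆ y) (hw : ⊥ ∈ w) :
    BotChain w :=
  ⟨hw, Set.subset_univ _, hy.2.2.mono (Finset.coe_subset.2 h)⟩

/-- Functions supported on chains with `k` elements containing `F`. -/
def IsCell (F : Finset P) (k : ℕ) (c : Finset P → ℝ) : Prop :=
  ∀ y, c y ≠ 0 → BotChain y ∧ F ⊆ y ∧ y.card = k

lemma IsCell.add {F : Finset P} {k : ℕ} {c e : Finset P → ℝ} (hc : IsCell F k c)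
    (he : IsCell F k e) : IsCell F k (c + e) := by
  intro y hy
  by_cases h : c y = 0
  · exact he y fun h' => hy (by simp [h, h'])
  · exact hc y h

lemma IsCell.smul {F : Finset P} {k : ℕ} {c : Finset P → ℝ} (hc : IsCell F k c) (t : ℝ) :
    IsCell F k (t • c) := fun y hy => hc y fun h => hy (by simp [h])

lemma IsCell.sub {F : Finset P} {k : ℕ} {c e : Finset P → ℝ} (hc : IsCell F k c)
    (he : IsCell F k e) : IsCell F k (c - e) := by
  have := hc.add (he.smul (-1))
  rwa [neg_one_smul, ← sub_eq_add_neg] at this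

lemma IsCell.sum {F : Finset P} {k : ℕ} {ι : Type*} (s : Finset ι) {c : ι → Finset P → ℝ}
    (hc : ∀ i ∈ s, IsCell F k (c i)) : IsCell F k (∑ i ∈ s, c i) := by
  intro y hy
  rw [Finset.sum_apply] at hy
  obtain ⟨i, hi, h⟩ := Finset.exists_ne_zero_of_sum_ne_zero hy
  exact hc i hi y h

lemma IsCell.mono {F F' : Finset P} {k : ℕ} {c : Finset P → ℝ} (h : F ⊆ F')
    (hc : IsCell F' k c) : IsCell F k c :=
  fun y hy => ⟨(hc y hy).1, h.trans (hc y hy).2.1, (hc y hy).2.2⟩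

lemma exists_of_dl_ne_zero {F : Finset P} {c : Finset P → ℝ} {w : Finset P}
    (h : dl F c w ≠ 0) : F ⊆ w ∧ ∃ x, x ∉ w ∧ c (insert x w) ≠ 0 := by
  by_cases hF : F ⊆ w
  · refine ⟨hF, ?_⟩
    rw [dl_apply F c hF] at h
    obtain ⟨x, hx, h⟩ := Finset.exists_ne_zero_of_sum_ne_zero h
    exact ⟨x, Finset.mem_compl.1 hx, right_ne_zero_of_mul h⟩
  · exact absurd (dl_apply_of_not F c hF) h

lemma IsCell.dl {F : Finset P} (hF : ⊥ ∈ F) {k : ℕ} {c : Finset P → ℝ}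
    (hc : IsCell F (k + 1) c) : IsCell F k (dl F c) := by
  intro w hw
  obtain ⟨hFw, x, hx, h⟩ := exists_of_dl_ne_zero hw
  obtain ⟨h1, h2, h3⟩ := hc _ h
  refine ⟨h1.subset (Finset.subset_insert _ _) (hFw hF), hFw, ?_⟩
  rw [Finset.card_insert_of_notMem hx] at h3
  omega

lemma insSign_insert {x z : P} {w : Finset P} (hx : x ∉ w) :
    insSign z (insert x w) = (if x < z then -1 else 1) * insSign z w := by
  unfold insSign
  rw [Finset.filter_insert]
  split_ifs with h
  · rw [Finset.card_insert_of_notMem (by simp [hx]), pow_succ, mul_comm]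
  · rw [one_mul]

lemma dl_dl {F : Finset P} {k : ℕ} {c : Finset P → ℝ} (hc : IsCell F k c) :
    dl F (dl F c) = 0 := by
  funext w
  by_cases hF : F ⊆ w
  swap
  · exact dl_apply_of_not F _ hF
  rw [dl_apply F _ hF]
  have e1 : ∑ x ∈ wᶜ, insSign x w * dl F c (insert x w)
      = ∑ x, ∑ z, if x ∉ w ∧ z ∉ w ∧ z ≠ x then
          insSign x w * insSign z (insert x w) * c (insert z (insert x w)) else 0 := by
    rw [← Finset.sum_subset (Finset.subset_univ wᶜ)]
    · refine Finset.sum_congr rfl fun x hx => ?_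
      rw [dl_apply F _ (hF.trans (Finset.subset_insert _ _)), Finset.mul_sum,
        ← Finset.sum_subset (Finset.subset_univ (insert x w)ᶜ)]
      · refine Finset.sum_congr rfl fun z hz => ?_
        simp only [Finset.mem_compl, Finset.mem_insert, not_or] at hx hz
        rw [if_pos ⟨hx, hz.2, hz.1⟩, mul_assoc]
      · intro z _ hz
        rw [if_neg]
        rintro ⟨_, h2, h3⟩
        exact hz (by simp [h2, h3])
    · intro x _ hx
      refine Finset.sum_eq_zero fun z _ => if_neg fun h => hx (Finset.mem_compl.2 h.1)
  rw [e1]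
  set X := ∑ x, ∑ z, if x ∉ w ∧ z ∉ w ∧ z ≠ x then
          insSign x w * insSign z (insert x w) * c (insert z (insert x w)) else 0 with hX
  have e2 : X = -X := by
    conv_lhs => rw [hX, Finset.sum_comm]
    rw [hX, ← Finset.sum_neg_distrib]
    refine Finset.sum_congr rfl fun x _ => ?_
    rw [← Finset.sum_neg_distrib]
    refine Finset.sum_congr rfl fun z _ => ?_
    by_cases h : x ∉ w ∧ z ∉ w ∧ z ≠ x
    · rw [if_pos h, if_pos ⟨h.2.1, h.1, h.2.2.symm⟩, Finset.insert_comm x z]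
      by_cases h0 : c (insert z (insert x w)) = 0
      · simp [h0]
      · have := (hc _ h0).1.le_total (Finset.mem_insert_self z _)
          (Finset.mem_insert_of_mem (Finset.mem_insert_self x _)) h.2.2
        rw [insSign_insert h.1, insSign_insert h.2.1]
        rcases this with h1 | h1
        · rw [if_pos h1, if_neg h1.not_gt]; ring
        · rw [if_neg h1.not_gt, if_pos h1]; ring
    · rw [if_neg h, if_neg fun h' => h ⟨h'.2.1, h'.1, h'.2.2.symm⟩, neg_zero]
  simpa using (by linarith : X = 0)

lemma mem_cellSpace_iff (F : Finset P) (k : ℕ) (c : Finset P →₀ ℝ) :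
    c ∈ cellSpace Set.univ ⊥ F k ↔ IsCell F k c := by
  have h : {f | ∃ y : Finset P, chainIn Set.univ ⊥ y ∧ F ⊆ y ∧ y.card = k ∧
      f = Finsupp.single y (1 : ℝ)} = (fun y => Finsupp.single y (1 : ℝ)) ''
        {y | BotChain y ∧ F ⊆ y ∧ y.card = k} := by
    ext f
    constructor
    · rintro ⟨y, h1, h2, h3, rfl⟩; exact ⟨y, ⟨h1, h2, h3⟩, rfl⟩
    · rintro ⟨y, ⟨h1, h2, h3⟩, rfl⟩; exact ⟨y, h1, h2, h3, rfl⟩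
  rw [cellSpace, h, ← Finsupp.supported_eq_span_single, Finsupp.mem_supported]
  constructor
  · intro h y hy
    exact h (Finsupp.mem_support_iff.2 hy)
  · intro h y hy
    exact h y (Finsupp.mem_support_iff.1 hy)

lemma bnd_eq_dl {F : Finset P} {k : ℕ} {c : Finset P →₀ ℝ} (hc : IsCell F k c) :
    ⇑(bnd F c) = dl F c := by
  funext w
  have e1 : bnd F c w = ∑ σ, ∑ y, if σ ∈ y \ F ∧ y.erase σ = w then
      c y * (-1 : ℝ) ^ (y.filter fun τ => τ < σ).card else 0 := by
    rw [bnd, Finsupp.lsum_apply, Finsupp.sum_fintype _ _ (by simp), Finsupp.finsetSum_apply,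
      Finset.sum_comm]
    refine Finset.sum_congr rfl fun y _ => ?_
    simp only [LinearMap.smulRight_apply, LinearMap.id_apply, Finsupp.smul_apply,
      Finsupp.finsetSum_apply, smul_eq_mul, Finset.mul_sum, Finsupp.single_apply]
    rw [← Finset.sum_subset (Finset.subset_univ (y \ F))]
    · refine Finset.sum_congr rfl fun σ hσ => ?_
      by_cases h : y.erase σ = w
      · rw [if_pos h, if_pos ⟨hσ, h⟩, mul_one]
      · rw [if_neg h, if_neg fun h' => h h'.2]; simp
    · intro σ _ hσ
      exact if_neg fun h => hσ h.1
  have e2 : ∀ σ, (∑ y, if σ ∈ y \ F ∧ y.erase σ = w then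
      c y * (-1 : ℝ) ^ (y.filter fun τ => τ < σ).card else 0)
      = if σ ∉ w ∧ σ ∉ F then insSign σ w * c (insert σ w) else 0 := by
    intro σ
    rw [Finset.sum_eq_single (insert σ w)]
    · by_cases hσ : σ ∈ w
      · rw [if_neg, if_neg]
        · exact fun h => h.1 hσ
        · rintro ⟨_, h2⟩
          rw [← h2] at hσ
          simp at hσ
      · rw [Finset.erase_insert hσ, Finset.filter_insert, if_neg (lt_irrefl σ), mul_comm]
        simp [hσ, insSign]
    · intro y _ hy
      refine if_neg ?_
      rintro ⟨h1, h2⟩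
      rw [← h2, Finset.insert_erase (Finset.mem_sdiff.1 h1).1] at hy
      exact hy rfl
    · simp
  rw [e1]
  simp only [e2]
  by_cases hF : F ⊆ w
  · rw [dl_apply F _ hF, ← Finset.sum_subset (Finset.subset_univ wᶜ)]
    · refine Finset.sum_congr rfl fun σ hσ => ?_
      rw [Finset.mem_compl] at hσ
      rw [if_pos ⟨hσ, fun h => hσ (hF h)⟩]
    · intro σ _ hσ
      exact if_neg fun h => hσ (Finset.mem_compl.2 h.1)
  · rw [dl_apply_of_not F _ hF]
    refine Finset.sum_eq_zero fun σ _ => ?_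
    by_cases h : σ ∉ w ∧ σ ∉ F
    · rw [if_pos h, mul_eq_zero]
      right
      by_contra h0
      refine hF fun τ hτ => ?_
      rcases Finset.mem_insert.1 ((hc _ h0).2.1 hτ) with h' | h'
      · exact absurd (h' ▸ hτ) h.2
      · exact h'
    · exact if_neg h

/-- Exactness below the top degree. -/
lemma exists_dl_eq {n : ℕ} (hg : GorensteinOn (Set.univ : Set P) ⊥ n) {F : Finset P}
    (hF : BotChain F) {k : ℕ} (hk : k ≠ n + 1) {c : Finset P → ℝ} (hc : IsCell F k c)
    (hdc : dl F c = 0) : ∃ e, IsCell F (k + 1) e ∧ dl F e = c := by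
  have h := hg F hF k
  rw [if_neg hk, add_zero] at h
  have hle : Submodule.map (bnd F) (cellSpace Set.univ ⊥ F (k + 1)) ≤
      LinearMap.ker (bnd F) ⊓ cellSpace Set.univ ⊥ F k := by
    rintro _ ⟨e, he, rfl⟩
    have he' : IsCell F (k + 1) e := (mem_cellSpace_iff _ _ _).1 he
    have h1 := bnd_eq_dl he'
    have h2 : IsCell F k (bnd F e) := h1 ▸ he'.dl hF.1
    refine ⟨?_, (mem_cellSpace_iff _ _ _).2 h2⟩
    rw [SetLike.mem_coe, LinearMap.mem_ker]
    apply DFunLike.coe_injective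
    rw [bnd_eq_dl h2, h1, dl_dl he']
    rfl
  have heq := Submodule.eq_of_le_of_finrank_eq hle h.symm
  let c' : Finset P →₀ ℝ := Finsupp.equivFunOnFinite.symm c
  have hcc : ⇑c' = c := rfl
  have hm : c' ∈ LinearMap.ker (bnd F) ⊓ cellSpace Set.univ ⊥ F k := by
    refine ⟨?_, (mem_cellSpace_iff _ _ _).2 hc⟩
    rw [SetLike.mem_coe, LinearMap.mem_ker]
    apply DFunLike.coe_injective
    rw [bnd_eq_dl (k := k) (by rwa [hcc]), hcc, hdc]
    rfl
  rw [← heq] at hm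
  obtain ⟨e, he, hec⟩ := hm
  have he' : IsCell F (k + 1) e := (mem_cellSpace_iff _ _ _).1 he
  exact ⟨e, he', by rw [← bnd_eq_dl he', hec, hcc]⟩

lemma exists_generator_of_finrank_eq_one {M : Type*} [AddCommGroup M] [Module ℝ M]
    {W : Submodule ℝ M} (h : Module.finrank ℝ W = 1) :
    ∃ o ∈ W, o ≠ 0 ∧ ∀ c ∈ W, ∃ t : ℝ, c = t • o := by
  obtain ⟨⟨o, ho⟩, ho0, hspan⟩ := (finrank_eq_one_iff' (K := ℝ) (V := W)).1 h
  refine ⟨o, ho, fun h0 => ho0 (Subtype.ext h0), fun c hc => ?_⟩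
  obtain ⟨t, ht⟩ := hspan ⟨c, hc⟩
  exact ⟨t, (congrArg Subtype.val ht).symm⟩

/-- The top cycles form a line. -/
lemma exists_top_cycle {n : ℕ} (hg : GorensteinOn (Set.univ : Set P) ⊥ n)
    (hn : ∀ y : Finset P, BotChain y → y.card ≤ n + 1) {F : Finset P} (hF : BotChain F) :
    ∃ o : Finset P → ℝ, o ≠ 0 ∧ IsCell F (n + 1) o ∧ dl F o = 0 ∧
      ∀ c, IsCell F (n + 1) c → dl F c = 0 → ∃ t : ℝ, c = t • o := by
  have h := hg F hF (n + 1)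
  have hbot : cellSpace Set.univ ⊥ F (n + 1 + 1) = ⊥ := by
    rw [eq_bot_iff]
    intro c hc
    rw [mem_cellSpace_iff] at hc
    rw [Submodule.mem_bot]
    ext y
    by_contra h0
    obtain ⟨h1, _, h3⟩ := hc y h0
    have := hn y h1
    omega
  rw [if_pos rfl, hbot, Submodule.map_bot, finrank_bot, zero_add] at h
  obtain ⟨o, ho, ho0, hspan⟩ := exists_generator_of_finrank_eq_one h
  have hoc : IsCell F (n + 1) o := (mem_cellSpace_iff _ _ _).1 ho.2
  refine ⟨o, fun h0 => ho0 (DFunLike.coe_injective h0), hoc, ?_, ?_⟩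
  · rw [← bnd_eq_dl hoc, show bnd F o = 0 from ho.1]; rfl
  · intro c hc hdc
    let c' : Finset P →₀ ℝ := Finsupp.equivFunOnFinite.symm c
    have hcc : ⇑c' = c := rfl
    have hm : c' ∈ LinearMap.ker (bnd F) ⊓ cellSpace Set.univ ⊥ F (n + 1) := by
      refine ⟨?_, (mem_cellSpace_iff _ _ _).2 hc⟩
      rw [SetLike.mem_coe, LinearMap.mem_ker]
      apply DFunLike.coe_injective
      rw [bnd_eq_dl (k := n + 1) (by rwa [hcc]), hcc, hdc]
      rfl
    obtain ⟨t, ht⟩ := hspan c' hm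
    exact ⟨t, congrArg (fun z : Finset P →₀ ℝ => (z : Finset P → ℝ)) ht⟩

end ChainComplex

section Avoid

set_option linter.unusedSectionVars false

variable {P : Type*} [Fintype P] [PartialOrder P] [OrderBot P] {n : ℕ} {ρ : P → ℕ}

/-- The function `c` is supported on sets whose elements have ranks outside `D`. -/
def Avoids (ρ : P → ℕ) (D : Finset ℕ) (c : Finset P → ℝ) : Prop :=
  ∀ y, c y ≠ 0 → ∀ x ∈ y, ρ x ∉ D

lemma Avoids.sub {D : Finset ℕ} {c e : Finset P → ℝ} (hc : Avoids ρ D c) (he : Avoids ρ D e) :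
    Avoids ρ D (c - e) := by
  intro y hy
  by_cases h : c y = 0
  · exact he y fun h' => hy (by simp [h, h'])
  · exact hc y h

lemma Avoids.dl {D : Finset ℕ} {c : Finset P → ℝ} (hc : Avoids ρ D c) (F : Finset P) :
    Avoids ρ D (dl F c) := by
  intro w hw x hx
  obtain ⟨_, z, _, hz⟩ := exists_of_dl_ne_zero hw
  exact hc _ hz x (Finset.mem_insert_of_mem hx)

lemma Avoids.sum {D : Finset ℕ} {ι : Type*} (s : Finset ι) {c : ι → Finset P → ℝ}
    (hc : ∀ i ∈ s, Avoids ρ D (c i)) : Avoids ρ D (∑ i ∈ s, c i) := by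
  intro y hy
  rw [Finset.sum_apply] at hy
  obtain ⟨i, hi, h⟩ := Finset.exists_ne_zero_of_sum_ne_zero hy
  exact hc i hi y h

lemma BotChain.eq_of_rank_eq {y : Finset P} (hρ : StrictMono ρ) (hy : BotChain y) {a b : P}
    (ha : a ∈ y) (hb : b ∈ y) (h : ρ a = ρ b) : a = b := by
  by_contra hab
  rcases hy.le_total ha hb hab with h' | h'
  · exact absurd h (hρ h').ne
  · exact absurd h (hρ h').ne'

/-- Exactness for rank-selected subposets. -/
lemma exists_dl_eq_of_avoids (hg : GorensteinOn (Set.univ : Set P) ⊥ n) (hρ : StrictMono ρ)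
    (D : Finset ℕ) : ∀ (k : ℕ) (F : Finset P) (c : Finset P → ℝ), BotChain F →
    (∀ x ∈ F, ρ x ∉ D) → k + D.card < n + 1 → IsCell F k c → Avoids ρ D c → dl F c = 0 →
    ∃ e, IsCell F (k + 1) e ∧ dl F e = c ∧ Avoids ρ D e := by
  induction D using Finset.induction_on with
  | empty =>
    intro k F c hF _ hk hc _ hdc
    obtain ⟨e, h1, h2⟩ := exists_dl_eq hg hF (by simpa using hk.ne) hc hdc
    exact ⟨e, h1, h2, fun y _ x _ => Finset.notMem_empty _⟩
  | insert i D hiD ih =>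
    intro k F c hF hFD hk hc hca hdc
    rw [Finset.card_insert_of_notMem hiD] at hk
    obtain ⟨e, he1, he2, he3⟩ := ih k F c hF
      (fun x hx h => hFD x hx (Finset.mem_insert_of_mem h)) (by omega) hc
      (fun y hy x hx h => hca y hy x hx (Finset.mem_insert_of_mem h)) hdc
    have key : ∀ x, ρ x = i → ∃ g, IsCell (insert x F) (k + 1 + 1) g ∧
        dl (insert x F) g = (fun y => if x ∈ y then e y else 0) ∧ Avoids ρ D g := by
      intro x hx
      set ex : Finset P → ℝ := fun y => if x ∈ y then e y else 0 with hex
      have hexc : IsCell (insert x F) (k + 1) ex := by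
        intro y hy
        by_cases hxy : x ∈ y
        · simp only [hex, hxy, if_true] at hy
          obtain ⟨h1, h2, h3⟩ := he1 y hy
          exact ⟨h1, Finset.insert_subset hxy h2, h3⟩
        · simp [hex, hxy] at hy
      by_cases hch : BotChain (insert x F)
      · refine ih (k + 1) (insert x F) ex hch ?_ (by omega) hexc ?_ ?_
        · intro z hz
          rcases Finset.mem_insert.1 hz with rfl | hz
          · rwa [hx]
          · exact fun h => hFD z hz (Finset.mem_insert_of_mem h)
        · intro y hy
          by_cases hxy : x ∈ y
          · simp only [hex, hxy, if_true] at hy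
            exact he3 y hy
          · simp [hex, hxy] at hy
        · funext w
          by_cases hw : insert x F ⊆ w
          · have hxw : x ∈ w := hw (Finset.mem_insert_self _ _)
            have h1 : dl (insert x F) ex w = dl F e w := by
              rw [dl_apply _ _ hw, dl_apply _ _ ((Finset.subset_insert _ _).trans hw)]
              refine Finset.sum_congr rfl fun z _ => ?_
              simp [hex, hxw]
            rw [h1, he2]
            by_contra h0
            exact hca w h0 x hxw (by rw [hx]; exact Finset.mem_insert_self _ _)
          · exact dl_apply_of_not _ _ hw
      · refine ⟨0, fun y hy => absurd rfl hy, ?_, fun y hy => absurd rfl hy⟩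
        rw [map_zero]
        funext y
        by_contra h0
        obtain ⟨h1, h2, _⟩ := hexc y (Ne.symm h0)
        exact hch (h1.subset h2 (Finset.mem_insert_of_mem hF.1))
    choose! g hg1 hg2 hg3 using key
    set T := ∑ x with ρ x = i, g x with hT
    have hTc : IsCell F (k + 1 + 1) T := IsCell.sum _ fun x hx =>
      (hg1 x (Finset.mem_filter.1 hx).2).mono (Finset.subset_insert _ _)
    have hTa : Avoids ρ D T := Avoids.sum _ fun x hx => hg3 x (Finset.mem_filter.1 hx).2
    refine ⟨e - dl F T, he1.sub (hTc.dl hF.1), ?_, ?_⟩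
    · rw [map_sub, dl_dl hTc, sub_zero, he2]
    · intro w hw x hxw hmem
      rcases Finset.mem_insert.1 hmem with hx | hx
      · apply hw
        by_cases hFw : F ⊆ w
        · have h1 : dl F T w = dl F (g x) w := by
            rw [hT, map_sum, Finset.sum_apply]
            refine Finset.sum_eq_single x ?_ ?_
            · intro z hz hzx
              by_contra h0
              obtain ⟨_, v, _, hv⟩ := exists_of_dl_ne_zero h0
              have hzi := (Finset.mem_filter.1 hz).2
              obtain ⟨h1, h2, _⟩ := hg1 z hzi _ hv
              exact hzx (h1.eq_of_rank_eq hρ (h2 (Finset.mem_insert_self _ _))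
                (Finset.mem_insert_of_mem hxw) (by rw [hzi, hx]))
            · intro h
              simp [hx] at h
          have h2 : dl F (g x) w = dl (insert x F) (g x) w := by
            rw [dl_apply _ _ hFw, dl_apply _ _ (Finset.insert_subset hxw hFw)]
          rw [Pi.sub_apply, h1, h2, hg2 x hx]
          simp [hxw]
        · rw [Pi.sub_apply, dl_apply_of_not _ _ hFw, sub_zero]
          by_contra h0
          exact hFw (he1 w h0).2.1
      · exact (he3.sub (hTa.dl F)) w hw x hxw hx

end Avoid

section Flags

set_option linter.unusedSectionVars false

variable {P : Type*} [Fintype P] [PartialOrder P] [OrderBot P] {n : ℕ} {ρ : P → ℕ}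

/-- The sequence `w` restricts to a flag with rank set `U`. -/
def IsFlag (ρ : P → ℕ) (U : Finset ℕ) (w : ℕ → P) : Prop :=
  (∀ i ∈ U, ρ (w i) = i) ∧ ∀ i ∈ U, ∀ j ∈ U, i < j → w i < w j

/-- The chain underlying a flag. -/
noncomputable def fset (U : Finset ℕ) (w : ℕ → P) : Finset P := insert ⊥ (U.image w)

/-- The flag underlying a chain. -/
noncomputable def sec (ρ : P → ℕ) (y : Finset P) (i : ℕ) : P :=
  if h : ∃ x ∈ y, ρ x = i then h.choose else ⊥

/-- The chain `y` has rank set `U`. -/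
def HasType (ρ : P → ℕ) (U : Finset ℕ) (y : Finset P) : Prop :=
  BotChain y ∧ y.image ρ = insert 0 U

lemma IsFlag.mono {U U' : Finset ℕ} {w : ℕ → P} (h : IsFlag ρ U' w) (hU : U ⊆ U') :
    IsFlag ρ U w :=
  ⟨fun i hi => h.1 i (hU hi), fun i hi j hj => h.2 i (hU hi) j (hU hj)⟩

lemma IsFlag.congr {U : Finset ℕ} {w w' : ℕ → P} (h : IsFlag ρ U w)
    (hw : ∀ i ∈ U, w i = w' i) : IsFlag ρ U w' :=
  ⟨fun i hi => hw i hi ▸ h.1 i hi, fun i hi j hj hij => hw i hi ▸ hw j hj ▸ h.2 i hi j hj hij⟩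

lemma IsFlag.congr_iff {U : Finset ℕ} {w w' : ℕ → P}
    (hw : ∀ i ∈ U, w i = w' i) : IsFlag ρ U w ↔ IsFlag ρ U w' :=
  ⟨fun h => h.congr hw, fun h => h.congr fun i hi => (hw i hi).symm⟩

lemma fset_congr {U : Finset ℕ} {w w' : ℕ → P} (hw : ∀ i ∈ U, w i = w' i) :
    fset U w = fset U w' := by
  rw [fset, fset, Finset.image_congr fun i hi => hw i hi]

lemma mem_fset {U : Finset ℕ} {w : ℕ → P} {x : P} :
    x ∈ fset U w ↔ x = ⊥ ∨ ∃ i ∈ U, w i = x := by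
  simp [fset]

lemma fset_subset {U U' : Finset ℕ} (h : U ⊆ U') (w : ℕ → P) : fset U w ⊆ fset U' w :=
  Finset.insert_subset_insert _ (Finset.image_subset_image h)

lemma IsFlag.hasType (hρ0 : ρ ⊥ = 0) {U : Finset ℕ} {w : ℕ → P}
    (h : IsFlag ρ U w) : HasType ρ U (fset U w) := by
  refine ⟨⟨Finset.mem_insert_self _ _, Set.subset_univ _, ?_⟩, ?_⟩
  · intro a ha b hb hab
    rcases mem_fset.1 ha with rfl | ⟨i, hi, rfl⟩
    · exact Or.inl (bot_lt_iff_ne_bot.2 hab.symm)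
    rcases mem_fset.1 hb with rfl | ⟨j, hj, rfl⟩
    · exact Or.inr (bot_lt_iff_ne_bot.2 hab)
    rcases lt_trichotomy i j with h' | rfl | h'
    · exact Or.inl (h.2 i hi j hj h')
    · exact absurd rfl hab
    · exact Or.inr (h.2 j hj i hi h')
  · rw [fset, Finset.image_insert, hρ0, Finset.image_image]
    congr 1
    exact (Finset.image_congr fun i hi => h.1 i hi).trans Finset.image_id

lemma HasType.card (hρ : StrictMono ρ) {U : Finset ℕ} (h0 : 0 ∉ U) {y : Finset P}
    (h : HasType ρ U y) : y.card = U.card + 1 := by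
  rw [← Finset.card_insert_of_notMem h0, ← h.2, Finset.card_image_of_injOn]
  exact fun a ha b hb hab => h.1.eq_of_rank_eq hρ ha hb hab

lemma sec_spec {y : Finset P} {i : ℕ} (h : i ∈ y.image ρ) :
    sec ρ y i ∈ y ∧ ρ (sec ρ y i) = i := by
  have h' : ∃ x ∈ y, ρ x = i := Finset.mem_image.1 h
  rw [sec, dif_pos h']
  exact h'.choose_spec

lemma BotChain.sec_eq (hρ : StrictMono ρ) {y : Finset P} (hy : BotChain y) {x : P}
    (hx : x ∈ y) : sec ρ y (ρ x) = x := by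
  have := sec_spec (Finset.mem_image_of_mem ρ hx)
  exact hy.eq_of_rank_eq hρ this.1 hx this.2

lemma HasType.isFlag (hρ : StrictMono ρ) {U : Finset ℕ} {y : Finset P}
    (h : HasType ρ U y) : IsFlag ρ U (sec ρ y) := by
  have hs : ∀ i ∈ U, sec ρ y i ∈ y ∧ ρ (sec ρ y i) = i := fun i hi =>
    sec_spec (by rw [h.2]; exact Finset.mem_insert_of_mem hi)
  refine ⟨fun i hi => (hs i hi).2, fun i hi j hj hij => ?_⟩
  rcases h.1.le_total (hs i hi).1 (hs j hj).1 fun h' => by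
    have h1 := (hs i hi).2
    rw [h', (hs j hj).2] at h1
    omega with h' | h'
  · exact h'
  · have := hρ h'
    rw [(hs i hi).2, (hs j hj).2] at this
    omega

lemma HasType.fset_sec (hρ : StrictMono ρ) (hρ0 : ρ ⊥ = 0) {U : Finset ℕ} {y : Finset P}
    (h : HasType ρ U y) : fset U (sec ρ y) = y := by
  ext x
  rw [mem_fset]
  constructor
  · rintro (rfl | ⟨i, hi, rfl⟩)
    · exact h.1.1
    · exact (sec_spec (by rw [h.2]; exact Finset.mem_insert_of_mem hi)).1
  · intro hx
    have h1 := Finset.mem_image_of_mem ρ hx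
    rw [h.2] at h1
    rcases Finset.mem_insert.1 h1 with h1 | h1
    · exact Or.inl (h.1.eq_of_rank_eq hρ hx h.1.1 (h1.trans hρ0.symm))
    · exact Or.inr ⟨_, h1, h.1.sec_eq hρ hx⟩

lemma IsFlag.sec_fset (hρ : StrictMono ρ) (hρ0 : ρ ⊥ = 0) {U : Finset ℕ}
    {w : ℕ → P} (h : IsFlag ρ U w) {i : ℕ} (hi : i ∈ U) : sec ρ (fset U w) i = w i := by
  have hm : w i ∈ fset U w := mem_fset.2 (Or.inr ⟨i, hi, rfl⟩)
  have := (h.hasType hρ0).1.sec_eq hρ hm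
  rwa [h.1 i hi] at this

/-- The sign of inserting an element of rank `j` in a chain. -/
noncomputable def rankSign (U : Finset ℕ) (j : ℕ) : ℝ :=
  (-1) ^ ((insert 0 (U.erase j)).filter (· < j)).card

lemma rankSign_mul_self (U : Finset ℕ) (j : ℕ) : rankSign U j * rankSign U j = 1 := by
  rw [rankSign, ← mul_pow]; norm_num

lemma fset_insert_update {U : Finset ℕ} {j : ℕ} (hj : j ∈ U) (w : ℕ → P) (x : P) :
    fset U (Function.update w j x) = insert x (fset (U.erase j) w) := by
  conv_lhs => rw [← Finset.insert_erase hj]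
  rw [fset, fset, Finset.image_insert, Function.update_self, Finset.insert_comm]
  congr 2
  exact Finset.image_congr fun i hi =>
    Function.update_of_ne (Finset.ne_of_mem_erase (Finset.mem_coe.1 hi)) _ _

lemma IsFlag.erase_of_update {U : Finset ℕ} {j : ℕ} {w : ℕ → P} {x : P}
    (h : IsFlag ρ U (Function.update w j x)) : IsFlag ρ (U.erase j) w :=
  (h.mono (Finset.erase_subset _ _)).congr fun _ hi =>
    Function.update_of_ne (Finset.ne_of_mem_erase hi) _ _

lemma notMem_fset_erase (hρ0 : ρ ⊥ = 0) {U : Finset ℕ} (h0 : 0 ∉ U) {j : ℕ} (hj : j ∈ U)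
    {w : ℕ → P} (hw : IsFlag ρ (U.erase j) w) {x : P} (hx : ρ x = j) :
    x ∉ fset (U.erase j) w := by
  intro h
  have := Finset.mem_image_of_mem ρ h
  rw [(hw.hasType hρ0).2, hx] at this
  rcases Finset.mem_insert.1 this with h | h
  · exact h0 (h ▸ hj)
  · exact (Finset.ne_of_mem_erase h) rfl

lemma insSign_fset (hρ : StrictMono ρ) (hρ0 : ρ ⊥ = 0) {U : Finset ℕ} {j : ℕ}
    (hj : j ∈ U) {w : ℕ → P} {x : P} (h : IsFlag ρ U (Function.update w j x)) :
    insSign x (fset (U.erase j) w) = rankSign U j := by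
  have hw := h.erase_of_update
  have ht := hw.hasType hρ0
  have hx : ρ x = j := by simpa using h.1 j hj
  have hch : BotChain (insert x (fset (U.erase j) w)) := by
    rw [← fset_insert_update hj]
    exact (h.hasType hρ0).1
  rw [insSign, rankSign, ← ht.2, Finset.filter_image, Finset.card_image_of_injOn]
  · congr 2
    ext a
    simp only [Finset.mem_filter, and_congr_right_iff]
    intro ha
    refine ⟨fun hax => hx ▸ hρ hax, fun hax => ?_⟩
    rcases hch.le_total (Finset.mem_insert_of_mem ha) (Finset.mem_insert_self _ _)
      (fun h' => by rw [h', hx] at hax; exact lt_irrefl _ hax) with h' | h'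
    · exact h'
    · have := hρ h'
      omega
  · exact fun a ha b hb hab => ht.1.eq_of_rank_eq hρ (Finset.mem_filter.1 ha).1
      (Finset.mem_filter.1 hb).1 hab

/-- Functions on flags from functions on chains. -/
noncomputable def toFlagFun (ρ : P → ℕ) (U : Finset ℕ) (c : Finset P → ℝ) (w : ℕ → P) : ℝ :=
  if IsFlag ρ U w then c (fset U w) else 0

/-- Functions on chains from functions on flags. -/
noncomputable def toChainFun (ρ : P → ℕ) (U : Finset ℕ) (K : (ℕ → P) → ℝ) (y : Finset P) : ℝ :=
  if HasType ρ U y then K (sec ρ y) else 0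

lemma toFlagFun_congr (U : Finset ℕ) (c : Finset P → ℝ) {w w' : ℕ → P}
    (h : ∀ i ∈ U, w i = w' i) : toFlagFun ρ U c w = toFlagFun ρ U c w' := by
  rw [toFlagFun, toFlagFun, fset_congr h]
  simp only [IsFlag.congr_iff (ρ := ρ) h]

lemma sum_toFlagFun_update (hρ : StrictMono ρ) (hρ0 : ρ ⊥ = 0) {U : Finset ℕ} (h0 : 0 ∉ U)
    {j : ℕ} (hj : j ∈ U) {F : Finset P} {c : Finset P → ℝ}
    (hc : ∀ y, c y ≠ 0 → HasType ρ U y ∧ F ⊆ y) (hF : ∀ x ∈ F, ρ x ≠ j) (w : ℕ → P) :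
    ∑ x, toFlagFun ρ U c (Function.update w j x)
      = if IsFlag ρ (U.erase j) w then rankSign U j * dl F c (fset (U.erase j) w) else 0 := by
  split_ifs with hw
  · by_cases hFw : F ⊆ fset (U.erase j) w
    · rw [dl_apply F c hFw, Finset.mul_sum, ← Finset.sum_subset (Finset.subset_univ (fset _ w)ᶜ)]
      · refine Finset.sum_congr rfl fun x hx => ?_
        rw [toFlagFun, fset_insert_update hj]
        split_ifs with hfl
        · rw [insSign_fset hρ hρ0 hj hfl, ← mul_assoc, rankSign_mul_self, one_mul]
        · by_cases h : c (insert x (fset (U.erase j) w)) = 0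
          · rw [h]; ring
          · exfalso
            apply hfl
            have ht := (hc _ h).1
            have hwt := hw.hasType hρ0
            have hxj : ρ x = j := by
              have h1 : j ∈ (insert x (fset (U.erase j) w)).image ρ := by
                rw [ht.2]; exact Finset.mem_insert_of_mem hj
              rw [Finset.image_insert, hwt.2] at h1
              rcases Finset.mem_insert.1 h1 with h1 | h1
              · exact h1.symm
              · rcases Finset.mem_insert.1 h1 with h1 | h1
                · exact absurd (h1 ▸ hj) h0
                · exact absurd rfl (Finset.ne_of_mem_erase h1)
            refine (ht.isFlag hρ).congr fun i hi => ?_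
            by_cases hij : i = j
            · rw [hij, Function.update_self]
              have := ht.1.sec_eq hρ (Finset.mem_insert_self _ _)
              rwa [hxj] at this
            · rw [Function.update_of_ne hij]
              have hi' : i ∈ U.erase j := Finset.mem_erase.2 ⟨hij, hi⟩
              have := ht.1.sec_eq hρ (Finset.mem_insert_of_mem
                (mem_fset.2 (Or.inr ⟨i, hi', rfl⟩)) : w i ∈ _)
              rwa [hw.1 i hi'] at this
      · intro x _ hx
        rw [toFlagFun, if_neg]
        intro hfl
        rw [Finset.mem_compl, not_not] at hx
        exact notMem_fset_erase hρ0 h0 hj hw (by simpa using hfl.1 j hj) hx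
    · rw [dl_apply_of_not F c hFw, mul_zero]
      refine Finset.sum_eq_zero fun x _ => ?_
      rw [toFlagFun]
      split_ifs with hfl
      · by_contra h
        refine hFw fun z hz => ?_
        have h1 := (hc _ h).2 hz
        rw [fset_insert_update hj] at h1
        rcases Finset.mem_insert.1 h1 with h1 | h1
        · exact absurd (h1 ▸ (by simpa using hfl.1 j hj)) (hF z hz)
        · exact h1
      · rfl
  · exact Finset.sum_eq_zero fun x _ => if_neg fun h => hw h.erase_of_update

end Flags

section Cycles

set_option linter.unusedSectionVars false

variable {P : Type*} [Fintype P] [PartialOrder P] [OrderBot P] {n : ℕ} {ρ : P → ℕ}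

/-- A Gorenstein poset together with a rank function bounded by `n`. -/
structure GorRank (n : ℕ) (ρ : P → ℕ) : Prop where
  gor : GorensteinOn (Set.univ : Set P) ⊥ n
  mono : StrictMono ρ
  bot : ρ ⊥ = 0
  le : ∀ x, ρ x ≤ n

/-- Functions of the coordinates in `U`, supported on flags agreeing with `f` on `A`, and with
vanishing sums in the directions in `J`. -/
def Cyc (ρ : P → ℕ) (U A J : Finset ℕ) (f : ℕ → P) : Submodule ℝ ((ℕ → P) → ℝ) where
  carrier := {K | (∀ w w', (∀ i ∈ U, w i = w' i) → K w = K w') ∧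
    (∀ w, K w ≠ 0 → IsFlag ρ U w ∧ ∀ i ∈ A, w i = f i) ∧
    ∀ j ∈ J, ∀ w, ∑ x, K (Function.update w j x) = 0}
  add_mem' := by
    rintro K L ⟨h1, h2, h3⟩ ⟨h1', h2', h3'⟩
    refine ⟨fun w w' h => ?_, fun w h => ?_, fun j hj w => ?_⟩
    · simp [h1 w w' h, h1' w w' h]
    · by_cases h0 : K w = 0
      · exact h2' w fun h' => h (by simp [h0, h'])
      · exact h2 w h0
    · simp [Finset.sum_add_distrib, h3 j hj w, h3' j hj w]
  zero_mem' := ⟨fun _ _ _ => rfl, fun _ h => absurd rfl h, fun _ _ _ => by simp⟩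
  smul_mem' := by
    rintro t K ⟨h1, h2, h3⟩
    refine ⟨fun w w' h => ?_, fun w h => ?_, fun j hj w => ?_⟩
    · simp [h1 w w' h]
    · exact h2 w fun h' => h (by simp [h'])
    · simp [← Finset.mul_sum, h3 j hj w]

lemma Cyc.isFlag {U A J : Finset ℕ} {f : ℕ → P} {K : (ℕ → P) → ℝ} (hK : K ∈ Cyc ρ U A J f)
    {w : ℕ → P} (hw : K w ≠ 0) (hA : A ⊆ U) : IsFlag ρ A f :=
  ((hK.2.1 w hw).1.mono hA).congr (hK.2.1 w hw).2

lemma rank_ne_of_mem_fset (hρ0 : ρ ⊥ = 0) {A : Finset ℕ} {f : ℕ → P} (hf : IsFlag ρ A f) {j : ℕ}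
    (hj0 : j ≠ 0) (hjA : j ∉ A) {x : P} (hx : x ∈ fset A f) : ρ x ≠ j := by
  rcases mem_fset.1 hx with rfl | ⟨i, hi, rfl⟩
  · rw [hρ0]; exact hj0.symm
  · rw [hf.1 i hi]
    rintro rfl
    exact hjA hi

lemma toChainFun_support (H : GorRank n ρ) {U A J : Finset ℕ} (hA : A ⊆ U)
    {f : ℕ → P} {K : (ℕ → P) → ℝ} (hK : K ∈ Cyc ρ U A J f) (y : Finset P)
    (hy : toChainFun ρ U K y ≠ 0) : HasType ρ U y ∧ fset A f ⊆ y := by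
  rw [toChainFun] at hy
  split_ifs at hy with ht
  swap
  · exact absurd rfl hy
  refine ⟨ht, ?_⟩
  rw [← fset_congr (hK.2.1 _ hy).2]
  conv_rhs => rw [← ht.fset_sec H.mono H.bot]
  exact fset_subset hA _

lemma toFlagFun_toChainFun (H : GorRank n ρ) {U A J : Finset ℕ}
    {f : ℕ → P} {K : (ℕ → P) → ℝ} (hK : K ∈ Cyc ρ U A J f) :
    toFlagFun ρ U (toChainFun ρ U K) = K := by
  funext w
  rw [toFlagFun]
  split_ifs with hw
  · rw [toChainFun, if_pos (hw.hasType H.bot)]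
    exact hK.1 _ _ fun i hi => hw.sec_fset H.mono H.bot hi
  · by_contra h
    exact hw (hK.2.1 w (Ne.symm h)).1

lemma dl_toChainFun (H : GorRank n ρ) {U A J : Finset ℕ} (h0 : 0 ∉ U) (hA : A ⊆ U)
    (hJ : U \ A ⊆ J) {f : ℕ → P} (hf : IsFlag ρ A f) {K : (ℕ → P) → ℝ} (hK : K ∈ Cyc ρ U A J f) :
    dl (fset A f) (toChainFun ρ U K) = 0 := by
  funext v
  by_contra hv
  obtain ⟨hFv, x, hx, hxv⟩ := exists_of_dl_ne_zero hv
  obtain ⟨ht, hF⟩ := toChainFun_support H hA hK _ hxv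
  have hxU : ρ x ∈ U := by
    have h1 := Finset.mem_image_of_mem ρ (Finset.mem_insert_self x v)
    rw [ht.2] at h1
    rcases Finset.mem_insert.1 h1 with h1 | h1
    · have := ht.1.eq_of_rank_eq H.mono (Finset.mem_insert_self x v) ht.1.1 (h1.trans H.bot.symm)
      exact absurd (this ▸ hFv (Finset.mem_insert_self _ _)) hx
    · exact h1
  have hxA : ρ x ∉ A := by
    intro h
    have hm : f (ρ x) ∈ v := hFv (mem_fset.2 (Or.inr ⟨_, h, rfl⟩))
    have := ht.1.eq_of_rank_eq H.mono (Finset.mem_insert_self x v) (Finset.mem_insert_of_mem hm)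
      (hf.1 _ h).symm
    exact hx (this ▸ hm)
  set w := sec ρ (insert x v) with hw
  have hfl : IsFlag ρ U w := ht.isFlag H.mono
  have hv' : fset (U.erase (ρ x)) w = v := by
    have h1 : fset U w = insert x v := ht.fset_sec H.mono H.bot
    have h2 : Function.update w (ρ x) x = w := by
      rw [Function.update_eq_self_iff]
      exact (ht.1.sec_eq H.mono (Finset.mem_insert_self _ _)).symm
    have h3 := fset_insert_update hxU w x
    rw [h2, h1] at h3
    have h4 := notMem_fset_erase H.bot h0 hxU (hfl.mono (Finset.erase_subset _ _)) (x := x) rfl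
    rw [← Finset.erase_insert hx, h3, Finset.erase_insert h4]
  have h1 := sum_toFlagFun_update H.mono H.bot h0 hxU
    (fun y hy => toChainFun_support H hA hK y hy)
    (fun z hz => rank_ne_of_mem_fset H.bot hf (fun h => h0 (h ▸ hxU)) hxA hz) w
  rw [toFlagFun_toChainFun H hK, hK.2.2 _ (hJ (Finset.mem_sdiff.2 ⟨hxU, hxA⟩)),
    if_pos (hfl.mono (Finset.erase_subset _ _)), hv'] at h1
  have h2 : rankSign U (ρ x) ≠ 0 := fun h => by
    have := rankSign_mul_self U (ρ x)
    rw [h] at this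
    simp at this
  exact hv ((mul_eq_zero.1 h1.symm).resolve_left h2)

lemma toFlagFun_mem_cyc (H : GorRank n ρ) {U A J : Finset ℕ} (h0 : 0 ∉ U) (hA : A ⊆ U)
    (hJ : J ⊆ U \ A) {f : ℕ → P} (hf : IsFlag ρ A f) {c : Finset P → ℝ}
    (hc : ∀ y, c y ≠ 0 → HasType ρ U y ∧ fset A f ⊆ y)
    (hd : ∀ j ∈ J, ∀ w, IsFlag ρ (U.erase j) w → dl (fset A f) c (fset (U.erase j) w) = 0) :
    toFlagFun ρ U c ∈ Cyc ρ U A J f := by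
  refine ⟨fun w w' h => toFlagFun_congr U c h, fun w hw => ?_, fun j hj w => ?_⟩
  · rw [toFlagFun] at hw
    split_ifs at hw with hfl
    swap
    · exact absurd rfl hw
    refine ⟨hfl, fun i hi => ?_⟩
    obtain ⟨ht, hF⟩ := hc _ hw
    refine ht.1.eq_of_rank_eq H.mono (mem_fset.2 (Or.inr ⟨i, hA hi, rfl⟩))
      (hF (mem_fset.2 (Or.inr ⟨i, hi, rfl⟩))) ?_
    rw [hfl.1 i (hA hi), hf.1 i hi]
  · have hj' := Finset.mem_sdiff.1 (hJ hj)
    rw [sum_toFlagFun_update H.mono H.bot h0 hj'.1 hc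
      (fun z hz => rank_ne_of_mem_fset H.bot hf (fun h => h0 (h ▸ hj'.1)) hj'.2 hz)]
    split_ifs with hw
    · rw [hd j hj w hw, mul_zero]
    · rfl

lemma zero_notMem_of_subset {U : Finset ℕ} (hU : U ⊆ Finset.Icc 1 n) : 0 ∉ U := fun h => by
  simpa using hU h

/-- Cycles lift in any new direction. -/
lemma exists_lift (H : GorRank n ρ) {U A : Finset ℕ} (hU : U ⊆ Finset.Icc 1 n) (hA : A ⊆ U)
    {i : ℕ} (hi : i ∈ Finset.Icc 1 n) (hiU : i ∉ U) {f : ℕ → P} {K : (ℕ → P) → ℝ}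
    (hK : K ∈ Cyc ρ U A (U \ A) f) :
    ∃ E ∈ Cyc ρ (insert i U) A (U \ A) f, ∀ w, ∑ x, E (Function.update w i x) = K w := by
  by_cases hK0 : K = 0
  · exact ⟨0, Submodule.zero_mem _, fun w => by simp [hK0]⟩
  obtain ⟨w0, hw0⟩ := Function.ne_iff.1 hK0
  have hf : IsFlag ρ A f := Cyc.isFlag hK hw0 hA
  have h0 := zero_notMem_of_subset hU
  have hi0 : i ≠ 0 := by have := Finset.mem_Icc.1 hi; omega
  have hU' : insert i U ⊆ Finset.Icc 1 n := Finset.insert_subset hi hU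
  have h0' := zero_notMem_of_subset hU'
  set c := toChainFun ρ U K with hc
  have hcs := toChainFun_support H hA hK
  have hcard : ((Finset.Icc 1 n) \ insert i U).card + (U.card + 1) = n := by
    have := Finset.card_sdiff_add_card_eq_card hU'
    rw [Finset.card_insert_of_notMem hiU] at this
    simpa using this
  obtain ⟨e, he1, he2, he3⟩ := exists_dl_eq_of_avoids H.gor H.mono (Finset.Icc 1 n \ insert i U)
    (U.card + 1) (fset A f) c (hf.hasType H.bot).1
    (by
      intro x hx
      rcases mem_fset.1 hx with rfl | ⟨j, hj, rfl⟩
      · rw [H.bot]; simp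
      · rw [hf.1 j hj]
        simp [hA hj])
    (by omega)
    (fun y hy => ⟨(hcs y hy).1.1, (hcs y hy).2, (hcs y hy).1.card H.mono h0⟩)
    (by
      intro y hy x hx
      have := Finset.mem_image_of_mem ρ hx
      rw [(hcs y hy).1.2] at this
      rcases Finset.mem_insert.1 this with h | h
      · simp [h]
      · simp [h])
    (dl_toChainFun H h0 hA subset_rfl hf hK)
  have hes : ∀ y, e y ≠ 0 → HasType ρ (insert i U) y ∧ fset A f ⊆ y := by
    intro y hy
    obtain ⟨h1, h2, h3⟩ := he1 y hy
    refine ⟨⟨h1, Finset.eq_of_subset_of_card_le ?_ ?_⟩, h2⟩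
    · intro r hr
      obtain ⟨x, hx, rfl⟩ := Finset.mem_image.1 hr
      have h4 := he3 y hy x hx
      have h5 := H.le x
      by_contra h6
      refine h4 (Finset.mem_sdiff.2 ⟨Finset.mem_Icc.2 ⟨?_, h5⟩,
        fun h7 => h6 (Finset.mem_insert_of_mem h7)⟩)
      by_contra h7
      exact h6 (Finset.mem_insert.2 (Or.inl (by omega)))
    · rw [Finset.card_insert_of_notMem h0', Finset.card_insert_of_notMem hiU,
        Finset.card_image_of_injOn fun a ha b hb hab => h1.eq_of_rank_eq H.mono ha hb hab, h3]
  refine ⟨rankSign (insert i U) i • toFlagFun ρ (insert i U) e, Submodule.smul_mem _ _ ?_, ?_⟩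
  · refine toFlagFun_mem_cyc H h0' (hA.trans (Finset.subset_insert _ _)) ?_ hf hes ?_
    · exact Finset.sdiff_subset_sdiff (Finset.subset_insert _ _) subset_rfl
    · intro j hj w hw
      rw [he2]
      by_contra h
      have h1 := (hcs _ h).1.2
      have h2 := Finset.mem_sdiff.1 hj
      rw [(hw.hasType H.bot).2] at h1
      have h3 : j ∈ insert 0 U := Finset.mem_insert_of_mem h2.1
      rw [← h1] at h3
      rcases Finset.mem_insert.1 h3 with h3 | h3
      · exact h0 (h3 ▸ h2.1)
      · exact Finset.ne_of_mem_erase h3 rfl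
  · intro w
    simp only [Pi.smul_apply, smul_eq_mul]
    rw [← Finset.mul_sum, sum_toFlagFun_update H.mono H.bot h0' (Finset.mem_insert_self i U) hes
      (fun z hz => rank_ne_of_mem_fset H.bot hf hi0 (fun h => hiU (hA h)) hz),
      Finset.erase_insert hiU, he2]
    conv_rhs => rw [← toFlagFun_toChainFun H hK, toFlagFun]
    split_ifs
    · rw [← mul_assoc, rankSign_mul_self, one_mul]
    · rw [mul_zero]

/-- The full cycles extending a given flag form a line. -/
lemma exists_top_generator (H : GorRank n ρ) {A : Finset ℕ} (hA : A ⊆ Finset.Icc 1 n)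
    {f : ℕ → P} (hf : IsFlag ρ A f) :
    ∃ O ∈ Cyc ρ (Finset.Icc 1 n) A (Finset.Icc 1 n \ A) f, O ≠ 0 ∧
      ∀ K ∈ Cyc ρ (Finset.Icc 1 n) A (Finset.Icc 1 n \ A) f, ∃ t : ℝ, K = t • O := by
  have h0 : 0 ∉ Finset.Icc 1 n := by simp
  have him : ∀ y : Finset P, y.image ρ ⊆ insert 0 (Finset.Icc 1 n) := by
    intro y r hr
    obtain ⟨x, _, rfl⟩ := Finset.mem_image.1 hr
    have := H.le x
    rw [Finset.mem_insert, Finset.mem_Icc]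
    omega
  have hci : ∀ y : Finset P, BotChain y → (y.image ρ).card = y.card := fun y hy =>
    Finset.card_image_of_injOn fun a ha b hb hab => hy.eq_of_rank_eq H.mono ha hb hab
  have hn : ∀ y : Finset P, BotChain y → y.card ≤ n + 1 := by
    intro y hy
    have := Finset.card_le_card (him y)
    rwa [Finset.card_insert_of_notMem h0, Nat.card_Icc, hci y hy] at this
  obtain ⟨o, ho0, ho1, ho2, ho3⟩ := exists_top_cycle H.gor hn (hf.hasType H.bot).1
  have hos : ∀ y, o y ≠ 0 → HasType ρ (Finset.Icc 1 n) y ∧ fset A f ⊆ y := by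
    intro y hy
    obtain ⟨h1, h2, h3⟩ := ho1 y hy
    refine ⟨⟨h1, Finset.eq_of_subset_of_card_le (him y) ?_⟩, h2⟩
    rw [Finset.card_insert_of_notMem h0, Nat.card_Icc, hci y h1, h3]
    omega
  refine ⟨toFlagFun ρ (Finset.Icc 1 n) o, toFlagFun_mem_cyc H h0 hA subset_rfl hf hos
    (fun j _ w _ => by rw [ho2]; rfl), ?_, ?_⟩
  · obtain ⟨y, hy⟩ := Function.ne_iff.1 ho0
    refine Function.ne_iff.2 ⟨sec ρ y, ?_⟩
    have ht := (hos y hy).1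
    rw [toFlagFun, if_pos (ht.isFlag H.mono), ht.fset_sec H.mono H.bot]
    exact hy
  · intro K hK
    have hcs := toChainFun_support H hA hK
    obtain ⟨t, ht⟩ := ho3 (toChainFun ρ (Finset.Icc 1 n) K)
      (fun y hy => ⟨(hcs y hy).1.1, (hcs y hy).2, by
        rw [(hcs y hy).1.card H.mono h0, Nat.card_Icc]; omega⟩)
      (dl_toChainFun H h0 hA subset_rfl hf hK)
    refine ⟨t, ?_⟩
    rw [← toFlagFun_toChainFun H hK, ht]
    funext w
    simp only [toFlagFun, Pi.smul_apply, smul_eq_mul]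
    split_ifs <;> simp

end Cycles

section FullSupport

set_option linter.unusedSectionVars false

variable {P : Type*} [Fintype P] [PartialOrder P] [OrderBot P] {n : ℕ} {ρ : P → ℕ}

/-- Cycles on full flags which agree with `f` on `A`. -/
abbrev FCyc (ρ : P → ℕ) (n : ℕ) (A : Finset ℕ) (f : ℕ → P) : Submodule ℝ ((ℕ → P) → ℝ) :=
  Cyc ρ (Finset.Icc 1 n) A (Finset.Icc 1 n \ A) f

lemma fCyc_mul_comm (H : GorRank n ρ) {A : Finset ℕ} (hA : A ⊆ Finset.Icc 1 n) {f : ℕ → P}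
    {K L : (ℕ → P) → ℝ} (hK : K ∈ FCyc ρ n A f) (hL : L ∈ FCyc ρ n A f) (w v : ℕ → P) :
    K w * L v = K v * L w := by
  by_cases hf : IsFlag ρ A f
  · obtain ⟨O, _, _, h⟩ := exists_top_generator H hA hf
    obtain ⟨s, rfl⟩ := h K hK
    obtain ⟨t, rfl⟩ := h L hL
    simp only [Pi.smul_apply, smul_eq_mul]
    ring
  · have h : ∀ u, K u = 0 := fun u => by
      by_contra h
      exact hf (Cyc.isFlag hK h hA)
    rw [h, h, zero_mul, zero_mul]

lemma exists_full_flag (H : GorRank n ρ) {A : Finset ℕ} (hA : A ⊆ Finset.Icc 1 n) {f : ℕ → P}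
    (hf : IsFlag ρ A f) : ∃ w, IsFlag ρ (Finset.Icc 1 n) w ∧ ∀ i ∈ A, w i = f i := by
  obtain ⟨O, hO, h0, _⟩ := exists_top_generator H hA hf
  obtain ⟨w, hw⟩ := Function.ne_iff.1 h0
  exact ⟨w, hO.2.1 w hw⟩

lemma restrict_mem_cyc {U A J : Finset ℕ} {f : ℕ → P} {K : (ℕ → P) → ℝ}
    (hK : K ∈ Cyc ρ U A J f) {i : ℕ} (hi : i ∈ U) (hiA : i ∉ A) (x : P) :
    (fun w => if w i = x then K w else 0) ∈
      Cyc ρ U (insert i A) (J.erase i) (Function.update f i x) := by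
  refine ⟨fun w w' h => ?_, fun w hw => ?_, fun j hj w => ?_⟩
  · simp only [h i hi, hK.1 w w' h]
  · by_cases hx : w i = x
    · simp only [hx, if_true] at hw
      refine ⟨(hK.2.1 w hw).1, fun k hk => ?_⟩
      rcases Finset.mem_insert.1 hk with rfl | hk
      · rw [hx, Function.update_self]
      · rw [Function.update_of_ne (ne_of_mem_of_not_mem hk hiA), (hK.2.1 w hw).2 k hk]
    · simp [hx] at hw
  · have h1 := Finset.mem_erase.1 hj
    simp only [Function.update_of_ne h1.1.symm]
    split_ifs
    · exact hK.2.2 j h1.2 w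
    · simp

lemma sdiff_insert_eq_erase (U A : Finset ℕ) (i : ℕ) : U \ insert i A = (U \ A).erase i := by
  ext k
  simp only [Finset.mem_sdiff, Finset.mem_insert, Finset.mem_erase]
  tauto

/-- The difference of two point masses in the direction `i` is a cycle. -/
lemma pointDiff_mem_cyc {A : Finset ℕ} {f : ℕ → P} {i : ℕ} (hiA : i ∉ A) {w w' : ℕ → P}
    (hw : IsFlag ρ (insert i A) w) (hw' : IsFlag ρ (insert i A) w')
    (hwf : ∀ k ∈ A, w k = f k) (hwf' : ∀ k ∈ A, w' k = f k) :
    (fun v : ℕ → P => if ∀ k ∈ A, v k = f k then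
      ((if v i = w i then 1 else 0) - (if v i = w' i then 1 else 0) : ℝ) else 0)
      ∈ Cyc ρ (insert i A) A (insert i A \ A) f := by
  refine ⟨fun v v' h => ?_, fun v hv => ?_, fun j hj v => ?_⟩
  · have h1 : (∀ k ∈ A, v k = f k) ↔ ∀ k ∈ A, v' k = f k :=
      forall₂_congr fun k hk => by rw [h k (Finset.mem_insert_of_mem hk)]
    simp only [h1, h i (Finset.mem_insert_self _ _)]
  · by_cases hvA : ∀ k ∈ A, v k = f k
    swap
    · simp [hvA] at hv
    refine ⟨?_, hvA⟩
    by_cases h1 : v i = w i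
    · refine hw.congr fun k hk => ?_
      rcases Finset.mem_insert.1 hk with rfl | hk
      · exact h1.symm
      · rw [hwf k hk, hvA k hk]
    by_cases h2 : v i = w' i
    · refine hw'.congr fun k hk => ?_
      rcases Finset.mem_insert.1 hk with rfl | hk
      · exact h2.symm
      · rw [hwf' k hk, hvA k hk]
    · simp [h1, h2] at hv
  · obtain rfl : j = i := by
      simp only [Finset.mem_sdiff, Finset.mem_insert] at hj
      tauto
    have h1 : ∀ x, (∀ k ∈ A, Function.update v j x k = f k) ↔ ∀ k ∈ A, v k = f k := fun x =>
      forall₂_congr fun k hk => by rw [Function.update_of_ne (ne_of_mem_of_not_mem hk hiA)]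
    simp only [h1, Function.update_self]
    split_ifs
    · simp [Finset.sum_sub_distrib]
    · simp

/-- A nonzero cycle vanishes on no full flag. -/
lemma fCyc_ne_zero (H : GorRank n ρ) (m : ℕ) : ∀ (A : Finset ℕ) (f : ℕ → P) (K : (ℕ → P) → ℝ),
    A ⊆ Finset.Icc 1 n → (Finset.Icc 1 n \ A).card = m → K ∈ FCyc ρ n A f → K ≠ 0 →
    ∀ w, IsFlag ρ (Finset.Icc 1 n) w → (∀ i ∈ A, w i = f i) → K w ≠ 0 := by
  induction m with
  | zero =>
    intro A f K hA hm hK hK0 w hw hwf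
    obtain ⟨w0, hw0⟩ := Function.ne_iff.1 hK0
    have hIA : Finset.Icc 1 n ⊆ A := Finset.sdiff_eq_empty_iff_subset.1 (Finset.card_eq_zero.1 hm)
    rw [hK.1 w w0 fun i hi => by rw [hwf i (hIA hi), (hK.2.1 w0 hw0).2 i (hIA hi)]]
    exact hw0
  | succ m ih =>
    intro A f K hA hm hK hK0 w hw hwf hKw
    obtain ⟨w0, hw0⟩ := Function.ne_iff.1 hK0
    obtain ⟨hfl0, hwf0⟩ := hK.2.1 w0 hw0
    obtain ⟨i, hi⟩ : (Finset.Icc 1 n \ A).Nonempty := Finset.card_pos.1 (by omega)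
    obtain ⟨hiI, hiA⟩ := Finset.mem_sdiff.1 hi
    have hIn : ∀ k, k ∈ Finset.Icc 1 n \ A → ∀ v, IsFlag ρ (Finset.Icc 1 n) v →
        (∀ i ∈ A, v i = f i) → (∃ u, u k = v k ∧ K u ≠ 0) → K v ≠ 0 := by
      rintro k hk v hv hvf ⟨u, huk, hu⟩
      obtain ⟨hkI, hkA⟩ := Finset.mem_sdiff.1 hk
      have h1 := restrict_mem_cyc hK hkI hkA (v k)
      rw [← sdiff_insert_eq_erase] at h1
      have h2 := ih (insert k A) (Function.update f k (v k)) _ (Finset.insert_subset hkI hA)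
        (by rw [sdiff_insert_eq_erase, Finset.card_erase_of_mem hk, hm]; rfl) h1
        (Function.ne_iff.2 ⟨u, by simpa [huk] using hu⟩) v hv (by
          intro l hl
          rcases Finset.mem_insert.1 hl with rfl | hl
          · rw [Function.update_self]
          · rw [Function.update_of_ne (ne_of_mem_of_not_mem hl hkA), hvf l hl])
      simpa using h2
    have hiAI : insert i A ⊆ Finset.Icc 1 n := Finset.insert_subset hiI hA
    have hD := pointDiff_mem_cyc hiA (hw.mono hiAI) (hfl0.mono hiAI) hwf hwf0
    have hne : w i ≠ w0 i := fun h => hIn i hi w hw hwf ⟨w0, h.symm, hw0⟩ hKw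
    by_cases hIA : Finset.Icc 1 n ⊆ insert i A
    · have hIA' : insert i A = Finset.Icc 1 n := Finset.Subset.antisymm hiAI hIA
      rw [hIA'] at hD
      have := fCyc_mul_comm H hA hK hD w0 w
      rw [if_pos hwf, if_pos rfl, if_neg hne, hKw, zero_mul, sub_zero, mul_one] at this
      exact hw0 this
    · obtain ⟨j, hjI, hj⟩ := Finset.not_subset.1 hIA
      have hjA : j ∉ A := fun h => hj (Finset.mem_insert_of_mem h)
      have hji : j ≠ i := fun h => hj (h ▸ Finset.mem_insert_self _ _)
      obtain ⟨E, hE, hEs⟩ := exists_lift H hiAI (Finset.subset_insert _ _) hjI hj hD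
      have hX : ∀ v, E v ≠ 0 → ((∃ u, u i = v i ∧ K u ≠ 0) ↔ ∃ u, u j = v j ∧ K u ≠ 0) := by
        intro v hv
        obtain ⟨hvfl, hvf⟩ := hE.2.1 v hv
        obtain ⟨v', hv', hvv⟩ := exists_full_flag H (Finset.insert_subset hjI hiAI) hvfl
        have hv'f : ∀ k ∈ A, v' k = f k := fun k hk => by
          rw [hvv k (Finset.mem_insert_of_mem (Finset.mem_insert_of_mem hk)), hvf k hk]
        have h1 := hvv i (Finset.mem_insert_of_mem (Finset.mem_insert_self _ _))
        have h2 := hvv j (Finset.mem_insert_self _ _)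
        rw [← h1, ← h2]
        exact ⟨fun h => ⟨v', rfl, hIn i hi v' hv' hv'f h⟩,
          fun h => ⟨v', rfl, hIn j (Finset.mem_sdiff.2 ⟨hjI, hjA⟩) v' hv' hv'f h⟩⟩
      have e1 : ∑ x, ∑ z, (if ∃ u, u i = x ∧ K u ≠ 0 then
          E (Function.update (Function.update f i x) j z) else 0) = -1 := by
        have : ∀ x, (∑ z, if ∃ u, u i = x ∧ K u ≠ 0 then
            E (Function.update (Function.update f i x) j z) else 0)
            = if x = w0 i then -1 else 0 := by
          intro x
          have hfx : ∀ k ∈ A, Function.update f i x k = f k := fun k hk =>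
            Function.update_of_ne (ne_of_mem_of_not_mem hk hiA) _ _
          by_cases hx : ∃ u, u i = x ∧ K u ≠ 0
          · have hxw : x ≠ w i := by
              rintro rfl
              exact hIn i hi w hw hwf hx hKw
            simp only [hx, if_true, hEs, Function.update_self]
            rw [if_pos hfx, if_neg hxw]
            split_ifs <;> simp
          · simp only [hx, if_false]
            rw [if_neg]
            · simp
            · rintro rfl
              exact hx ⟨w0, rfl, hw0⟩
        simp [this]
      have e2 : ∑ x, ∑ z, (if ∃ u, u i = x ∧ K u ≠ 0 then
          E (Function.update (Function.update f i x) j z) else 0) = 0 := by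
        rw [Finset.sum_comm]
        refine Finset.sum_eq_zero fun z _ => ?_
        have h1 : ∀ x, (if ∃ u, u i = x ∧ K u ≠ 0 then
            E (Function.update (Function.update f i x) j z) else 0)
            = if ∃ u, u j = z ∧ K u ≠ 0 then E (Function.update (Function.update f j z) i x)
              else 0 := by
          intro x
          rw [Function.update_comm hji.symm]
          by_cases h0 : E (Function.update (Function.update f j z) i x) = 0
          · simp [h0]
          · have := hX _ h0
            rw [Function.update_self, Function.update_of_ne hji, Function.update_self] at this
            simp only [this]
        simp only [h1]
        split_ifs
        · exact hE.2.2 i (Finset.mem_sdiff.2 ⟨Finset.mem_insert_self _ _, hiA⟩) _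
        · simp
      rw [e1] at e2
      norm_num at e2

end FullSupport

section Splitting

set_option linter.unusedSectionVars false

variable {P : Type*} [Fintype P] [PartialOrder P] [OrderBot P] {n : ℕ} {ρ : P → ℕ}

/-- Follow `a` up to index `j`, then `b`. -/
def comb (j : ℕ) (a b : ℕ → P) : ℕ → P := fun k => if k ≤ j then a k else b k

lemma comb_of_le {j k : ℕ} (h : k ≤ j) (a b : ℕ → P) : comb j a b k = a k := if_pos h

lemma comb_of_lt {j k : ℕ} (h : j < k) (a b : ℕ → P) : comb j a b k = b k := if_neg h.not_ge

lemma IsFlag.comb {a b : ℕ → P} (ha : IsFlag ρ (Finset.Icc 1 n) a)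
    (hb : IsFlag ρ (Finset.Icc 1 n) b) {j : ℕ} (h : a j < b (j + 1)) :
    IsFlag ρ (Finset.Icc 1 n) (comb j a b) := by
  refine ⟨fun i hi => ?_, fun i hi k hk hik => ?_⟩
  · by_cases hij : i ≤ j
    · rw [comb_of_le hij, ha.1 i hi]
    · rw [comb_of_lt (not_le.1 hij), hb.1 i hi]
  · by_cases hkj : k ≤ j
    · rw [comb_of_le hkj, comb_of_le (by omega)]
      exact ha.2 i hi k hk hik
    · rw [comb_of_lt (not_le.1 hkj)]
      by_cases hij : i ≤ j
      · rw [comb_of_le hij]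
        rw [Finset.mem_Icc] at hi hk
        have h1 : a i ≤ a j := by
          rcases hij.eq_or_lt with rfl | h'
          · exact le_rfl
          · exact (ha.2 i (by simp; omega) j (by simp; omega) h').le
        have h2 : b (j + 1) ≤ b k := by
          rcases (show j + 1 ≤ k by omega).eq_or_lt with rfl | h'
          · exact le_rfl
          · exact (hb.2 (j + 1) (by simp; omega) k (by simp; omega) h').le
        exact h1.trans_lt (h.trans_le h2)
      · rw [comb_of_lt (not_le.1 hij)]
        exact hb.2 i hi k hk hik

lemma comb_mul_comm (H : GorRank n ρ) {f : ℕ → P} {O : (ℕ → P) → ℝ} (hO : O ∈ FCyc ρ n ∅ f)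
    {j : ℕ} (hj : j ≤ n) {a b : ℕ → P} (hb : IsFlag ρ (Finset.Icc 1 n) b) (hab : a j = b j)
    (G G' : ℕ → P) :
    O (comb j a G) * O (comb j b G') = O (comb j b G) * O (comb j a G') := by
  by_cases hj0 : j = 0
  · have h : ∀ G, O (comb j a G) = O (comb j b G) := fun G => hO.1 _ _ fun i hi => by
      rw [Finset.mem_Icc] at hi
      rw [comb_of_lt (by omega), comb_of_lt (by omega)]
    rw [h, h]
  have hIj : Finset.Icc j n ⊆ Finset.Icc 1 n := Finset.Icc_subset_Icc_left (by omega)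
  have key : ∀ G, (fun v : ℕ → P => if ∀ k ∈ Finset.Icc j n, v k = b k then O (comb j v G) else 0)
      ∈ FCyc ρ n (Finset.Icc j n) b := by
    intro G
    refine ⟨fun v v' h => ?_, fun v hv => ?_, fun i hi v => ?_⟩
    · have h1 : (∀ k ∈ Finset.Icc j n, v k = b k) ↔ ∀ k ∈ Finset.Icc j n, v' k = b k :=
        forall₂_congr fun k hk => by rw [h k (hIj hk)]
      have h2 : O (comb j v G) = O (comb j v' G) := hO.1 _ _ fun i hi => by
        simp only [comb, h i hi]
      simp only [h1, h2]
    · by_cases hvb : ∀ k ∈ Finset.Icc j n, v k = b k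
      swap
      · exact absurd (if_neg hvb) hv
      replace hv : O (comb j v G) ≠ 0 := fun h => hv ((if_pos hvb).trans h)
      refine ⟨?_, hvb⟩
      have h1 := (hO.2.1 _ hv).1
      have hv' : ∀ k ∈ Finset.Icc 1 n, comb j (comb j v G) b k = v k := by
        intro k hk
        by_cases hkj : k ≤ j
        · rw [comb_of_le hkj, comb_of_le hkj]
        · rw [comb_of_lt (not_le.1 hkj)]
          rw [Finset.mem_Icc] at hk
          exact (hvb k (by rw [Finset.mem_Icc]; omega)).symm
      by_cases hjn : j = n
      · refine h1.congr fun k hk => ?_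
        rw [comb_of_le (by rw [Finset.mem_Icc] at hk; omega)]
      · refine (h1.comb hb ?_).congr hv'
        rw [comb_of_le le_rfl, hvb j (by rw [Finset.mem_Icc]; omega)]
        exact hb.2 j (by rw [Finset.mem_Icc]; omega) (j + 1) (by rw [Finset.mem_Icc]; omega)
          (by omega)
    · obtain ⟨hi1, hi2⟩ := Finset.mem_sdiff.1 hi
      have hij : i < j := by
        rw [Finset.mem_Icc] at hi1 hi2
        omega
      have h1 : ∀ x, (∀ k ∈ Finset.Icc j n, Function.update v i x k = b k) ↔
          ∀ k ∈ Finset.Icc j n, v k = b k := fun x => forall₂_congr fun k hk => by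
        rw [Function.update_of_ne (ne_of_mem_of_not_mem hk hi2)]
      have h2 : ∀ x, comb j (Function.update v i x) G = Function.update (comb j v G) i x := by
        intro x
        funext k
        by_cases hk : k = i
        · subst hk; simp [comb, hij.le]
        · simp [comb, hk]
      simp only [h1, h2]
      split_ifs
      · exact hO.2.2 i (by simpa using hi1) _
      · simp
  have h := fCyc_mul_comm H hIj (key G) (key G') (comb j a b) b
  have h3 : ∀ k ∈ Finset.Icc j n, comb j a b k = b k := by
    intro k hk
    rw [Finset.mem_Icc] at hk
    rcases hk.1.eq_or_lt with rfl | h'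
    · rw [comb_of_le le_rfl, hab]
    · rw [comb_of_lt h']
  have h4 : ∀ G, comb j (comb j a b) G = comb j a G := by
    intro G
    funext k
    simp only [comb]
    split_ifs <;> rfl
  have h5 : ∀ k ∈ Finset.Icc j n, b k = b k := fun _ _ => rfl
  rw [if_pos h3, if_pos h3, if_pos h5, if_pos h5, h4, h4] at h
  exact h

lemma eq_bot_of_rank_eq_zero (H : GorRank n ρ) {x : P} (hx : ρ x = 0) : x = ⊥ := by
  by_contra h
  have := H.mono (bot_lt_iff_ne_bot.2 h)
  omega

/-- Every element lies on a full flag. -/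
lemma exists_flag_through (H : GorRank n ρ) (z : P) :
    ∃ w, IsFlag ρ (Finset.Icc 1 n) w ∧ w 0 = ⊥ ∧ w (ρ z) = z := by
  have key : ∃ w, IsFlag ρ (Finset.Icc 1 n) w ∧ (ρ z ≠ 0 → w (ρ z) = z) := by
    by_cases hz : ρ z = 0
    · obtain ⟨w, h1, _⟩ := exists_full_flag H (A := ∅) (f := fun _ => ⊥) (Finset.empty_subset _)
        ⟨by simp, by simp⟩
      exact ⟨w, h1, fun h => absurd hz h⟩
    · have := H.le z
      obtain ⟨w, h1, h2⟩ := exists_full_flag H (A := {ρ z}) (f := fun _ => z)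
        (by simp; omega) ⟨by simp, by simp⟩
      exact ⟨w, h1, fun _ => h2 _ (by simp)⟩
  obtain ⟨w, h1, h2⟩ := key
  refine ⟨Function.update w 0 ⊥, h1.congr fun i hi => ?_, Function.update_self _ _ _, ?_⟩
  · rw [Finset.mem_Icc] at hi
    rw [Function.update_of_ne (by omega)]
  · by_cases hz : ρ z = 0
    · rw [hz, Function.update_self, eq_bot_of_rank_eq_zero H hz]
    · rw [Function.update_of_ne hz, h2 hz]

/-- The fundamental cycle of a Gorenstein poset is multiplicative. -/
lemma exists_multiplicative_cycle (H : GorRank n ρ) :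
    ∃ (ε : P → P → ℝ) (O : (ℕ → P) → ℝ), O ∈ FCyc ρ n ∅ (fun _ => ⊥) ∧
      (∀ w, O w ≠ 0 ↔ IsFlag ρ (Finset.Icc 1 n) w) ∧ (∀ w, w 0 = ⊥ → oo ε n w = O w) ∧
      ∀ y z, ∑ x, ε y x * ε x z = 0 := by
  choose M hM hM0 hMz using exists_flag_through H
  obtain ⟨O, hO, hO0, _⟩ := exists_top_generator H (A := ∅) (f := fun _ => ⊥)
    (Finset.empty_subset _) ⟨by simp, by simp⟩
  have hne : ∀ w, O w ≠ 0 ↔ IsFlag ρ (Finset.Icc 1 n) w := fun w =>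
    ⟨fun h => (hO.2.1 w h).1, fun h =>
      fCyc_ne_zero H _ ∅ _ O (Finset.empty_subset _) rfl hO hO0 w h (by simp)⟩
  set ε : P → P → ℝ := fun y z =>
    if y < z ∧ ρ z = ρ y + 1 then O (comb (ρ y) (M y) (M z)) / O (M y) else 0 with hε
  have hεne : ∀ y z, ε y z ≠ 0 ↔ y < z ∧ ρ z = ρ y + 1 := by
    intro y z
    constructor
    · intro h
      by_contra h'
      exact h (if_neg h')
    · intro h
      rw [hε]
      simp only [h, and_self, if_true]
      refine div_ne_zero ((hne _).2 ((hM y).comb (hM z) ?_)) ((hne _).2 (hM y))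
      rw [hMz, ← h.2, hMz]
      exact h.1
  have hflag : ∀ w : ℕ → P, w 0 = ⊥ → IsFlag ρ (Finset.Icc 1 n) w →
      ∀ k < n, ρ (w k) = k ∧ w k < w (k + 1) ∧ ρ (w (k + 1)) = ρ (w k) + 1 := by
    intro w hw0 hw k hk
    have h1 := hw.1 (k + 1) (by rw [Finset.mem_Icc]; omega)
    by_cases hk0 : k = 0
    · subst hk0
      have h2 : ρ (w 0) = 0 := by rw [hw0, H.bot]
      refine ⟨h2, ?_, by omega⟩
      rw [hw0, bot_lt_iff_ne_bot]
      intro h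
      rw [h, H.bot] at h1
      omega
    · have h2 := hw.1 k (by rw [Finset.mem_Icc]; omega)
      exact ⟨h2, hw.2 k (by rw [Finset.mem_Icc]; omega) _ (by rw [Finset.mem_Icc]; omega)
        (by omega), by omega⟩
  have hprod : ∀ w : ℕ → P, w 0 = ⊥ → IsFlag ρ (Finset.Icc 1 n) w → ∀ m ≤ n,
      O (comb m w (M (w m))) = O (M ⊥) * oo ε m w := by
    intro w hw0 hw m
    induction m with
    | zero =>
      intro _
      rw [oo, Finset.prod_range_zero, mul_one, hw0]
      refine hO.1 _ _ fun i hi => ?_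
      rw [Finset.mem_Icc] at hi
      rw [comb_of_lt (by omega)]
    | succ m ih =>
      intro hm
      obtain ⟨h1, h2, h3⟩ := hflag w hw0 hw m (by omega)
      have hMm : M (w m) m = w m := by
        have := hMz (w m)
        rwa [h1] at this
      have hMm1 : M (w (m + 1)) (m + 1) = w (m + 1) := by
        have := hMz (w (m + 1))
        rwa [h3, h1] at this
      have e1 : comb (m + 1) w (M (w (m + 1))) = comb m w (M (w (m + 1))) := by
        funext k
        rcases Nat.lt_trichotomy k (m + 1) with h | rfl | h
        · rw [comb_of_le h.le, comb_of_le (by omega)]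
        · rw [comb_of_le le_rfl, comb_of_lt (by omega), hMm1]
        · rw [comb_of_lt h, comb_of_lt (by omega)]
      have e2 : comb m (M (w m)) (M (w m)) = M (w m) := by
        funext k
        simp [comb]
      have e3 := comb_mul_comm H hO (by omega : m ≤ n) (hM (w m)) hMm.symm
        (M (w (m + 1))) (M (w m))
      have e4 : ε (w m) (w (m + 1)) = O (comb m (M (w m)) (M (w (m + 1)))) / O (M (w m)) := by
        rw [hε]
        simp only [h2, h3, and_self, if_true]
        rw [h1]
      rw [e2, ih (by omega)] at e3
      rw [oo_succ, e1, e4, ← mul_assoc, mul_div_assoc', eq_div_iff ((hne _).2 (hM _)), e3]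
      ring
  have hOM : O (M ⊥) ≠ 0 := (hne _).2 (hM _)
  have hoo : ∀ w : ℕ → P, w 0 = ⊥ → oo ε n w = (O (M ⊥))⁻¹ * O w := by
    intro w hw0
    by_cases hw : IsFlag ρ (Finset.Icc 1 n) w
    · have h1 := hprod w hw0 hw n le_rfl
      have h2 : O (comb n w (M (w n))) = O w := hO.1 _ _ fun i hi =>
        comb_of_le (Finset.mem_Icc.1 hi).2 _ _
      rw [← h2, h1, inv_mul_cancel_left₀ hOM]
    · have h1 : O w = 0 := by
        by_contra h
        exact hw ((hne w).1 h)
      rw [h1, mul_zero]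
      by_contra h
      apply hw
      have h2 : ∀ k < n, w k < w (k + 1) ∧ ρ (w (k + 1)) = ρ (w k) + 1 := fun k hk =>
        (hεne _ _).1 (Finset.prod_ne_zero_iff.1 h k (Finset.mem_range.2 hk))
      have h3 : ∀ k ≤ n, ρ (w k) = k := by
        intro k
        induction k with
        | zero => intro _; rw [hw0, H.bot]
        | succ k ih =>
          intro hk
          rw [(h2 k (by omega)).2, ih (by omega)]
      have h4 : ∀ i k, i < k → k ≤ n → w i < w k := by
        intro i k hik
        induction k, hik using Nat.le_induction with
        | base => intro hk; exact (h2 i (by omega)).1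
        | succ k hk ih => intro hkn; exact (ih (by omega)).trans (h2 k (by omega)).1
      exact ⟨fun i hi => h3 i (Finset.mem_Icc.1 hi).2,
        fun i _ k hk hik => h4 i k hik (Finset.mem_Icc.1 hk).2⟩
  refine ⟨ε, (O (M ⊥))⁻¹ • O, Submodule.smul_mem _ _ hO, fun w => ?_, fun w hw => hoo w hw, ?_⟩
  · rw [← hne w, Pi.smul_apply, smul_eq_mul]
    simp [hOM]
  intro y z
  by_contra hyz
  obtain ⟨x0, _, hx0⟩ := Finset.exists_ne_zero_of_sum_ne_zero hyz
  obtain ⟨h1, h1'⟩ := (hεne _ _).1 (left_ne_zero_of_mul hx0)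
  obtain ⟨h2, h2'⟩ := (hεne _ _).1 (right_ne_zero_of_mul hx0)
  set r := ρ y with hr
  have hrn : r + 2 ≤ n := by have := H.le z; omega
  set a := comb r (M y) (M x0) with ha
  have hafl : IsFlag ρ (Finset.Icc 1 n) a := (hM y).comb (hM x0) (by
    rw [hMz, ← h1', hMz]; exact h1)
  have hax : a (r + 1) = x0 := by
    rw [ha, comb_of_lt (by omega), ← h1', hMz]
  set W := comb (r + 1) a (M z) with hW
  have hWz : W (r + 2) = z := by
    rw [hW, comb_of_lt (by omega)]
    have := hMz z
    rwa [h2', h1'] at this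
  have hWfl : IsFlag ρ (Finset.Icc 1 n) W := hafl.comb (hM z) (by
    rw [hax]
    have := hMz z
    rw [h2', h1'] at this
    rw [this]
    exact h2)
  have hWx : W (r + 1) = x0 := by rw [hW, comb_of_le le_rfl, hax]
  have hWy : W r = y := by
    rw [hW, comb_of_le (by omega), ha, comb_of_le le_rfl, hMz]
  have hW0 : W 0 = ⊥ := by
    rw [hW, comb_of_le (by omega), ha, comb_of_le (by omega), hM0]
  have hr1 : r + 1 ∈ Finset.range n := Finset.mem_range.2 (by omega)
  have hr0 : r ∈ (Finset.range n).erase (r + 1) :=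
    Finset.mem_erase.2 ⟨by omega, Finset.mem_range.2 (by omega)⟩
  have hfac : ∀ x, oo ε n (Function.update W (r + 1) x)
      = (∏ k ∈ ((Finset.range n).erase (r + 1)).erase r, ε (W k) (W (k + 1))) *
        (ε y x * ε x z) := by
    intro x
    rw [oo, ← Finset.mul_prod_erase _ _ hr1, ← Finset.mul_prod_erase _ _ hr0]
    rw [Function.update_self, Function.update_of_ne (by omega), Function.update_of_ne (by omega),
      hWy, show r + 1 + 1 = r + 2 from rfl, hWz]
    rw [Finset.prod_congr (s₂ := ((Finset.range n).erase (r + 1)).erase r)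
      (g := fun k => ε (W k) (W (k + 1))) rfl]
    · ring
    · intro k hk
      simp only [Finset.mem_erase, Finset.mem_range] at hk
      rw [Function.update_of_ne (by omega), Function.update_of_ne (by omega)]
  have hsum : ∑ x, oo ε n (Function.update W (r + 1) x) = 0 := by
    have h3 : ∀ x, oo ε n (Function.update W (r + 1) x)
        = (O (M ⊥))⁻¹ * O (Function.update W (r + 1) x) := fun x =>
      hoo _ (by rw [Function.update_of_ne (by omega), hW0])
    simp only [h3]
    rw [← Finset.mul_sum, hO.2.2 (r + 1) (by simp; omega), mul_zero]
  have hWne : oo ε n W ≠ 0 := by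
    rw [hoo W hW0]
    exact mul_ne_zero (inv_ne_zero hOM) ((hne W).2 hWfl)
  have h4 := hfac x0
  rw [← hWx, Function.update_eq_self] at h4
  rw [h4] at hWne
  simp only [hfac] at hsum
  rw [← Finset.mul_sum] at hsum
  exact (mul_ne_zero (left_ne_zero_of_mul hWne) hyz) hsum

end Splitting

section Dimensions

open Module

set_option linter.unusedSectionVars false

universe u

variable {P : Type u} [Fintype P] [PartialOrder P] [OrderBot P] {n : ℕ} {ρ : P → ℕ}

lemma finite_cyc {U : Finset ℕ} (hU : U ⊆ Finset.Icc 1 n) (A J : Finset ℕ) (f : ℕ → P) :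
    FiniteDimensional ℝ (Cyc ρ U A J f) := by
  let T : ↥(Cyc ρ U A J f) →ₗ[ℝ] ((Fin (n + 1) → P) → ℝ) :=
    { toFun := fun K g => K.1 (ext0 ⊥ g)
      map_add' := fun _ _ => rfl
      map_smul' := fun _ _ => rfl }
  refine FiniteDimensional.of_injective T fun K L h => Subtype.ext (funext fun w => ?_)
  have h1 := congrFun h (trunc n w)
  have h2 : ∀ i ∈ U, w i = ext0 ⊥ (trunc n w) i := fun i hi =>
    (ext0_trunc ⊥ w (Finset.mem_Icc.1 (hU hi)).2).symm
  rw [K.2.1 _ _ h2, L.2.1 _ _ h2]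
  exact h1

/-- The dimension of the space of cycles. -/
noncomputable def cycDim (ρ : P → ℕ) (U A : Finset ℕ) (f : ℕ → P) : ℕ :=
  finrank ℝ (Cyc ρ U A (U \ A) f)

/-- The exact sequence computing cycles in a new direction. -/
lemma sum_cycDim (H : GorRank n ρ) {U A : Finset ℕ} (hU : U ⊆ Finset.Icc 1 n) (hA : A ⊆ U)
    {i : ℕ} (hi : i ∈ Finset.Icc 1 n) (hiU : i ∉ U) (f : ℕ → P) :
    ∑ x, cycDim ρ (insert i U) (insert i A) (Function.update f i x)
      = cycDim ρ (insert i U) A f + cycDim ρ U A f := by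
  have hiA : i ∉ A := fun h => hiU (hA h)
  have hU' : insert i U ⊆ Finset.Icc 1 n := Finset.insert_subset hi hU
  have hJ : insert i U \ insert i A = U \ A := by
    ext k
    simp only [Finset.mem_sdiff, Finset.mem_insert]
    constructor
    · tauto
    · rintro ⟨h1, h2⟩
      refine ⟨Or.inr h1, ?_⟩
      rintro (rfl | h)
      · exact hiU h1
      · exact h2 h
  have hJ' : (insert i U \ A).erase i = U \ A := by
    rw [← sdiff_insert_eq_erase, hJ]
  let C : P → Submodule ℝ ((ℕ → P) → ℝ) := fun x =>
    Cyc ρ (insert i U) (insert i A) (U \ A) (Function.update f i x)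
  have hfin : ∀ x, FiniteDimensional ℝ (C x) := fun x => finite_cyc hU' _ _ _
  let L : ((x : P) → C x) →ₗ[ℝ] ((ℕ → P) → ℝ) :=
    { toFun := fun K w => ∑ x, (K x).1 (Function.update w i x)
      map_add' := fun K K' => by
        funext w
        simp [Finset.sum_add_distrib]
      map_smul' := fun t K => by
        funext w
        simp [Finset.mul_sum] }
  let S : ((x : P) → C x) →ₗ[ℝ] ((ℕ → P) → ℝ) :=
    { toFun := fun K w => ∑ x, (K x).1 w
      map_add' := fun K K' => by
        funext w
        simp [Finset.sum_add_distrib]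
      map_smul' := fun t K => by
        funext w
        simp [Finset.mul_sum] }
  have hsupp : ∀ (K : (x : P) → C x) x w, (K x).1 w ≠ 0 → w i = x := by
    intro K x w h
    have := ((K x).2.2.1 w h).2 i (Finset.mem_insert_self _ _)
    rwa [Function.update_self] at this
  have hsum : ∀ (K : (x : P) → C x) w, S K w = (K (w i)).1 w := by
    intro K w
    refine Finset.sum_eq_single (w i) (fun x _ hx => ?_) (by simp)
    by_contra h
    exact hx (hsupp K x w h).symm
  have hLS : ∀ K w, ∑ z, S K (Function.update w i z) = L K w := by
    intro K w
    refine Finset.sum_congr rfl fun z _ => ?_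
    rw [hsum, Function.update_self]
  have hSinj : Function.Injective S := by
    intro K K' h
    funext x
    refine Subtype.ext (funext fun w => ?_)
    have h1 := congrFun h w
    rw [hsum, hsum] at h1
    by_cases hx : w i = x
    · rwa [hx] at h1
    · have h2 : ∀ K : (x : P) → C x, (K x).1 w = 0 := fun K => by
        by_contra h
        exact hx (hsupp K x w h)
      rw [h2, h2]
  have hlift : ∀ E, E ∈ Cyc ρ (insert i U) A (U \ A) f →
      ∃ K : (x : P) → C x, S K = E ∧ ∀ w, L K w = ∑ x, E (Function.update w i x) := by
    intro E hE
    have h1 : ∀ x, (fun w => if w i = x then E w else 0) ∈ C x := fun x => by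
      have := restrict_mem_cyc hE (Finset.mem_insert_self i U) hiA x
      rwa [Finset.erase_eq_of_notMem (fun h => hiU (Finset.mem_sdiff.1 h).1)] at this
    let K : (x : P) → C x := fun x => ⟨_, h1 x⟩
    have h2 : S K = E := by
      funext w
      rw [hsum]
      exact if_pos rfl
    exact ⟨K, h2, fun w => by rw [← hLS, h2]⟩
  have hrange : LinearMap.range L = Cyc ρ U A (U \ A) f := by
    ext K
    constructor
    · rintro ⟨G, rfl⟩
      refine ⟨fun w w' h => ?_, fun w hw => ?_, fun j hj w => ?_⟩
      · refine Finset.sum_congr rfl fun x _ => (G x).2.1 _ _ fun k hk => ?_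
        by_cases hki : k = i
        · rw [hki, Function.update_self, Function.update_self]
        · rw [Function.update_of_ne hki, Function.update_of_ne hki,
            h k ((Finset.mem_insert.1 hk).resolve_left hki)]
      · obtain ⟨x, _, hx⟩ := Finset.exists_ne_zero_of_sum_ne_zero hw
        obtain ⟨h1, h2⟩ := (G x).2.2.1 _ hx
        refine ⟨?_, fun k hk => ?_⟩
        · have := h1.erase_of_update
          rwa [Finset.erase_insert hiU] at this
        · have := h2 k (Finset.mem_insert_of_mem hk)
          rwa [Function.update_of_ne (ne_of_mem_of_not_mem hk hiA),
            Function.update_of_ne (ne_of_mem_of_not_mem hk hiA)] at this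
      · have hji : j ≠ i := ne_of_mem_of_not_mem (Finset.mem_sdiff.1 hj).1 hiU
        change ∑ z, ∑ x, (G x).1 (Function.update (Function.update w j z) i x) = 0
        rw [Finset.sum_comm]
        refine Finset.sum_eq_zero fun x _ => ?_
        simp only [Function.update_comm hji]
        exact (G x).2.2.2 j hj _
    · intro hK
      obtain ⟨E, hE, hEK⟩ := exists_lift H hU hA hi hiU hK
      obtain ⟨G, _, hG⟩ := hlift E hE
      exact ⟨G, funext fun w => by rw [hG, hEK]⟩
  have hker : (LinearMap.ker L).map S = Cyc ρ (insert i U) A (insert i U \ A) f := by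
    ext K
    constructor
    · rintro ⟨G, hG, rfl⟩
      refine ⟨fun w w' h => ?_, fun w hw => ?_, fun j hj w => ?_⟩
      · exact Finset.sum_congr rfl fun x _ => (G x).2.1 _ _ h
      · obtain ⟨x, _, hx⟩ := Finset.exists_ne_zero_of_sum_ne_zero hw
        obtain ⟨h1, h2⟩ := (G x).2.2.1 _ hx
        refine ⟨h1, fun k hk => ?_⟩
        have := h2 k (Finset.mem_insert_of_mem hk)
        rwa [Function.update_of_ne (ne_of_mem_of_not_mem hk hiA)] at this
      · by_cases hji : j = i
        · rw [hji, hLS, show L G = 0 from hG]; rfl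
        · change ∑ z, ∑ x, (G x).1 (Function.update w j z) = 0
          rw [Finset.sum_comm]
          refine Finset.sum_eq_zero fun x _ => (G x).2.2.2 j ?_ _
          rw [← hJ', Finset.mem_erase]
          exact ⟨hji, hj⟩
    · intro hK
      have hK' : K ∈ Cyc ρ (insert i U) A (U \ A) f :=
        ⟨hK.1, hK.2.1, fun j hj => hK.2.2 j
          (Finset.sdiff_subset_sdiff (Finset.subset_insert _ _) subset_rfl hj)⟩
      obtain ⟨G, hG, hG'⟩ := hlift K hK'
      refine ⟨G, ?_, hG⟩
      rw [SetLike.mem_coe, LinearMap.mem_ker]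
      funext w
      rw [hG', hK.2.2 i (Finset.mem_sdiff.2 ⟨Finset.mem_insert_self _ _, hiA⟩)]
      rfl
  have h1 := LinearMap.finrank_range_add_finrank_ker L
  rw [Module.finrank_pi_fintype, hrange,
    (Submodule.equivMapOfInjective S hSinj (LinearMap.ker L)).finrank_eq, hker] at h1
  rw [cycDim, cycDim, add_comm, h1]
  refine Finset.sum_congr rfl fun x _ => ?_
  rw [cycDim, hJ]

variable {ε : P → P → ℝ} {O : (ℕ → P) → ℝ} {f0 : ℕ → P}

/-- The cycle obtained from `O` by fixing the coordinates in `A` and `S`. -/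
noncomputable def sliceFun (O : (ℕ → P) → ℝ) (A S : Finset ℕ) (f g : ℕ → P) (w : ℕ → P) : ℝ :=
  if ∀ i ∈ A, w i = f i then O (mg ⊥ A S f g w) else 0

lemma sliceFun_congr (hO : O ∈ FCyc ρ n ∅ f0) {A S : Finset ℕ} {f g g' : ℕ → P}
    (h : ∀ i ∈ Finset.Icc 1 n, g i = g' i) : sliceFun O A S f g = sliceFun O A S f g' := by
  funext w
  rw [sliceFun, sliceFun]
  have : O (mg ⊥ A S f g w) = O (mg ⊥ A S f g' w) := hO.1 _ _ fun i hi => by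
    simp only [mg, h i hi]
  rw [this]

lemma sliceFun_mem_cyc (hO : O ∈ FCyc ρ n ∅ f0) {A S : Finset ℕ} (hA : A ⊆ Finset.Icc 1 n)
    (f g : ℕ → P) : sliceFun O A S f g ∈
      Cyc ρ (Finset.Icc 1 n \ (S \ A)) A ((Finset.Icc 1 n \ (S \ A)) \ A) f := by
  have hAU : A ⊆ Finset.Icc 1 n \ (S \ A) := fun i hi =>
    Finset.mem_sdiff.2 ⟨hA hi, fun h => (Finset.mem_sdiff.1 h).2 hi⟩
  have hmg : ∀ w : ℕ → P, (∀ i ∈ A, w i = f i) → ∀ i ∈ Finset.Icc 1 n \ (S \ A),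
      mg ⊥ A S f g w i = w i := by
    intro w hw i hi
    obtain ⟨h1, h2⟩ := Finset.mem_sdiff.1 hi
    rw [Finset.mem_Icc] at h1
    rw [Finset.mem_sdiff, not_and_not_right] at h2
    by_cases hiA : i ∈ A
    · simp [mg, hiA, hw i hiA, show i ≠ 0 by omega]
    · have : i ∉ S := fun h => hiA (h2 h)
      simp [mg, hiA, this, show i ≠ 0 by omega]
  refine ⟨fun w w' h => ?_, fun w hw => ?_, fun j hj w => ?_⟩
  · have h1 : (∀ i ∈ A, w i = f i) ↔ ∀ i ∈ A, w' i = f i :=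
      forall₂_congr fun i hi => by rw [h i (hAU hi)]
    have h2 : O (mg ⊥ A S f g w) = O (mg ⊥ A S f g w') := hO.1 _ _ fun i hi => by
      by_cases hiA : i ∈ A
      · simp [mg, hiA]
      by_cases hiS : i ∈ S
      · simp [mg, hiA, hiS]
      · simp only [mg, h i (Finset.mem_sdiff.2 ⟨hi, fun h => hiS (Finset.mem_sdiff.1 h).1⟩)]
    simp only [sliceFun, h1, h2]
  · by_cases hwA : ∀ i ∈ A, w i = f i
    swap
    · exact absurd (if_neg hwA) hw
    replace hw : O (mg ⊥ A S f g w) ≠ 0 := fun h => hw ((if_pos hwA).trans h)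
    exact ⟨((hO.2.1 _ hw).1.mono Finset.sdiff_subset).congr (hmg w hwA), hwA⟩
  · obtain ⟨h1, h2⟩ := Finset.mem_sdiff.1 hj
    obtain ⟨h3, h4⟩ := Finset.mem_sdiff.1 h1
    have hjS : j ∉ S := fun h => h4 (Finset.mem_sdiff.2 ⟨h, h2⟩)
    have hj0 : j ≠ 0 := by rw [Finset.mem_Icc] at h3; omega
    have h5 : ∀ x, (∀ i ∈ A, Function.update w j x i = f i) ↔ ∀ i ∈ A, w i = f i := fun x =>
      forall₂_congr fun i hi => by rw [Function.update_of_ne (ne_of_mem_of_not_mem hi h2)]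
    have h6 : ∀ x, mg ⊥ A S f g (Function.update w j x)
        = Function.update (mg ⊥ A S f g w) j x := by
      intro x
      funext k
      by_cases hk : k = j
      · subst hk
        simp [mg, h2, hjS, hj0]
      · simp [mg, hk]
    simp only [sliceFun, h5, h6]
    split_ifs
    · exact hO.2.2 j (by simpa using h3) _
    · simp

/-- The span of the slices of `O`. -/
noncomputable def sliceSpan (n : ℕ) (O : (ℕ → P) → ℝ) (A S : Finset ℕ) (f : ℕ → P) :
    Submodule ℝ ((ℕ → P) → ℝ) :=
  Submodule.span ℝ (Set.range fun g : Fin (n + 1) → P => sliceFun O A S f (ext0 ⊥ g))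

lemma sliceFun_mem_span (hO : O ∈ FCyc ρ n ∅ f0) (A S : Finset ℕ) (f g : ℕ → P) :
    sliceFun O A S f g ∈ sliceSpan n O A S f := by
  refine Submodule.subset_span ⟨trunc n g, sliceFun_congr hO fun i hi => ?_⟩
  rw [ext0_trunc ⊥ g (Finset.mem_Icc.1 hi).2]

/-- All cycles are combinations of slices of the fundamental cycle. -/
lemma cyc_le_sliceSpan (H : GorRank n ρ) (hO : O ∈ FCyc ρ n ∅ f0)
    (hne : ∀ w, O w ≠ 0 ↔ IsFlag ρ (Finset.Icc 1 n) w) (S : Finset ℕ) :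
    ∀ (A : Finset ℕ) (f : ℕ → P), S ⊆ Finset.Icc 1 n → A ⊆ Finset.Icc 1 n → Disjoint A S →
    Cyc ρ (Finset.Icc 1 n \ S) A ((Finset.Icc 1 n \ S) \ A) f ≤ sliceSpan n O A S f := by
  induction S using Finset.induction_on with
  | empty =>
    intro A f _ hA _ K hK
    rw [Finset.sdiff_empty] at hK
    by_cases hf : IsFlag ρ A f
    · obtain ⟨v, hv, hvf⟩ := exists_full_flag H hA hf
      have hL := sliceFun_mem_cyc hO (S := ∅) hA f f
      rw [Finset.empty_sdiff, Finset.sdiff_empty] at hL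
      have hLv : sliceFun O A ∅ f f v ≠ 0 := by
        rw [sliceFun, if_pos hvf]
        refine (hne _).2 (hv.congr fun i hi => ?_)
        rw [Finset.mem_Icc] at hi
        by_cases hiA : i ∈ A
        · simp [mg, hiA, hvf i hiA, show i ≠ 0 by omega]
        · simp [mg, hiA, show i ≠ 0 by omega]
      have : K = (K v / sliceFun O A ∅ f f v) • sliceFun O A ∅ f f := by
        funext w
        have := fCyc_mul_comm H hA hK hL w v
        rw [Pi.smul_apply, smul_eq_mul, div_mul_eq_mul_div, eq_div_iff hLv, this]
      rw [this]
      exact Submodule.smul_mem _ _ (sliceFun_mem_span hO _ _ _ _)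
    · have : K = 0 := by
        funext w
        by_contra h
        exact hf (Cyc.isFlag hK h hA)
      rw [this]
      exact Submodule.zero_mem _
  | insert i S hiS ih =>
    intro A f hS hA hAS K hK
    have hiI := hS (Finset.mem_insert_self i S)
    have hSI : S ⊆ Finset.Icc 1 n := (Finset.subset_insert i S).trans hS
    rw [Finset.disjoint_insert_right] at hAS
    obtain ⟨hiA, hAS⟩ := hAS
    have hAU : A ⊆ Finset.Icc 1 n \ insert i S := fun k hk => Finset.mem_sdiff.2 ⟨hA hk, by
      rw [Finset.mem_insert, not_or]
      exact ⟨ne_of_mem_of_not_mem hk hiA, Finset.disjoint_left.1 hAS hk⟩⟩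
    have hUi : insert i (Finset.Icc 1 n \ insert i S) = Finset.Icc 1 n \ S := by
      rw [sdiff_insert_eq_erase, Finset.insert_erase (Finset.mem_sdiff.2 ⟨hiI, hiS⟩)]
    obtain ⟨E, hE, hEK⟩ := exists_lift H Finset.sdiff_subset hAU hiI (by simp) hK
    have hiJ : (Finset.Icc 1 n \ insert i S) \ A = (Finset.Icc 1 n \ S) \ insert i A := by
      ext k
      simp only [Finset.mem_sdiff, Finset.mem_insert]
      tauto
    rw [hUi, hiJ] at hE
    let T : P → ((ℕ → P) → ℝ) →ₗ[ℝ] ((ℕ → P) → ℝ) := fun x =>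
      LinearMap.funLeft ℝ ℝ fun w : ℕ → P => Function.update w i x
    have hT : ∀ x F, F ∈ sliceSpan n O (insert i A) S (Function.update f i x) →
        T x F ∈ sliceSpan n O A (insert i S) f := by
      intro x F hF
      refine (Submodule.span_le.2 ?_ : _ ≤ (sliceSpan n O A (insert i S) f).comap (T x)) hF
      rintro _ ⟨g, rfl⟩
      have : T x (sliceFun O (insert i A) S (Function.update f i x) (ext0 ⊥ g))
          = sliceFun O A (insert i S) f (Function.update (ext0 ⊥ g) i x) := by
        funext w
        have h1 : (∀ k ∈ insert i A, Function.update w i x k = Function.update f i x k) ↔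
            ∀ k ∈ A, w k = f k := by
          rw [Finset.forall_mem_insert]
          simp only [Function.update_self, true_and]
          exact forall₂_congr fun k hk => by
            rw [Function.update_of_ne (ne_of_mem_of_not_mem hk hiA),
              Function.update_of_ne (ne_of_mem_of_not_mem hk hiA)]
        have h2 : mg ⊥ (insert i A) S (Function.update f i x) (ext0 ⊥ g) (Function.update w i x)
            = mg ⊥ A (insert i S) f (Function.update (ext0 ⊥ g) i x) w := by
          funext k
          by_cases hk : k = i
          · subst hk
            simp [mg, hiA]
          · simp [mg, hk]
        simp only [T, LinearMap.funLeft_apply, sliceFun, h1, h2]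
      rw [SetLike.mem_coe, Submodule.mem_comap, this]
      exact sliceFun_mem_span hO _ _ _ _
    have hK' : K = ∑ x, T x (fun w => if w i = x then E w else 0) := by
      funext w
      rw [← hEK, Finset.sum_apply]
      exact Finset.sum_congr rfl fun x _ => by simp [T, LinearMap.funLeft_apply]
    rw [hK']
    refine Submodule.sum_mem _ fun x _ => hT x _ (ih (insert i A) _ hSI
      (Finset.insert_subset hiI hA) (Finset.disjoint_insert_left.2 ⟨hiS, hAS⟩) ?_)
    have := restrict_mem_cyc hE (Finset.mem_sdiff.2 ⟨hiI, hiS⟩) hiA x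
    rwa [Finset.erase_eq_of_notMem (by simp)] at this

end Dimensions

section Exactness

set_option linter.unusedSectionVars false

universe u

open Module

variable {P : Type u} [Fintype P] [PartialOrder P] [OrderBot P] {n : ℕ} {ρ : P → ℕ}

/-- The constant one-dimensional form. -/
noncomputable def unitForm (_ : P) : (PUnit.{u + 1} → ℝ) →ₗ[ℝ] (PUnit.{u + 1} → ℝ) →ₗ[ℝ] ℝ :=
  (LinearMap.mul ℝ ℝ).compl₁₂ (LinearMap.proj PUnit.unit) (LinearMap.proj PUnit.unit)

lemma unitForm_apply (z : P) (v w : PUnit.{u + 1} → ℝ) :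
    unitForm z v w = v PUnit.unit * w PUnit.unit := rfl

lemma unitForm_flip (z : P) : (unitForm z).flip = unitForm z := by
  refine LinearMap.ext fun v => LinearMap.ext fun w => ?_
  rw [LinearMap.flip_apply, unitForm_apply, unitForm_apply, mul_comm]

variable {ε : P → P → ℝ} {O : (ℕ → P) → ℝ} {f0 : ℕ → P}

lemma sliceSpan_eq_cyc (H : GorRank n ρ) (hO : O ∈ FCyc ρ n ∅ f0)
    (hne : ∀ w, O w ≠ 0 ↔ IsFlag ρ (Finset.Icc 1 n) w) {A S : Finset ℕ}
    (hA : A ⊆ Finset.Icc 1 n) (hS : S ⊆ Finset.Icc 1 n) (f : ℕ → P) :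
    sliceSpan n O A S f
      = Cyc ρ (Finset.Icc 1 n \ (S \ A)) A ((Finset.Icc 1 n \ (S \ A)) \ A) f := by
  apply le_antisymm
  · refine Submodule.span_le.2 ?_
    rintro _ ⟨g, rfl⟩
    exact sliceFun_mem_cyc hO hA f _
  · have h : sliceSpan n O A (S \ A) f = sliceSpan n O A S f := by
      have : ∀ g : ℕ → P, sliceFun O A (S \ A) f g = sliceFun O A S f g := by
        intro g
        funext w
        have : mg ⊥ A (S \ A) f g w = mg ⊥ A S f g w := by
          funext k
          by_cases hk : k ∈ A <;> simp [mg, hk]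
        rw [sliceFun, sliceFun, this]
      simp only [sliceSpan, this]
    rw [← h]
    exact cyc_le_sliceSpan H hO hne _ A f (Finset.sdiff_subset.trans hS) hA
      Finset.disjoint_sdiff

/-- The ranks of the forms built from the fundamental cycle are dimensions of cycle spaces. -/
lemma seqRank_eq_cycDim (H : GorRank n ρ) (hO : O ∈ FCyc ρ n ∅ f0)
    (hne : ∀ w, O w ≠ 0 ↔ IsFlag ρ (Finset.Icc 1 n) w)
    (hεO : ∀ w : ℕ → P, w 0 = ⊥ → oo ε n w = O w) {A S : Finset ℕ}
    (hA : A ⊆ Finset.Icc 1 n) (hS : S ⊆ Finset.Icc 1 n) (f : ℕ → P) :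
    seqRank n ε ⊥ n unitForm A S f = cycDim ρ (Finset.Icc 1 n \ (S \ A)) A f := by
  rw [cycDim, ← sliceSpan_eq_cyc H hO hne hA hS]
  let F : (Fin (n + 1) → P) → (ℕ → P) → ℝ := fun g => sliceFun O A S f (ext0 ⊥ g)
  let c : ((Fin (n + 1) → P) → PUnit.{u + 1} → ℝ) →ₗ[ℝ] ((Fin (n + 1) → P) → ℝ) :=
    (LinearMap.proj PUnit.unit : (PUnit.{u + 1} → ℝ) →ₗ[ℝ] ℝ).compLeft _
  have hc : LinearMap.range c = ⊤ := LinearMap.range_eq_top.2 fun β =>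
    ⟨fun g _ => β g, rfl⟩
  have hr : LinearMap.range (Fintype.linearCombination ℝ F ∘ₗ c) = sliceSpan n O A S f := by
    rw [LinearMap.range_comp_of_range_eq_top _ hc, Fintype.range_linearCombination]
    rfl
  have hmg0 : ∀ g h : ℕ → P, mg ⊥ A S f g h 0 = ⊥ := fun g h => by simp [mg]
  have key : ∀ α, seqForm n ε ⊥ n unitForm A S f α = 0 ↔
      (Fintype.linearCombination ℝ F ∘ₗ c) α = 0 := by
    intro α
    rw [seqForm_eq_zero_iff]
    have h1 : ∀ h : Fin (n + 1) → P,
        (∑ g, wform ε n unitForm (mg ⊥ A S f (ext0 ⊥ g) (ext0 ⊥ h)) (α g) = 0 ↔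
          ∑ g, α g PUnit.unit * O (mg ⊥ A S f (ext0 ⊥ g) (ext0 ⊥ h)) = 0) := by
      intro h
      have e : ∀ v : PUnit.{u + 1} → ℝ,
          (∑ g, wform ε n unitForm (mg ⊥ A S f (ext0 ⊥ g) (ext0 ⊥ h)) (α g)) v
            = (∑ g, α g PUnit.unit * O (mg ⊥ A S f (ext0 ⊥ g) (ext0 ⊥ h))) * v PUnit.unit := by
        intro v
        rw [LinearMap.sum_apply, Finset.sum_mul]
        refine Finset.sum_congr rfl fun g _ => ?_
        rw [wform, hεO _ (hmg0 _ _), LinearMap.smul_apply, LinearMap.smul_apply, unitForm_apply,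
          smul_eq_mul]
        ring
      constructor
      · intro h0
        have := e fun _ => 1
        rwa [h0, LinearMap.zero_apply, mul_one, eq_comm] at this
      · intro h0
        refine LinearMap.ext fun v => ?_
        rw [e, h0, zero_mul, LinearMap.zero_apply]
    have h2 : ∀ w, (Fintype.linearCombination ℝ F ∘ₗ c) α w
        = ∑ g, α g PUnit.unit * sliceFun O A S f (ext0 ⊥ g) w := by
      intro w
      rw [LinearMap.comp_apply, Fintype.linearCombination_apply, Finset.sum_apply]
      rfl
    simp only [h1]
    constructor
    · intro h
      funext w
      rw [h2, Pi.zero_apply]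
      by_cases hw : ∀ i ∈ A, w i = f i
      · rw [← h (trunc n w)]
        refine Finset.sum_congr rfl fun g _ => ?_
        rw [sliceFun, if_pos hw]
        congr 1
        refine hO.1 _ _ fun i hi => ?_
        simp only [mg, ext0_trunc ⊥ w (Finset.mem_Icc.1 hi).2]
      · exact Finset.sum_eq_zero fun g _ => by rw [sliceFun, if_neg hw, mul_zero]
    · intro h h'
      have h3 := h2 (mg ⊥ A ∅ f (ext0 ⊥ h') (ext0 ⊥ h'))
      rw [h, Pi.zero_apply] at h3
      rw [h3]
      refine Finset.sum_congr rfl fun g _ => ?_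
      rw [sliceFun, if_pos fun i hi => ?_]
      · congr 2
        funext k
        simp only [mg]
        split_ifs <;> simp_all
      · have := Finset.mem_Icc.1 (hA hi)
        simp [mg, hi, show i ≠ 0 by omega]
  have hk : LinearMap.ker (seqForm n ε ⊥ n unitForm A S f)
      = LinearMap.ker (Fintype.linearCombination ℝ F ∘ₗ c) := by
    ext α
    exact key α
  have r1 := LinearMap.finrank_range_add_finrank_ker (seqForm n ε ⊥ n unitForm A S f)
  have r2 := LinearMap.finrank_range_add_finrank_ker (Fintype.linearCombination ℝ F ∘ₗ c)
  rw [hr, ← hk] at r2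
  rw [seqRank, bilinRank]
  omega

lemma rankExact_unitForm (H : GorRank n ρ) (hO : O ∈ FCyc ρ n ∅ f0)
    (hne : ∀ w, O w ≠ 0 ↔ IsFlag ρ (Finset.Icc 1 n) w)
    (hεO : ∀ w : ℕ → P, w 0 = ⊥ → oo ε n w = O w) : RankExact n ε ⊥ n unitForm := by
  intro i hi1 hin A hA S hS f hiA hiS
  have hi : i ∈ Finset.Icc 1 n := Finset.mem_Icc.2 ⟨hi1, by omega⟩
  have hU : insert i (Finset.Icc 1 n \ (insert i S \ A)) = Finset.Icc 1 n \ (S \ A) := by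
    ext k
    simp only [Finset.mem_insert, Finset.mem_sdiff]
    by_cases hk : k = i
    · subst hk; simp_all
    · simp [hk]
  have hS' : S \ insert i A = S \ A := by
    rw [sdiff_insert_eq_erase, Finset.erase_eq_of_notMem (by simp [hiS])]
  have h := sum_cycDim H (U := Finset.Icc 1 n \ (insert i S \ A)) Finset.sdiff_subset
    (A := A) (fun k hk => Finset.mem_sdiff.2 ⟨hA hk, by simp [hk]⟩) hi (by simp [hiA]) f
  rw [hU] at h
  rw [seqRank_eq_cycDim H hO hne hεO hA hS,
    seqRank_eq_cycDim H hO hne hεO hA (Finset.insert_subset hi hS), ← h]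
  refine Finset.sum_congr rfl fun x _ => ?_
  rw [seqRank_eq_cycDim H hO hne hεO (Finset.insert_subset hi hA) hS, hS']

end Exactness

section Counting

set_option linter.unusedSectionVars false

universe u

open Module

variable {P : Type u} [Fintype P] [PartialOrder P] [OrderBot P] {n : ℕ} {ρ : P → ℕ}

/-- The number of chains with rank set `U` through the elements `f i`, `i ∈ A`. -/
noncomputable def chainCount (ρ : P → ℕ) (U A : Finset ℕ) (f : ℕ → P) : ℕ :=
  (Finset.univ.filter fun y => HasType ρ U y ∧ ∀ i ∈ A, f i ∈ y ∧ ρ (f i) = i).card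

lemma chainCount_self (H : GorRank n ρ) (A : Finset ℕ) (f : ℕ → P) :
    chainCount ρ A A f = cycDim ρ A A f := by
  have key : ∀ y, (HasType ρ A y ∧ ∀ i ∈ A, f i ∈ y ∧ ρ (f i) = i) →
      IsFlag ρ A f ∧ y = fset A f := by
    rintro y ⟨ht, hy⟩
    have h1 : ∀ i ∈ A, sec ρ y i = f i := fun i hi => by
      have := ht.1.sec_eq H.mono (hy i hi).1
      rwa [(hy i hi).2] at this
    exact ⟨(ht.isFlag H.mono).congr h1, by rw [← fset_congr h1, ht.fset_sec H.mono H.bot]⟩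
  by_cases hf : IsFlag ρ A f
  · have hc : chainCount ρ A A f = 1 := by
      rw [chainCount, Finset.card_eq_one]
      refine ⟨fset A f, ?_⟩
      ext y
      rw [Finset.mem_filter, Finset.mem_singleton]
      refine ⟨fun h => (key y h.2).2, ?_⟩
      rintro rfl
      exact ⟨Finset.mem_univ _, hf.hasType H.bot, fun i hi =>
        ⟨mem_fset.2 (Or.inr ⟨i, hi, rfl⟩), hf.1 i hi⟩⟩
    rw [hc, cycDim]
    symm
    let K : (ℕ → P) → ℝ := fun w => if ∀ i ∈ A, w i = f i then 1 else 0
    have hK : K ∈ Cyc ρ A A (A \ A) f := by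
      refine ⟨fun w w' h => ?_, fun w hw => ?_, fun j hj => by simp at hj⟩
      · have : (∀ i ∈ A, w i = f i) ↔ ∀ i ∈ A, w' i = f i :=
          forall₂_congr fun i hi => by rw [h i hi]
        simp only [K, this]
      · have hwA : ∀ i ∈ A, w i = f i := by
          by_contra h
          exact hw (if_neg h)
        exact ⟨hf.congr fun i hi => (hwA i hi).symm, hwA⟩
    have hKf : K f = 1 := if_pos fun _ _ => rfl
    refine finrank_eq_one (⟨K, hK⟩ : Cyc ρ A A (A \ A) f) ?_ fun L => ⟨L.1 f, ?_⟩
    · intro h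
      have : K f = 0 := congrFun (congrArg Subtype.val h) f
      rw [hKf] at this
      exact one_ne_zero this
    · refine Subtype.ext (funext fun w => ?_)
      change L.1 f * K w = L.1 w
      by_cases hw : ∀ i ∈ A, w i = f i
      · rw [show K w = 1 from if_pos hw, mul_one]
        exact L.2.1 _ _ fun i hi => (hw i hi).symm
      · rw [show K w = 0 from if_neg hw, mul_zero]
        by_contra h
        exact hw (L.2.2.1 w (Ne.symm h)).2
  · have hc : chainCount ρ A A f = 0 := by
      rw [chainCount, Finset.card_eq_zero, Finset.filter_eq_empty_iff]
      exact fun y _ h => hf (key y h).1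
    have hb : Cyc ρ A A (A \ A) f = ⊥ := by
      rw [eq_bot_iff]
      intro K hK
      rw [Submodule.mem_bot]
      funext w
      by_contra h
      exact hf (Cyc.isFlag hK h subset_rfl)
    rw [hc, cycDim, hb, finrank_bot]

lemma sum_chainCount_update (H : GorRank n ρ) {U A : Finset ℕ} {i : ℕ} (hi : i ∈ U) (hiA : i ∉ A)
    (f : ℕ → P) :
    chainCount ρ U A f = ∑ x, chainCount ρ U (insert i A) (Function.update f i x) := by
  rw [chainCount, Finset.card_eq_sum_card_fiberwise (f := fun y => sec ρ y i)
    (t := Finset.univ) fun _ _ => Finset.mem_coe.2 (Finset.mem_univ _)]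
  refine Finset.sum_congr rfl fun x _ => ?_
  rw [chainCount]
  congr 1
  ext y
  simp only [Finset.mem_filter, Finset.mem_univ, true_and, Finset.forall_mem_insert,
    Function.update_self]
  have h1 : (∀ k ∈ A, Function.update f i x k ∈ y ∧ ρ (Function.update f i x k) = k) ↔
      ∀ k ∈ A, f k ∈ y ∧ ρ (f k) = k := forall₂_congr fun k hk => by
    rw [Function.update_of_ne (ne_of_mem_of_not_mem hk hiA)]
  rw [h1]
  constructor
  · rintro ⟨⟨ht, hA⟩, rfl⟩
    exact ⟨ht, sec_spec (by rw [ht.2]; exact Finset.mem_insert_of_mem hi), hA⟩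
  · rintro ⟨ht, ⟨hxy, hx⟩, hA⟩
    refine ⟨⟨ht, hA⟩, ?_⟩
    have := ht.1.sec_eq H.mono hxy
    rwa [hx] at this

/-- Chains are counted by cycles. -/
lemma chainCount_eq_sum_cycDim (H : GorRank n ρ) (T : Finset ℕ) :
    ∀ (A : Finset ℕ) (f : ℕ → P), T ⊆ Finset.Icc 1 n → A ⊆ Finset.Icc 1 n → Disjoint A T →
    chainCount ρ (A ∪ T) A f = ∑ W ∈ T.powerset, cycDim ρ (A ∪ W) A f := by
  induction T using Finset.induction_on with
  | empty =>
    intro A f _ _ _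
    rw [Finset.powerset_empty, Finset.sum_singleton, Finset.union_empty, chainCount_self H]
  | insert i T hiT ih =>
    intro A f hT hA hAT
    rw [Finset.disjoint_insert_right] at hAT
    obtain ⟨hiA, hAT⟩ := hAT
    have hiI := hT (Finset.mem_insert_self i T)
    have hTI := (Finset.subset_insert i T).trans hT
    rw [sum_chainCount_update H (i := i) (by simp) hiA, Finset.sum_powerset_insert hiT,
      ← Finset.sum_add_distrib]
    have h1 : ∀ x, chainCount ρ (A ∪ insert i T) (insert i A) (Function.update f i x)
        = ∑ W ∈ T.powerset, cycDim ρ (insert i A ∪ W) (insert i A) (Function.update f i x) := by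
      intro x
      rw [← ih (insert i A) _ hTI (Finset.insert_subset hiI hA)
        (Finset.disjoint_insert_left.2 ⟨hiT, hAT⟩), Finset.insert_union, Finset.union_insert]
    simp only [h1]
    rw [Finset.sum_comm]
    refine Finset.sum_congr rfl fun W hW => ?_
    rw [Finset.mem_powerset] at hW
    rw [Finset.union_insert, add_comm, Finset.insert_union]
    refine sum_cycDim H (Finset.union_subset hA (hW.trans hTI)) Finset.subset_union_left hiI ?_ f
    rw [Finset.mem_union, not_or]
    exact ⟨hiA, fun h => hiT (hW h)⟩

/-- The word of length `m` with letters `b` on `U` and `a - b` elsewhere. -/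
noncomputable def diffWord : ℕ → Finset ℕ → NC
  | 0, _ => 1
  | m + 1, U => diffWord m U * (if m + 1 ∈ U then vb else va - vb)

lemma diffWord_congr {m : ℕ} {S T : Finset ℕ} (h : ∀ i, 1 ≤ i → i ≤ m → (i ∈ S ↔ i ∈ T)) :
    diffWord m S = diffWord m T := by
  induction m with
  | zero => rfl
  | succ m ih =>
    rw [diffWord, diffWord, ih fun i h1 h2 => h i h1 (by omega)]
    simp only [h (m + 1) (by omega) le_rfl]

lemma sum_diffWord (m : ℕ) (S : Finset ℕ) :
    ∑ U ∈ (Finset.Icc 1 m).powerset, (if S ∩ Finset.Icc 1 m ⊆ U then diffWord m U else 0)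
      = abWord m S := by
  induction m with
  | zero => simp [abWord, diffWord]
  | succ m ih =>
    rw [sum_powerset_Icc_succ, abWord, ← ih, Finset.sum_mul]
    refine Finset.sum_congr rfl fun U hU => ?_
    rw [Finset.mem_powerset] at hU
    have hmU : m + 1 ∉ U := fun h => by have := Finset.mem_Icc.1 (hU h); omega
    have e1 : diffWord m (insert (m + 1) U) = diffWord m U := diffWord_congr fun i _ h => by
      simp [show i ≠ m + 1 by omega]
    have e2 : S ∩ Finset.Icc 1 (m + 1) ⊆ insert (m + 1) U ↔ S ∩ Finset.Icc 1 m ⊆ U := by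
      constructor
      · intro h i hi
        obtain ⟨hi1, hi2⟩ := Finset.mem_inter.1 hi
        rw [Finset.mem_Icc] at hi2
        have := h (Finset.mem_inter.2 ⟨hi1, Finset.mem_Icc.2 ⟨hi2.1, by omega⟩⟩)
        rcases Finset.mem_insert.1 this with h | h
        · omega
        · exact h
      · intro h i hi
        obtain ⟨hi1, hi2⟩ := Finset.mem_inter.1 hi
        rw [Finset.mem_Icc] at hi2
        by_cases him : i = m + 1
        · simp [him]
        · exact Finset.mem_insert_of_mem
            (h (Finset.mem_inter.2 ⟨hi1, Finset.mem_Icc.2 ⟨hi2.1, by omega⟩⟩))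
    have e3 : S ∩ Finset.Icc 1 (m + 1) ⊆ U ↔ m + 1 ∉ S ∧ S ∩ Finset.Icc 1 m ⊆ U := by
      constructor
      · intro h
        refine ⟨fun h' => hmU (h (by simp [h'])), fun i hi => h ?_⟩
        exact Finset.inter_subset_inter_left
          (Finset.Icc_subset_Icc_right (Nat.le_succ m)) hi
      · rintro ⟨h1, h2⟩ i hi
        have := e2.2 h2 hi
        rcases Finset.mem_insert.1 this with rfl | h
        · exact absurd (Finset.mem_inter.1 hi).1 h1
        · exact h
    simp only [diffWord, e1, e2, e3, hmU, Finset.mem_insert_self, if_true, if_false]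
    by_cases h1 : m + 1 ∈ S <;> by_cases h2 : S ∩ Finset.Icc 1 m ⊆ U <;> simp [h1, h2, mul_sub]

lemma wtRanks_cons (l : List ℕ) : ∀ (r k : ℕ), (r :: l).Pairwise (· < ·) → (∀ i ∈ l, i ≤ r + k) →
    wtRanks (r + k + 1) (r :: l)
      = ((List.range' (r + 1) k).map fun i => if i ∈ l then vb else va - vb).prod := by
  induction l with
  | nil =>
    intro r k _ _
    rw [wtRanks]
    simp
  | cons s l ih =>
    intro r k hp hk
    rw [List.pairwise_cons] at hp
    have hrs := hp.1 s List.mem_cons_self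
    have hsk := hk s List.mem_cons_self
    have hp2 := List.pairwise_cons.1 hp.2
    have hsplit : List.range' (r + 1) k
        = List.range' (r + 1) (s - r - 1) ++ s :: List.range' (s + 1) (r + k - s) := by
      rw [← List.range'_succ]
      have h1 := List.range'_append (s := r + 1) (m := s - r - 1) (n := r + k - s + 1) (step := 1)
      rw [show r + 1 + 1 * (s - r - 1) = s by omega,
        show s - r - 1 + (r + k - s + 1) = k by omega] at h1
      exact h1.symm
    have e1 : (List.range' (r + 1) (s - r - 1)).map
        (fun i => if i ∈ s :: l then vb else va - vb)
        = List.replicate (s - r - 1) (va - vb) := by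
      rw [List.eq_replicate_iff]
      refine ⟨by simp, fun b hb => ?_⟩
      obtain ⟨i, hi, rfl⟩ := List.mem_map.1 hb
      rw [List.mem_range'_1] at hi
      rw [if_neg]
      intro h
      rcases List.mem_cons.1 h with h | h
      · omega
      · have := hp2.1 i h
        omega
    have e2 : (List.range' (s + 1) (r + k - s)).map (fun i => if i ∈ s :: l then vb else va - vb)
        = (List.range' (s + 1) (r + k - s)).map fun i => if i ∈ l then vb else va - vb := by
      refine List.map_congr_left fun i hi => ?_
      rw [List.mem_range'_1] at hi
      simp [show i ≠ s by omega]
    have h := ih s (r + k - s) hp.2 fun i hi => by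
      have := hk i (List.mem_cons_of_mem _ hi)
      omega
    rw [show s + (r + k - s) + 1 = r + k + 1 by omega] at h
    rw [wtRanks, h, hsplit, List.map_append, List.prod_append, e1, List.prod_replicate,
      List.map_cons, List.prod_cons, e2, if_pos List.mem_cons_self, mul_assoc]

lemma prod_range'_eq_diffWord (r : ℕ) (l : List ℕ) (U : Finset ℕ) (m : ℕ)
    (h : ∀ i, 1 ≤ i → i ≤ m → (r + i ∈ l ↔ i ∈ U)) :
    ((List.range' (r + 1) m).map fun i => if i ∈ l then vb else va - vb).prod = diffWord m U := by
  induction m with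
  | zero => simp [diffWord]
  | succ m ih =>
    rw [List.range'_1_concat, List.map_append, List.prod_append,
      ih fun i h1 h2 => h i h1 (by omega), diffWord, List.map_singleton, List.prod_singleton]
    have := h (m + 1) (by omega) le_rfl
    rw [show r + (m + 1) = r + 1 + m by omega] at this
    simp only [this]

lemma wtRanks_sort (r : ℕ) {U : Finset ℕ} (hU : U ⊆ Finset.Icc 1 n) (s : Finset ℕ)
    (hs : s = (insert 0 U).image (r + ·)) :
    wtRanks (r + n + 1) (s.sort (· ≤ ·)) = diffWord n U := by
  have hms : ∀ j, j ∈ s ↔ j = r ∨ ∃ i ∈ U, r + i = j := by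
    intro j
    rw [hs]
    simp [eq_comm]
  have hp : (s.sort (· ≤ ·)).Pairwise (· < ·) := Finset.sortedLT_sort s |>.pairwise
  have hm : ∀ j, j ∈ s.sort (· ≤ ·) ↔ j ∈ s := fun j => Finset.mem_sort _
  generalize s.sort (· ≤ ·) = L at hp hm
  have hrL : r ∈ L := (hm r).2 ((hms r).2 (Or.inl rfl))
  cases L with
  | nil => simp at hrL
  | cons x l =>
    have hp' := List.pairwise_cons.1 hp
    have hxr : r = x := by
      rcases List.mem_cons.1 hrL with h | h
      · exact h
      · have h1 := hp'.1 r h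
        rcases (hms x).1 ((hm x).1 List.mem_cons_self) with h2 | ⟨i, _, h2⟩ <;> omega
    subst hxr
    have hrl : r ∉ l := fun h => lt_irrefl _ (hp'.1 r h)
    rw [wtRanks_cons l r n hp fun i hi => ?_, prod_range'_eq_diffWord r l U n fun i h1 h2 => ?_]
    · have h3 : r + i ∈ l ↔ r + i ∈ r :: l := by
        simp [show i ≠ 0 by omega]
      rw [h3, hm, hms]
      simp [show i ≠ 0 by omega]
    · rcases (hms i).1 ((hm i).1 (List.mem_cons_of_mem _ hi)) with h | ⟨j, hj, h⟩
      · omega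
      · have := Finset.mem_Icc.1 (hU hj)
        omega

lemma absIndexOn_eq_sum_chainCount (H : GorRank n ρ) (rk : P → ℕ) (hrk : ∀ x, rk x = rk ⊥ + ρ x)
    (f : ℕ → P) :
    absIndexOn Set.univ ⊥ rk n
      = ∑ U ∈ (Finset.Icc 1 n).powerset, (chainCount ρ U ∅ f : ℚ) • diffWord n U := by
  have h1 : ∀ U, (chainCount ρ U ∅ f : ℚ) • diffWord n U
      = ∑ y : Finset P, if HasType ρ U y then diffWord n U else 0 := by
    intro U
    rw [← Finset.sum_filter, Finset.sum_const, chainCount, Nat.cast_smul_eq_nsmul]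
    simp
  simp only [h1]
  rw [Finset.sum_comm, absIndexOn]
  refine Finset.sum_congr rfl fun y _ => ?_
  split_ifs with hy
  · set U := (y.image ρ).erase 0 with hUd
    have h0 : 0 ∈ y.image ρ := Finset.mem_image.2 ⟨⊥, hy.1, H.bot⟩
    have hyU : y.image ρ = insert 0 U := (Finset.insert_erase h0).symm
    have hU : U ⊆ Finset.Icc 1 n := by
      intro i hi
      obtain ⟨h2, h3⟩ := Finset.mem_erase.1 hi
      obtain ⟨x, _, rfl⟩ := Finset.mem_image.1 h3
      exact Finset.mem_Icc.2 ⟨Nat.one_le_iff_ne_zero.2 h2, H.le x⟩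
    rw [Finset.sum_eq_single_of_mem U (Finset.mem_powerset.2 hU), if_pos ⟨hy, hyU⟩]
    · refine wtRanks_sort (rk ⊥) hU _ ?_
      rw [← hyU, Finset.image_image]
      exact Finset.image_congr fun x _ => hrk x
    · intro U' hU' hne
      rw [if_neg]
      intro h
      apply hne
      have h00 : 0 ∉ U' := zero_notMem_of_subset (Finset.mem_powerset.1 hU')
      rw [hUd, h.2, Finset.erase_insert h00]
  · exact (Finset.sum_eq_zero fun U _ => if_neg fun h => hy h.1).symm

lemma absIndexOn_eq_sum_cycDim (H : GorRank n ρ) (rk : P → ℕ) (hrk : ∀ x, rk x = rk ⊥ + ρ x)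
    (f : ℕ → P) :
    absIndexOn Set.univ ⊥ rk n
      = ∑ S ∈ (Finset.Icc 1 n).powerset, (cycDim ρ S ∅ f : ℚ) • abWord n S := by
  have h1 : ∀ S ∈ (Finset.Icc 1 n).powerset, (cycDim ρ S ∅ f : ℚ) • abWord n S
      = ∑ U ∈ (Finset.Icc 1 n).powerset,
        if S ⊆ U then (cycDim ρ S ∅ f : ℚ) • diffWord n U else 0 := by
    intro S hS
    rw [← sum_diffWord, Finset.smul_sum,
      Finset.inter_eq_left.2 (Finset.mem_powerset.1 hS)]
    exact Finset.sum_congr rfl fun U _ => by split_ifs <;> simp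
  rw [absIndexOn_eq_sum_chainCount H rk hrk f, Finset.sum_congr rfl h1, Finset.sum_comm]
  refine Finset.sum_congr rfl fun U hU => ?_
  have hU' := Finset.mem_powerset.1 hU
  have h2 := chainCount_eq_sum_cycDim H U ∅ f hU' (Finset.empty_subset _)
    (Finset.disjoint_empty_left _)
  simp only [Finset.empty_union] at h2
  rw [h2, Nat.cast_sum, Finset.sum_smul, ← Finset.sum_filter]
  refine Finset.sum_congr ?_ fun _ _ => rfl
  ext S
  rw [Finset.mem_filter, Finset.mem_powerset, Finset.mem_powerset]
  exact ⟨fun h => ⟨h.trans hU', h⟩, fun h => h.2⟩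

theorem GorRank.absIndexOn_mem_cdCone (H : GorRank n ρ) (rk : P → ℕ)
    (hrk : ∀ x, rk x = rk ⊥ + ρ x) : absIndexOn Set.univ ⊥ rk n ∈ cdCone := by
  obtain ⟨ε, O, hO, hne, hεO, hε⟩ := exists_multiplicative_cycle H
  have h : absIndexOn Set.univ ⊥ rk n = rankPoly n ε ⊥ n unitForm (fun _ => (⊥ : P)) := by
    rw [absIndexOn_eq_sum_cycDim H rk hrk fun _ => ⊥, rankPoly]
    refine Finset.sum_congr rfl fun S hS => ?_
    rw [Finset.mem_powerset] at hS
    rw [seqRank_flip (T := Finset.Icc 1 n \ S) ε ⊥ unitForm_flip _ fun i h1 h2 _ => by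
        simp [h1, h2],
      seqRank_eq_cycDim H hO hne hεO (Finset.empty_subset _) Finset.sdiff_subset,
      Finset.sdiff_empty, Finset.sdiff_sdiff_eq_self hS]
  rw [h]
  exact rankPoly_mem_cdCone ε ⊥ _ hε n le_rfl _ unitForm unitForm_flip
    (rankExact_unitForm H hO hne hεO)

end Counting

section GradedPosets

variable {P : Type*} [Fintype P] [PartialOrder P] [OrderBot P] {rk : P → ℕ} {n : ℕ}

lemma IsGradedOn.strictMono (h : IsGradedOn Set.univ ⊥ rk n) : StrictMono rk := by
  let _ : LocallyFiniteOrder P := Fintype.toLocallyFiniteOrder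
  refine (strictMono_iff_forall_covBy rk).2 fun a b hab => ?_
  have := h.2.2.1 a trivial b trivial hab.1 fun ⟨c, _, h1, h2⟩ => hab.2 h1 h2
  omega

lemma IsGradedOn.rank_le (h : IsGradedOn Set.univ ⊥ rk n) (x : P) : rk x ≤ rk ⊥ + n := by
  obtain ⟨b, hxb, hb⟩ := Set.toFinite (Set.univ : Set P) |>.exists_le_maximal (Set.mem_univ x)
  rw [← h.2.2.2 b trivial fun c _ hbc => hbc.not_ge (hb.2 trivial hbc.le)]
  exact h.strictMono.monotone hxb

lemma IsGorensteinStarOn.gorRank (h : IsGorensteinStarOn Set.univ ⊥ rk n) :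
    GorRank n fun x : P => rk x - rk ⊥ where
  gor := h.2
  mono := fun x y hxy => by
    have h1 := h.1.strictMono hxy
    have h2 := h.1.strictMono.monotone (bot_le (a := x))
    change rk x - rk ⊥ < rk y - rk ⊥
    omega
  bot := Nat.sub_self _
  le := fun x => by
    have := h.1.rank_le x
    omega

end GradedPosets

/-- **Theorem (Karu).** The `cd`-index of a Gorenstein* poset has non-negative integer
coefficients: if `Π` is a Gorenstein* poset of rank `n`, then its `ab`-index can be
written in terms of `c = a+b`, `d = ab+ba` with all coefficients non-negative integers. -/
theorem cd_index_nonneg_of_gorensteinStar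
    {P : Type*} [Fintype P] [PartialOrder P] [OrderBot P]
    (rk : P → ℕ) (n : ℕ)
    (hgor : IsGorensteinStarOn (Set.univ : Set P) (⊥ : P) rk n) :
    ∃ f : List Bool →₀ ℤ,
      absIndexOn (Set.univ : Set P) (⊥ : P) rk n = cdEval f ∧ ∀ w, 0 ≤ f w :=
  exists_cdEval_of_mem_cdCone <| hgor.gorRank.absIndexOn_mem_cdCone rk fun _ =>
    (Nat.add_sub_cancel' (hgor.1.strictMono.monotone bot_le)).symm
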